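/- There exists a constant C, depending only on n and Ω, such that for all maps u, v that are continuously differentiable up to the boundary of Ω with values in ℝ^n and every ψ ∈ C^1_c(Ω), one has |⟨Ju,ψ⟩ − ⟨Jv,ψ⟩| ≤ C ‖u−v‖_{W^{n/(n+1),n+1}(Ω)} (‖u‖_{W^{n/(n+1),n+1}(Ω)} + ‖v‖_{W^{n/(n+1),n+1}(Ω)})^{n−1} ‖ψ‖_{W^{n/(n+1),n+1}(Ω)}. -/

import Mathlib

open MeasureTheory Metric Filter Topology

noncomputable section

abbrev Euc (n : ℕ) := EuclideanSpace ℝ (Fin n)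

/-- The Jacobian matrix `∇u(x)` of a map `u : ℝⁿ → ℝⁿ`, with entries `∂_j u_i (x)`. -/
def jacMat (n : ℕ) (u : Euc n → Euc n) (x : Euc n) : Matrix (Fin n) (Fin n) ℝ :=
  Matrix.of fun i j => fderiv ℝ u x (EuclideanSpace.single j 1) i

/-- The vector field `j u := (1/n) (cof ∇u)ᵀ u` (componentwise); note that
`(cof A)ᵀ = adjugate A`. -/
def jvec (n : ℕ) (u : Euc n → Euc n) (x : Euc n) : Fin n → ℝ :=
  fun i => (n : ℝ)⁻¹ * Matrix.mulVec (Matrix.adjugate (jacMat n u x)) (fun j => u x j) i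

/-- The pointwise pairing `j u (x) · ∇ψ(x)`. -/
def jPair (n : ℕ) (u : Euc n → Euc n) (ψ : Euc n → ℝ) (x : Euc n) : ℝ :=
  ∑ i, jvec n u x i * fderiv ℝ ψ x (EuclideanSpace.single i 1)

/-- `ψ ∈ C¹_c(Ω)`. -/
def Cc1 (n : ℕ) (Ω : Set (Euc n)) (ψ : Euc n → ℝ) : Prop :=
  ContDiff ℝ 1 ψ ∧ HasCompactSupport ψ ∧ tsupport ψ ⊆ Ω

/-- The fractional Sobolev seminorm `[u]_{W^{s,p}(Ω)}`. -/
def sobSemi (n : ℕ) (s p : ℝ) (Ω : Set (Euc n)) {F : Type*} [NormedAddCommGroup F]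
    (u : Euc n → F) : ℝ :=
  (∫ x in Ω, ∫ y in Ω, ‖u x - u y‖ ^ p / dist x y ^ ((n : ℝ) + s * p)) ^ (1 / p)

/-- The fractional Sobolev norm `‖u‖_{W^{s,p}(Ω)} = ‖u‖_{L^p(Ω)} + [u]_{W^{s,p}(Ω)}`. -/
def sobNorm (n : ℕ) (s p : ℝ) (Ω : Set (Euc n)) {F : Type*} [NormedAddCommGroup F]
    (u : Euc n → F) : ℝ :=
  (∫ x in Ω, ‖u x‖ ^ p) ^ (1 / p) + sobSemi n s p Ω u

/-- Membership `u ∈ W^{s,p}(Ω; F)`: `u ∈ L^p(Ω)` and the double integral defining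
`[u]_{W^{s,p}(Ω)}^p` is finite. -/
def MemWsp (n : ℕ) (s p : ℝ) (Ω : Set (Euc n)) {F : Type*} [NormedAddCommGroup F]
    (u : Euc n → F) : Prop :=
  AEStronglyMeasurable u (volume.restrict Ω) ∧
  Integrable (fun x => ‖u x‖ ^ p) (volume.restrict Ω) ∧
  Integrable (fun q : Euc n × Euc n => ‖u q.1 - u q.2‖ ^ p / dist q.1 q.2 ^ ((n : ℝ) + s * p))
    ((volume.restrict Ω).prod (volume.restrict Ω))

/-- `Ω` has smooth boundary: it is a sublevel set of a smooth function whose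
differential does not vanish on the boundary. -/
def SmoothBoundary (n : ℕ) (Ω : Set (Euc n)) : Prop :=
  ∃ f : Euc n → ℝ, ContDiff ℝ (⊤ : ℕ∞) f ∧ Ω = f ⁻¹' Set.Iio 0 ∧
    ∀ x ∈ frontier Ω, fderiv ℝ f x ≠ 0

/-- `u^a(x) = (u(x) - a)/|u(x) - a|`. -/
def proj (n : ℕ) (u : Euc n → Euc n) (a : Euc n) : Euc n → Euc n :=
  fun x => ‖u x - a‖⁻¹ • (u x - a)

/-- The set of Hölder quotients of `u` on `Ω`. -/
def holderSet (n : ℕ) (α : ℝ) (Ω : Set (Euc n)) {F : Type*} [NormedAddCommGroup F]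
    (u : Euc n → F) : Set ℝ :=
  {r | ∃ x ∈ Ω, ∃ y ∈ Ω, x ≠ y ∧ r = ‖u x - u y‖ / dist x y ^ α}

/-- The Hölder seminorm `[u]_{C^{0,α}(Ω)}`. -/
def holderSemi (n : ℕ) (α : ℝ) (Ω : Set (Euc n)) {F : Type*} [NormedAddCommGroup F]
    (u : Euc n → F) : ℝ :=
  sSup (holderSet n α Ω u)

/-- The Hölder norm `‖u‖_{C^{0,α}(Ω)} = sup_Ω ‖u‖ + [u]_{C^{0,α}(Ω)}`. -/
def holderNorm (n : ℕ) (α : ℝ) (Ω : Set (Euc n)) {F : Type*} [NormedAddCommGroup F]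
    (u : Euc n → F) : ℝ :=
  sSup {r | ∃ x ∈ Ω, r = ‖u x‖} + holderSemi n α Ω u

/-- the volume `ω_n` of the unit ball of `ℝⁿ`. -/
def ballVol (n : ℕ) : ℝ := (volume (ball (0 : Euc n) 1)).toReal

/-- `⟨Jv, ψ⟩ = J` for `v ∈ W^{(n-1)/n, n}(Ω; ℝⁿ)`: approximating sequences of maps which are
`C¹` up to the boundary exist, and for every such sequence the Jacobian integrals converge
to `J`. -/
def JPairing (n : ℕ) (Ω : Set (Euc n)) (v : Euc n → Euc n) (ψ : Euc n → ℝ) (J : ℝ) : Prop :=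
  (∃ vk : ℕ → Euc n → Euc n, (∀ k, ContDiffOn ℝ 1 (vk k) (closure Ω)) ∧
      Tendsto (fun k => sobNorm n (((n : ℝ) - 1) / n) n Ω (vk k - v)) atTop (𝓝 0) ∧
      Tendsto (fun k => ∫ x in Ω, (jacMat n (vk k) x).det * ψ x) atTop (𝓝 J)) ∧
  (∀ vk : ℕ → Euc n → Euc n, (∀ k, ContDiffOn ℝ 1 (vk k) (closure Ω)) →
      Tendsto (fun k => sobNorm n (((n : ℝ) - 1) / n) n Ω (vk k - v)) atTop (𝓝 0) →
      Tendsto (fun k => ∫ x in Ω, (jacMat n (vk k) x).det * ψ x) atTop (𝓝 J))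

/-- The set of values `⟨Jv, ψ⟩` over test functions `ψ ∈ C¹_c(Ω)` with `|ψ| ≤ 1`;
its supremum is the total variation `|Jv|_{TV}`. -/
def TVset (n : ℕ) (Ω : Set (Euc n)) (v : Euc n → Euc n) : Set ℝ :=
  {r | ∃ ψ : Euc n → ℝ, Cc1 n Ω ψ ∧ (∀ x, |ψ x| ≤ 1) ∧ JPairing n Ω v ψ r}

/-- `⟨Jv, ψ⟩ = -∫_Ω j v · ∇ψ` for (pointwise defined) `v`. -/
def jpairOn (n : ℕ) (Ω : Set (Euc n)) (v : Euc n → Euc n) (ψ : Euc n → ℝ) : ℝ :=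
  -∫ x in Ω, jPair n v ψ x

/-- The `W^{-1,1}(Ω)` distance between two functionals on test functions:
`sup { S ψ - T ψ : ψ ∈ C¹_c(Ω), Lip ψ ≤ 1 }`. -/
def Wm11dist (n : ℕ) (Ω : Set (Euc n)) (S T : (Euc n → ℝ) → ℝ) : ℝ :=
  sSup {r | ∃ ψ : Euc n → ℝ, Cc1 n Ω ψ ∧ LipschitzWith 1 ψ ∧ r = S ψ - T ψ}

/-- basis vectors -/
abbrev bv (n : ℕ) (j : Fin n) : Euc n := EuclideanSpace.single j 1

/-- gradient matrix of a family of scalar functions -/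
def gmat (n : ℕ) (g : Fin n → Euc n → ℝ) (x : Euc n) : Matrix (Fin n) (Fin n) ℝ :=
  Matrix.of fun i j => fderiv ℝ (g i) x (bv n j)

lemma gmat_continuous (n : ℕ) (g : Fin n → Euc n → ℝ) (hg : ∀ i, ContDiff ℝ 1 (g i)) :
    Continuous (gmat n g) := by
  unfold gmat
  refine continuous_matrix fun i j => ?_
  simp only [Matrix.of_apply]
  exact ((hg i).continuous_fderiv (by norm_num)).clm_apply continuous_const

lemma poly_vanish {n : ℕ} (hn : 1 ≤ n) (a : Finset (Fin n) → ℝ) (c : ℝ)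
    (h : ∀ᶠ s in 𝓝 (0:ℝ), ∑ S : Finset (Fin n), s ^ S.card * a S = c) : a Finset.univ = 0 := by
  classical
  let Q : Polynomial ℝ := (∑ S : Finset (Fin n), Polynomial.C (a S) * Polynomial.X ^ S.card)
    - Polynomial.C c
  have hQ : Q = 0 := by
    apply Polynomial.eq_zero_of_infinite_isRoot
    have : {x | Q.IsRoot x} ∈ 𝓝 (0:ℝ) := by
      filter_upwards [h] with s hs
      simp only [Polynomial.IsRoot, Q, Polynomial.eval_sub,
        Polynomial.eval_finsetSum, Polynomial.eval_mul, Polynomial.eval_C, Polynomial.eval_pow,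
        Polynomial.eval_X]
      rw [← hs, sub_eq_zero]
      exact Finset.sum_congr rfl fun S _ => mul_comm _ _
    exact infinite_of_mem_nhds 0 this
  have h1 : Q.coeff n = a Finset.univ := by
    simp only [Q, Polynomial.coeff_sub, Polynomial.finsetSum_coeff, Polynomial.coeff_C_mul,
      Polynomial.coeff_X_pow, Polynomial.coeff_C]
    rw [if_neg (by omega), sub_zero, Finset.sum_eq_single Finset.univ]
    · simp
    · intro S _ hS
      rw [if_neg]; · simp
      intro h
      apply hS
      apply Finset.eq_univ_of_card
      simp [← h]
    · simp
  rw [← h1, hQ]; simp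

/-- rows of `J` on `S`, rows of the identity elsewhere -/
def pwMat {n : ℕ} (S : Finset (Fin n)) (J : Matrix (Fin n) (Fin n) ℝ) : Matrix (Fin n) (Fin n) ℝ :=
  Matrix.of fun i j => if i ∈ S then J i j else (1 : Matrix (Fin n) (Fin n) ℝ) i j

lemma det_expand {n : ℕ} (J : Matrix (Fin n) (Fin n) ℝ) (s : ℝ) :
    (1 + s • J).det = ∑ S : Finset (Fin n), s ^ S.card * (pwMat S J).det := by
  classical
  have := (Matrix.detRowAlternating (R := ℝ) (n := Fin n)).toMultilinearMap.map_add_univ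
    (fun i j => s * J i j) (fun i j => (1 : Matrix (Fin n) (Fin n) ℝ) i j)
  rw [add_comm]
  refine Eq.trans this ?_
  refine Finset.sum_congr rfl fun S _ => ?_
  have h2 : S.piecewise (fun i j => s * J i j) (fun i j => (1 : Matrix (Fin n) (Fin n) ℝ) i j) =
     S.piecewise (fun i => s • (fun i j => pwMat S J i j) i) (fun i j => pwMat S J i j) := by
    funext i j
    by_cases hi : i ∈ S <;> simp [hi, pwMat]
  have h3 := (Matrix.detRowAlternating (R := ℝ) (n := Fin n)).toMultilinearMap.map_piecewise_smul
    (fun _ => s) (fun i j => pwMat S J i j) S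
  rw [h2]
  refine Eq.trans h3 ?_
  simp only [Finset.prod_const, smul_eq_mul]
  rfl

theorem integral_det_zero (n : ℕ) (hn : 1 ≤ n) (g : Fin n → Euc n → ℝ)
    (hg : ∀ i, ContDiff ℝ 1 (g i)) (hc : ∀ i, HasCompactSupport (g i)) :
    ∫ x, (gmat n g x).det = 0 := by
  classical
  -- the vector map
  let G : Euc n → Euc n := fun x => WithLp.toLp 2 (fun i => g i x)
  have hG : ContDiff ℝ 1 G := by
    rw [contDiff_euclidean]
    exact hg
  have hGc : HasCompactSupport G := by
    have hK : IsCompact (⋃ i, tsupport (g i)) := isCompact_iUnion fun i => hc i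
    refine HasCompactSupport.intro hK fun x hx => ?_
    ext i
    simp only [Set.mem_iUnion, not_exists] at hx
    simpa [G] using image_eq_zero_of_notMem_tsupport (hx i)
  obtain ⟨K, hK⟩ := hG.lipschitzWith_of_hasCompactSupport hGc (by norm_num)
  obtain ⟨R, hR0, hR⟩ : ∃ R : ℝ, 0 < R ∧ tsupport G ⊆ ball 0 R := by
    obtain ⟨R, hR⟩ := hGc.isBounded.subset_ball (0 : Euc n)
    exact ⟨max R 1, by positivity, hR.trans (ball_subset_ball (le_max_left _ _))⟩
  have hGout : ∀ x ∉ ball (0 : Euc n) R, G x = 0 := fun x hx =>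
    image_eq_zero_of_notMem_tsupport fun h => hx (hR h)
  have hJc := gmat_continuous n g hg
  -- derivative of the perturbation
  have hder : ∀ (s : ℝ) (x : Euc n), HasFDerivAt (fun x => x + s • G x)
      (ContinuousLinearMap.id ℝ (Euc n) + s • fderiv ℝ G x) x := fun s x =>
    (hasFDerivAt_id x).add (((hG.differentiable (by norm_num)) x).hasFDerivAt.const_smul s)
  have hentry : ∀ x i j, fderiv ℝ G x (bv n j) i = gmat n g x i j := by
    intro x i j
    have h1 : HasFDerivAt (fun y => G y i) ((EuclideanSpace.proj i).comp (fderiv ℝ G x)) x :=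
      (EuclideanSpace.proj (𝕜 := ℝ) i).hasFDerivAt.comp x
        ((hG.differentiable (by norm_num)) x).hasFDerivAt
    have h2 : fderiv ℝ (g i) x = (EuclideanSpace.proj i).comp (fderiv ℝ G x) := h1.fderiv
    simp [gmat, h2]
  have hdet : ∀ (s : ℝ) (x : Euc n),
      (ContinuousLinearMap.id ℝ (Euc n) + s • fderiv ℝ G x).det = (1 + s • gmat n g x).det := by
    intro s x
    rw [ContinuousLinearMap.det]
    rw [← LinearMap.det_toMatrix (EuclideanSpace.basisFun (Fin n) ℝ).toBasis]
    congr 1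
    ext i j
    rw [LinearMap.toMatrix_apply]
    have := hentry x i j
    simp only [OrthonormalBasis.coe_toBasis, EuclideanSpace.basisFun_apply,
      OrthonormalBasis.coe_toBasis_repr_apply, EuclideanSpace.basisFun_repr,
      Matrix.add_apply, Matrix.smul_apply, ← this]
    simp [Matrix.one_apply]
  have hcont : Continuous fun q : ℝ × Euc n => (1 + q.1 • gmat n g q.2).det := by
    apply Continuous.matrix_det
    exact continuous_const.add (continuous_fst.smul (hJc.comp continuous_snd))
  have hpos : ∀ᶠ s in 𝓝 (0:ℝ), ∀ x ∈ closedBall (0 : Euc n) R, 0 < (1 + s • gmat n g x).det := by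
    refine (isCompact_closedBall (0 : Euc n) R).eventually_forall_of_forall_eventually ?_
    intro x _
    have : 0 < (1 + ((0:ℝ), x).1 • gmat n g ((0:ℝ), x).2).det := by simp
    exact hcont.continuousAt.eventually (lt_mem_nhds this)
  have hsmall : ∀ᶠ s in 𝓝 (0:ℝ), |s| * (K:ℝ) ≤ 1/2 := by
    have : Tendsto (fun s : ℝ => |s| * (K:ℝ)) (𝓝 0) (𝓝 (|(0:ℝ)| * (K:ℝ))) :=
      (continuous_abs.mul continuous_const).tendsto 0
    simp only [abs_zero, zero_mul] at this
    exact (this.eventually (gt_mem_nhds (show (0:ℝ) < 1/2 by norm_num))).mono fun s h => h.le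
  have hvol : ∀ᶠ s in 𝓝 (0:ℝ), ∫ x in ball (0 : Euc n) R, (1 + s • gmat n g x).det =
      (volume (ball (0 : Euc n) R)).toReal := by
    filter_upwards [hpos, hsmall] with s hs1 hs2
    set F : Euc n → Euc n := fun x => x + s • G x with hF
    have hlip : ∀ x y, ‖s • G x - s • G y‖ ≤ 1/2 * ‖x - y‖ := by
      intro x y
      rw [← smul_sub, norm_smul, Real.norm_eq_abs]
      have := hK.dist_le_mul x y
      rw [dist_eq_norm, dist_eq_norm] at this
      calc |s| * ‖G x - G y‖ ≤ |s| * (K * ‖x - y‖) := by gcongr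
        _ = (|s| * K) * ‖x - y‖ := by ring
        _ ≤ _ := by gcongr
    have hinj : Function.Injective F := by
      intro x y hxy
      have h1 : x - y = -(s • G x - s • G y) := by
        simp only [hF] at hxy
        rw [← sub_eq_zero] at hxy ⊢
        rw [← hxy]; abel
      have h2 := hlip x y
      rw [← norm_neg, ← h1] at h2
      have : ‖x - y‖ ≤ 0 := by linarith
      exact sub_eq_zero.1 (norm_le_zero_iff.1 this)
    have hsurj : Function.Surjective F := by
      intro y
      have hcw : ContractingWith (1/2) (fun x => y - s • G x) := by
        refine ⟨by rw [← NNReal.coe_lt_coe]; norm_num, LipschitzWith.of_dist_le_mul fun a b => ?_⟩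
        have := hlip b a
        rw [dist_eq_norm, dist_eq_norm, norm_sub_rev a b]
        simpa using this
      refine ⟨hcw.fixedPoint, ?_⟩
      have : y - s • G hcw.fixedPoint = hcw.fixedPoint := hcw.fixedPoint_isFixedPt
      simp only [hF]
      nth_rewrite 1 [← this]
      abel
    have hFout : ∀ x ∉ ball (0 : Euc n) R, F x = x := fun x hx => by simp [hF, hGout x hx]
    have himg : F '' ball 0 R = ball 0 R := by
      ext y
      constructor
      · rintro ⟨x, hx, rfl⟩
        by_contra h
        exact h (by rw [hinj (hFout _ h)]; exact hx)
      · intro hy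
        obtain ⟨x, rfl⟩ := hsurj y
        refine ⟨x, ?_, rfl⟩
        by_contra h
        rw [hFout x h] at hy
        exact h hy
    have hcv := integral_image_eq_integral_abs_det_fderiv_smul volume
      (measurableSet_ball : MeasurableSet (ball (0 : Euc n) R))
      (fun x _ => (hder s x).hasFDerivWithinAt) hinj.injOn (fun _ => (1:ℝ))
    rw [himg] at hcv
    simp only [integral_const, smul_eq_mul, mul_one, Measure.real,
      Measure.restrict_apply MeasurableSet.univ, Set.univ_inter] at hcv
    rw [hcv]
    refine setIntegral_congr_fun measurableSet_ball fun x hx => ?_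
    rw [hdet, abs_of_pos (hs1 x (ball_subset_closedBall hx))]
  have hSc : ∀ S : Finset (Fin n), Continuous fun x => (pwMat S (gmat n g x)).det := by
    intro S
    apply Continuous.matrix_det
    refine continuous_matrix fun i j => ?_
    by_cases hi : i ∈ S
    · simpa [hi, pwMat] using hJc.matrix_elem i j
    · simpa [hi, pwMat] using continuous_const
  have hfin : ∀ᶠ s in 𝓝 (0:ℝ), ∑ S : Finset (Fin n), s ^ S.card *
      (∫ x in ball (0 : Euc n) R, (pwMat S (gmat n g x)).det) =
      (volume (ball (0 : Euc n) R)).toReal := by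
    filter_upwards [hvol] with s hs
    rw [← hs]
    simp_rw [det_expand]
    rw [integral_finsetSum]
    · simp_rw [integral_const_mul]
    · intro S _
      apply Integrable.const_mul
      exact ((hSc S).continuousOn.integrableOn_compact (isCompact_closedBall (0 : Euc n) R)).mono_set
        ball_subset_closedBall
  have := poly_vanish hn _ _ hfin
  have hu : ∀ x, pwMat Finset.univ (gmat n g x) = gmat n g x := by
    intro x; ext i j; simp [pwMat]
  simp only [hu] at this
  refine Eq.trans ?_ this
  symm
  apply setIntegral_eq_integral_of_forall_compl_eq_zero
  intro x hx
  have hz : gmat n g x = 0 := by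
    ext i j
    rw [← hentry]
    have : x ∉ tsupport G := fun h => hx (hR h)
    rw [fderiv_of_notMem_tsupport (𝕜 := ℝ) this]
    simp
  rw [hz]
  haveI : Nonempty (Fin n) := ⟨⟨0, hn⟩⟩
  simp [Matrix.det_zero]

/-- `C¹` with compact support -/
def CC (n : ℕ) (g : Euc n → ℝ) : Prop := ContDiff ℝ 1 g ∧ HasCompactSupport g

lemma CC.sub {n : ℕ} {f g : Euc n → ℝ} (hf : CC n f) (hg : CC n g) : CC n (fun x => f x - g x) :=
  ⟨hf.1.sub hg.1, hf.2.sub hg.2⟩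

lemma CC.mul {n : ℕ} {f g : Euc n → ℝ} (hf : CC n f) (hg : CC n g) : CC n (fun x => f x * g x) :=
  ⟨hf.1.mul hg.1, hf.2.mul_right⟩

lemma CC.diff {n : ℕ} {f : Euc n → ℝ} (hf : CC n f) (x : Euc n) : DifferentiableAt ℝ f x :=
  (hf.1.differentiable (by norm_num)) x

lemma CC.integrable_mul {n : ℕ} {f : Euc n → ℝ} (hf : CC n f) {h : Euc n → ℝ}
    (hh : Continuous h) : Integrable (fun x => f x * h x) :=
  (hf.1.continuous.mul hh).integrable_of_hasCompactSupport hf.2.mul_right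

lemma det_gmat_continuous {n : ℕ} {g : Fin n → Euc n → ℝ} (hg : ∀ i, CC n (g i)) :
    Continuous fun x => (gmat n g x).det :=
  (gmat_continuous n g fun i => (hg i).1).matrix_det

lemma gmat_update {n : ℕ} (g : Fin n → Euc n → ℝ) (i : Fin n) (h : Euc n → ℝ) (x : Euc n) :
    gmat n (Function.update g i h) x = (gmat n g x).updateRow i (fun j => fderiv ℝ h x (bv n j)) := by
  ext k j
  by_cases hk : k = i
  · subst hk; simp [gmat]
  · simp [gmat, hk]

lemma CC.update {n : ℕ} {g : Fin n → Euc n → ℝ} (hg : ∀ i, CC n (g i)) (i : Fin n)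
    {h : Euc n → ℝ} (hh : CC n h) : ∀ k, CC n (Function.update g i h k) := by
  intro k
  by_cases hk : k = i
  · subst hk; simpa using hh
  · simpa [hk] using hg k

theorem stokes {n : ℕ} (hn : 1 ≤ n) {g : Fin n → Euc n → ℝ} (hg : ∀ i, CC n (g i))
    {ψ : Euc n → ℝ} (hψ : CC n ψ) (i : Fin n) :
    ∫ x, ψ x * (gmat n g x).det =
      - ∫ x, g i x * (gmat n (Function.update g i ψ) x).det := by
  have hu := CC.update hg i ((hg i).mul hψ)
  have h0 := integral_det_zero n hn _ (fun k => (hu k).1) (fun k => (hu k).2)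
  have hpt : ∀ x, (gmat n (Function.update g i fun x => g i x * ψ x) x).det =
      ψ x * (gmat n g x).det + g i x * (gmat n (Function.update g i ψ) x).det := by
    intro x
    rw [gmat_update, gmat_update]
    have hf : fderiv ℝ (fun x => g i x * ψ x) x = g i x • fderiv ℝ ψ x + ψ x • fderiv ℝ (g i) x :=
      ((hg i).diff x).hasFDerivAt.mul (hψ.diff x).hasFDerivAt |>.fderiv
    have : (fun j => fderiv ℝ (fun x => g i x * ψ x) x (bv n j)) =
        g i x • (fun j => fderiv ℝ ψ x (bv n j)) + ψ x • (gmat n g x i) := by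
      funext j
      rw [hf]
      simp [gmat]
    rw [this, Matrix.det_updateRow_add, Matrix.det_updateRow_smul, Matrix.det_updateRow_smul,
      Matrix.updateRow_eq_self]
    ring
  simp_rw [hpt] at h0
  rw [integral_add] at h0
  · linarith
  · exact hψ.integrable_mul (det_gmat_continuous hg)
  · exact (hg i).integrable_mul (det_gmat_continuous (CC.update hg i hψ))

/-- interpolating family -/
def tele {n : ℕ} {α : Type*} [Sub α] (a b : Fin n → α) (i j : Fin n) : α :=
  if j < i then a j else if j = i then a j - b j else b j

lemma det_sub_det {n : ℕ} (A B : Matrix (Fin n) (Fin n) ℝ) :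
    A.det - B.det = ∑ i, (Matrix.of (tele (fun k => A k) (fun k => B k) i)).det := by
  have h := (Matrix.detRowAlternating (R := ℝ) (n := Fin n)).toMultilinearMap.map_piecewise_sub_map_piecewise
    (fun k => A k) (fun k => B k) (fun k => B k) Finset.univ
  simp only [Finset.piecewise_univ, Finset.mem_univ, if_true] at h
  exact h

lemma gmat_tele {n : ℕ} {a b : Fin n → Euc n → ℝ} (ha : ∀ i x, DifferentiableAt ℝ (a i) x)
    (hb : ∀ i x, DifferentiableAt ℝ (b i) x) (i : Fin n) (x : Euc n) :
    gmat n (tele a b i) x =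
      Matrix.of (tele (fun k => gmat n a x k) (fun k => gmat n b x k) i) := by
  ext k j
  simp only [gmat, tele, Matrix.of_apply]
  split_ifs with h1 h2
  · rfl
  · rw [fderiv_sub (ha k x) (hb k x)]; rfl
  · rfl

lemma det_bound {n : ℕ} (A : Matrix (Fin n) (Fin n) ℝ) (Y : ℝ) (h : ∀ i j, |A i j| ≤ Y) :
    |A.det| ≤ n.factorial * Y ^ n := by
  have := Matrix.det_le (A := A) (abv := AbsoluteValue.abs) (x := Y) h
  simpa using this

theorem diff_bound {n : ℕ} (hn : 1 ≤ n) {a b : Fin n → Euc n → ℝ} {α β : Euc n → ℝ}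
    (ha : ∀ i, CC n (a i)) (hb : ∀ i, CC n (b i)) (hα : CC n α) (hβ : CC n β)
    {S : Set (Euc n)} (hS : MeasurableSet S) (hαS : tsupport α ⊆ S) (hβS : tsupport β ⊆ S)
    (X Y : Euc n → ℝ) (hX0 : ∀ i, ∀ x ∈ S, |a i x - b i x| ≤ X x)
    (hX1 : ∀ x ∈ S, |α x - β x| ≤ X x)
    (hYa : ∀ i j, ∀ x ∈ S, |fderiv ℝ (a i) x (bv n j)| ≤ Y x)
    (hYb : ∀ i j, ∀ x ∈ S, |fderiv ℝ (b i) x (bv n j)| ≤ Y x)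
    (hYβ : ∀ j, ∀ x ∈ S, |fderiv ℝ β x (bv n j)| ≤ Y x) :
    ENNReal.ofReal |(∫ x, α x * (gmat n a x).det) - ∫ x, β x * (gmat n b x).det| ≤
      ∫⁻ x in S, ENNReal.ofReal ((n + 1) * n.factorial * (X x * Y x ^ n)) := by
  have ht : ∀ i k, CC n (tele a b i k) := by
    intro i k
    unfold tele
    split_ifs
    · exact ha k
    · exact (ha k).sub (hb k)
    · exact hb k
  set H : Euc n → ℝ := fun x => (α x - β x) * (gmat n a x).det -
    ∑ i, (a i x - b i x) * (gmat n (Function.update (tele a b i) i β) x).det with hH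
  have hint : ∀ i, Integrable fun x =>
      (a i x - b i x) * (gmat n (Function.update (tele a b i) i β) x).det := fun i =>
    ((ha i).sub (hb i)).integrable_mul (det_gmat_continuous (CC.update (ht i) i hβ))
  have hTT : (∫ x, α x * (gmat n a x).det) - ∫ x, β x * (gmat n b x).det = ∫ x, H x := by
    rw [hH, integral_sub ((hα.sub hβ).integrable_mul (det_gmat_continuous ha))
      (integrable_finsetSum _ fun i _ => hint i), integral_finsetSum _ fun i _ => hint i]
    have h1 : ∀ i, ∫ x, (a i x - b i x) * (gmat n (Function.update (tele a b i) i β) x).det =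
        - ∫ x, β x * (gmat n (tele a b i) x).det := by
      intro i
      rw [stokes hn (ht i) hβ i, neg_neg]
      simp [tele]
    simp_rw [h1]
    rw [Finset.sum_neg_distrib, sub_neg_eq_add, ← integral_finsetSum _ fun i _ =>
      hβ.integrable_mul (det_gmat_continuous (ht i)), ← integral_add
        ((hα.sub hβ).integrable_mul (det_gmat_continuous ha))
        (integrable_finsetSum _ fun i _ => hβ.integrable_mul (det_gmat_continuous (ht i))),
      ← integral_sub (hα.integrable_mul (det_gmat_continuous ha))
        (hβ.integrable_mul (det_gmat_continuous hb))]
    refine integral_congr_ae (Eventually.of_forall fun x => ?_)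
    simp only
    rw [← Finset.mul_sum]
    have : ∑ i, (gmat n (tele a b i) x).det = (gmat n a x).det - (gmat n b x).det := by
      rw [det_sub_det]
      refine Finset.sum_congr rfl fun i _ => ?_
      rw [gmat_tele (fun i x => (ha i).diff x) (fun i x => (hb i).diff x)]
    rw [this]
    ring
  have hout : ∀ x ∉ S, H x = 0 := by
    intro x hx
    have h1 : α x = 0 := image_eq_zero_of_notMem_tsupport fun h => hx (hαS h)
    have h2 : x ∉ tsupport β := fun h => hx (hβS h)
    have h3 : β x = 0 := image_eq_zero_of_notMem_tsupport h2
    have h4 : ∀ i, (gmat n (Function.update (tele a b i) i β) x).det = 0 := by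
      intro i
      apply Matrix.det_eq_zero_of_row_eq_zero i
      intro j
      simp [gmat, fderiv_of_notMem_tsupport (𝕜 := ℝ) h2]
    simp [hH, h1, h3, h4]
  have hbd : ∀ x ∈ S, |H x| ≤ (n + 1) * n.factorial * (X x * Y x ^ n) := by
    intro x hx
    have hXn : 0 ≤ X x := (abs_nonneg _).trans (hX1 x hx)
    have hYn : 0 ≤ Y x := (abs_nonneg _).trans (hYβ ⟨0, hn⟩ x hx)
    have hd1 : |(gmat n a x).det| ≤ n.factorial * Y x ^ n := det_bound _ _ fun i j => hYa i j x hx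
    have hd2 : ∀ i, |(gmat n (Function.update (tele a b i) i β) x).det| ≤
        n.factorial * Y x ^ n := by
      intro i
      refine det_bound _ _ fun k j => ?_
      by_cases hk : k = i
      · subst hk; simpa [gmat] using hYβ j x hx
      · simp only [gmat, Matrix.of_apply, Function.update_of_ne hk, tele]
        rw [if_neg hk]
        split_ifs
        · exact hYa _ _ x hx
        · exact hYb _ _ x hx
    have hs : |∑ i, (a i x - b i x) * (gmat n (Function.update (tele a b i) i β) x).det| ≤
        n * (X x * (n.factorial * Y x ^ n)) := by
      refine (Finset.abs_sum_le_sum_abs _ _).trans ?_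
      have : ∀ i ∈ Finset.univ, |(a i x - b i x) * (gmat n (Function.update (tele a b i) i β) x).det|
          ≤ X x * (n.factorial * Y x ^ n) := by
        intro i _
        rw [abs_mul]
        exact mul_le_mul (hX0 i x hx) (hd2 i) (abs_nonneg _) hXn
      refine (Finset.sum_le_sum this).trans ?_
      simp
    have hf : |(α x - β x) * (gmat n a x).det| ≤ X x * (n.factorial * Y x ^ n) := by
      rw [abs_mul]
      exact mul_le_mul (hX1 x hx) hd1 (abs_nonneg _) hXn
    calc |H x| ≤ _ := abs_sub _ _
      _ ≤ _ := add_le_add hf hs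
      _ = _ := by ring
  rw [hTT, ← setIntegral_eq_integral_of_forall_compl_eq_zero hout]
  rw [← Real.enorm_eq_ofReal_abs]
  refine (enorm_integral_le_lintegral_enorm _).trans ?_
  refine setLIntegral_mono' hS fun x hx => ?_
  rw [Real.enorm_eq_ofReal_abs]
  exact ENNReal.ofReal_le_ofReal (hbd x hx)

/-- mollifier data -/
structure Moll (n : ℕ) (φ : Euc n → ℝ) (B : ℝ) : Prop where
  cd : ContDiff ℝ 1 φ
  supp : tsupport φ ⊆ closedBall 0 1
  one : ∫ z, φ z = 1
  bpos : 0 < B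
  b0 : ∀ z, |φ z| ≤ B
  b1 : ∀ j z, |fderiv ℝ φ z (bv n j)| ≤ B
  b2 : ∀ j z, |fderiv ℝ (fun z : Euc n => z j * φ z) z (bv n j)| ≤ B

lemma contDiff_coord {n : ℕ} (j : Fin n) : ContDiff ℝ 1 (fun z : Euc n => z j) :=
  (EuclideanSpace.proj (𝕜 := ℝ) j).contDiff

lemma bounded_partial {n : ℕ} {g : Euc n → ℝ} (hg : CC n g) (v : Euc n) :
    ∃ M, ∀ x, |fderiv ℝ g x v| ≤ M := by
  have hc : Continuous fun x => fderiv ℝ g x v :=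
    (hg.1.continuous_fderiv (by norm_num)).clm_apply continuous_const
  have hs : HasCompactSupport fun x => fderiv ℝ g x v := hg.2.fderiv_apply (𝕜 := ℝ) v
  obtain ⟨M, hM⟩ := hs.exists_bound_of_continuous hc
  exact ⟨M, fun x => hM x⟩

lemma exists_moll (n : ℕ) : ∃ φ B, Moll n φ B := by
  let b : ContDiffBump (0 : Euc n) := ⟨1/2, 1, by norm_num, by norm_num⟩
  let φ := b.normed volume
  have hcd : ContDiff ℝ 1 φ := b.contDiff_normed
  have hcs : HasCompactSupport φ := b.hasCompactSupport_normed
  have hsup : tsupport φ ⊆ closedBall 0 1 := (b.tsupport_normed_eq).subset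
  obtain ⟨B0, hB0⟩ := hcs.exists_bound_of_continuous hcd.continuous
  choose B1 hB1 using fun j => bounded_partial (g := φ) ⟨hcd, hcs⟩ (bv n j)
  have hz : ∀ j, CC n (fun z : Euc n => z j * φ z) := fun j =>
    ⟨(contDiff_coord j).mul hcd, hcs.mul_left⟩
  choose B2 hB2 using fun j => bounded_partial (hz j) (bv n j)
  have hB1' : ∀ j, B1 j ≤ ∑ j, |B1 j| := fun j => (le_abs_self _).trans
    (Finset.single_le_sum (f := fun j => |B1 j|) (fun _ _ => abs_nonneg _) (Finset.mem_univ j))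
  have hB2' : ∀ j, B2 j ≤ ∑ j, |B2 j| := fun j => (le_abs_self _).trans
    (Finset.single_le_sum (f := fun j => |B2 j|) (fun _ _ => abs_nonneg _) (Finset.mem_univ j))
  have p1 : 0 ≤ ∑ j, |B1 j| := Finset.sum_nonneg fun _ _ => abs_nonneg _
  have p2 : 0 ≤ ∑ j, |B2 j| := Finset.sum_nonneg fun _ _ => abs_nonneg _
  have p0 := le_abs_self B0
  have p00 := abs_nonneg B0
  refine ⟨φ, 1 + |B0| + (∑ j, |B1 j|) + ∑ j, |B2 j|, ⟨hcd, hsup, b.integral_normed, ?_, ?_, ?_, ?_⟩⟩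
  · positivity
  · intro z; have := hB0 z; rw [Real.norm_eq_abs] at this; linarith
  · intro j z; have := hB1 j z; have := hB1' j; linarith
  · intro j z; have := hB2 j z; have := hB2' j; linarith

lemma Moll.cs {n : ℕ} {φ : Euc n → ℝ} {B : ℝ} (h : Moll n φ B) : HasCompactSupport φ :=
  HasCompactSupport.of_support_subset_isCompact (isCompact_closedBall (0 : Euc n) 1)
    ((subset_tsupport _).trans h.supp)

/-- average of `w` at scale `r x` -/
def avg {n : ℕ} (φ : Euc n → ℝ) (r : Euc n → ℝ) (w : Euc n → ℝ) (x : Euc n) : ℝ :=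
  ∫ z, w (x + r x • z) * φ z

/-- mean oscillation -/
def Dav {n : ℕ} (r : Euc n → ℝ) (w : Euc n → ℝ) (x : Euc n) : ℝ :=
  ∫ z in closedBall (0 : Euc n) 1, |w (x + r x • z) - w x|

lemma Dav_nonneg {n : ℕ} (r : Euc n → ℝ) (w : Euc n → ℝ) (x : Euc n) : 0 ≤ Dav r w x :=
  integral_nonneg fun _ => abs_nonneg _

lemma osc_integrable {n : ℕ} (r : Euc n → ℝ) {w : Euc n → ℝ} (hw : Continuous w) (x : Euc n) :
    IntegrableOn (fun z => |w (x + r x • z) - w x|) (closedBall (0 : Euc n) 1) := by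
  exact (by fun_prop : Continuous fun z => |w (x + r x • z) - w x|).continuousOn.integrableOn_compact
    (isCompact_closedBall 0 1)

lemma abs_integral_le_Dav {n : ℕ} (r : Euc n → ℝ) {w : Euc n → ℝ} (hw : Continuous w) (x : Euc n)
    {B : ℝ} {h : Euc n → ℝ} (hs : ∀ z ∉ closedBall (0 : Euc n) 1, h z = 0) (hB : ∀ z, |h z| ≤ B) :
    |∫ z, (w (x + r x • z) - w x) * h z| ≤ B * Dav r w x := by
  rw [← setIntegral_eq_integral_of_forall_compl_eq_zero (s := closedBall (0 : Euc n) 1)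
    (fun z hz => by rw [hs z hz, mul_zero])]
  rw [Dav, ← integral_const_mul]
  rw [← Real.norm_eq_abs]
  refine norm_integral_le_of_norm_le ((osc_integrable r hw x).const_mul B) ?_
  refine Eventually.of_forall fun z => ?_
  rw [norm_mul, Real.norm_eq_abs, Real.norm_eq_abs, mul_comm]
  exact mul_le_mul_of_nonneg_right (hB z) (abs_nonneg _)

lemma avg_sub {n : ℕ} {φ : Euc n → ℝ} {B : ℝ} (hφ : Moll n φ B) (r : Euc n → ℝ)
    {w : Euc n → ℝ} (hw : Continuous w) (x : Euc n) :
    |avg φ r w x - w x| ≤ B * Dav r w x := by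
  have h1 : avg φ r w x - w x = ∫ z, (w (x + r x • z) - w x) * φ z := by
    simp_rw [sub_mul]
    rw [integral_sub, integral_const_mul, hφ.one, mul_one]; · rfl
    · exact Continuous.integrable_of_hasCompactSupport
        ((by fun_prop : Continuous fun z => w (x + r x • z)).mul hφ.cd.continuous) hφ.cs.mul_left
    · exact (hφ.cd.continuous.integrable_of_hasCompactSupport hφ.cs).const_mul _
  rw [h1]
  exact abs_integral_le_Dav r hw x
    (fun z hz => image_eq_zero_of_notMem_tsupport fun h => hz (hφ.supp h)) hφ.b0

lemma ibp_Dav {n : ℕ} {η : Euc n → ℝ} (hη : CC n η) (hs : tsupport η ⊆ closedBall 0 1)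
    {B : ℝ} (j : Fin n) (hB : ∀ z, |fderiv ℝ η z (bv n j)| ≤ B) (r : Euc n → ℝ)
    {w : Euc n → ℝ} (hw : CC n w) (x : Euc n) (hr : 0 < r x) :
    |∫ z, fderiv ℝ w (x + r x • z) (bv n j) * η z| ≤ (r x)⁻¹ * (B * Dav r w x) := by
  set f : Euc n → ℝ := fun z => w (x + r x • z) - w x with hf
  have hfd : ∀ z, HasFDerivAt f ((fderiv ℝ w (x + r x • z)).comp
      (r x • ContinuousLinearMap.id ℝ (Euc n))) z := by
    intro z
    have h1 : HasFDerivAt (fun z : Euc n => x + r x • z) (r x • ContinuousLinearMap.id ℝ (Euc n)) z :=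
      ((hasFDerivAt_id z).const_smul (r x)).const_add x
    exact ((hw.diff (x + r x • z)).hasFDerivAt.comp z h1).sub_const _
  have hfe : ∀ z, fderiv ℝ f z (bv n j) = r x * fderiv ℝ w (x + r x • z) (bv n j) := by
    intro z
    rw [(hfd z).fderiv]
    simp
  have hfc : Continuous f := by
    have := hw.1.continuous
    fun_prop
  have hwc : Continuous fun z => fderiv ℝ w (x + r x • z) (bv n j) :=
    ((hw.1.continuous_fderiv (by norm_num)).comp (by fun_prop)).clm_apply continuous_const
  have hηc : Continuous fun z => fderiv ℝ η z (bv n j) :=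
    (hη.1.continuous_fderiv (by norm_num)).clm_apply continuous_const
  have key := integral_mul_fderiv_eq_neg_fderiv_mul_of_integrable (μ := volume) (f := f) (g := η)
    (v := bv n j) ?_ ?_ ?_ (fun z _ => (hfd z).differentiableAt) (fun z _ => hη.diff z)
  · simp_rw [hfe, mul_assoc] at key
    rw [integral_const_mul] at key
    have hb := abs_integral_le_Dav (B := B) r hw.1.continuous x (h := fun z => fderiv ℝ η z (bv n j))
      (fun z hz => by
        rw [fderiv_of_notMem_tsupport (𝕜 := ℝ) (fun h => hz (hs h))]; rfl) hB
    change |∫ z, f z * fderiv ℝ η z (bv n j)| ≤ _ at hb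
    rw [key, abs_neg, abs_mul, abs_of_pos hr] at hb
    rw [← div_eq_inv_mul, le_div_iff₀ hr, mul_comm]
    exact hb
  · simp_rw [hfe]
    exact ((continuous_const.mul hwc).mul hη.1.continuous).integrable_of_hasCompactSupport
      hη.2.mul_left
  · exact (hfc.mul hηc).integrable_of_hasCompactSupport
      (HasCompactSupport.mul_left (hη.2.fderiv_apply (𝕜 := ℝ) _))
  · exact (hfc.mul hη.1.continuous).integrable_of_hasCompactSupport hη.2.mul_left

/-- derivative integrand -/
def avgD {n : ℕ} (φ : Euc n → ℝ) (r : Euc n → ℝ) (w : Euc n → ℝ) (x z : Euc n) : Euc n →L[ℝ] ℝ :=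
  φ z • (fderiv ℝ w (x + r x • z)).comp
    (ContinuousLinearMap.id ℝ (Euc n) + (fderiv ℝ r x).smulRight z)

lemma avgD_bound {n : ℕ} (φ : Euc n → ℝ) {r : Euc n → ℝ} (hr1 : ∀ x, ‖fderiv ℝ r x‖ ≤ 1)
    {w : Euc n → ℝ} {M : ℝ} (hM : ∀ x, ‖fderiv ℝ w x‖ ≤ M) (x z : Euc n) :
    ‖avgD φ r w x z‖ ≤ |φ z| * (M * (1 + ‖z‖)) := by
  unfold avgD
  rw [norm_smul, Real.norm_eq_abs]
  refine mul_le_mul_of_nonneg_left ?_ (abs_nonneg _)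
  refine (ContinuousLinearMap.opNorm_comp_le _ _).trans ?_
  refine mul_le_mul (hM _) ?_ (norm_nonneg _) ((norm_nonneg _).trans (hM x))
  refine (norm_add_le _ _).trans ?_
  refine add_le_add ContinuousLinearMap.norm_id_le ?_
  rw [ContinuousLinearMap.norm_smulRight_apply]
  exact mul_le_of_le_one_left (norm_nonneg _) (hr1 x)

lemma avgD_continuous {n : ℕ} {φ : Euc n → ℝ} (hφ : Continuous φ) {r : Euc n → ℝ}
    (hr : ContDiff ℝ 1 r) {w : Euc n → ℝ} (hw : ContDiff ℝ 1 w) :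
    Continuous fun q : Euc n × Euc n => avgD φ r w q.1 q.2 := by
  unfold avgD
  have h1 := hr.continuous_fderiv (by norm_num)
  have h2 := hw.continuous_fderiv (by norm_num)
  have h3 := hr.continuous
  refine (hφ.comp continuous_snd).smul ?_
  have h4 : Continuous fun q : Euc n × Euc n => (fderiv ℝ r q.1).smulRight q.2 := by
    have := ((ContinuousLinearMap.smulRightL ℝ (Euc n) (Euc n)).continuous.comp
      (h1.comp continuous_fst)).clm_apply continuous_snd
    exact this
  exact (h2.comp (by fun_prop : Continuous fun q : Euc n × Euc n => q.1 + r q.1 • q.2)).clm_comp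
    (continuous_const.add h4)

lemma avg_hasFDerivAt {n : ℕ} {φ : Euc n → ℝ} {B : ℝ} (hφ : Moll n φ B) {r : Euc n → ℝ}
    (hr : ContDiff ℝ 1 r) (hr1 : ∀ x, ‖fderiv ℝ r x‖ ≤ 1) {w : Euc n → ℝ} (hw : CC n w)
    (x : Euc n) : HasFDerivAt (avg φ r w) (∫ z, avgD φ r w x z) x := by
  obtain ⟨M, hM⟩ := (hw.2.fderiv (𝕜 := ℝ)).exists_bound_of_continuous
    (hw.1.continuous_fderiv (by norm_num))
  have hc := avgD_continuous hφ.cd.continuous hr hw.1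
  have hrc := hr.continuous
  have hwc := hw.1.continuous
  have hφc := hφ.cd.continuous
  refine hasFDerivAt_integral_of_dominated_of_fderiv_le (s := Set.univ)
    (bound := fun z => |φ z| * (M * (1 + ‖z‖))) univ_mem ?_ ?_ ?_ ?_ ?_ ?_
  · refine Eventually.of_forall fun y => Continuous.aestronglyMeasurable ?_
    fun_prop
  · exact Continuous.integrable_of_hasCompactSupport (by fun_prop) hφ.cs.mul_left
  · exact (hc.comp (by fun_prop : Continuous fun z : Euc n => (x, z))).aestronglyMeasurable
  · exact Eventually.of_forall fun z y _ => avgD_bound φ hr1 hM y z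
  · exact Continuous.integrable_of_hasCompactSupport (by fun_prop) (hφ.cs.norm.mul_right)
  · refine Eventually.of_forall fun z y _ => ?_
    have h1 : HasFDerivAt (fun y => y + r y • z)
        (ContinuousLinearMap.id ℝ (Euc n) + (fderiv ℝ r y).smulRight z) y :=
      (hasFDerivAt_id y).add
        (((hr.differentiable (by norm_num)) y).hasFDerivAt.smul_const z)
    exact ((hw.diff _).hasFDerivAt.comp y h1).mul_const (φ z)

lemma avg_CC {n : ℕ} {φ : Euc n → ℝ} {B : ℝ} (hφ : Moll n φ B) {r : Euc n → ℝ}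
    (hr : ContDiff ℝ 1 r) (hr1 : ∀ x, ‖fderiv ℝ r x‖ ≤ 1) {w : Euc n → ℝ} (hw : CC n w)
    {M : ℝ} (hrM : ∀ x, |r x| ≤ M) : CC n (avg φ r w) := by
  constructor
  · obtain ⟨M, hM⟩ := (hw.2.fderiv (𝕜 := ℝ)).exists_bound_of_continuous
      (hw.1.continuous_fderiv (by norm_num))
    have hc := avgD_continuous hφ.cd.continuous hr hw.1
    have hφc := hφ.cd.continuous
    rw [contDiff_one_iff_hasFDerivAt]
    refine ⟨fun x => ∫ z, avgD φ r w x z, ?_, avg_hasFDerivAt hφ hr hr1 hw⟩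
    refine continuous_of_dominated (bound := fun z => |φ z| * (M * (1 + ‖z‖))) ?_ ?_ ?_ ?_
    · intro x
      exact (hc.comp (by fun_prop : Continuous fun z : Euc n => (x, z))).aestronglyMeasurable
    · intro x
      exact Eventually.of_forall fun z => avgD_bound φ hr1 hM x z
    · exact Continuous.integrable_of_hasCompactSupport (by fun_prop) (hφ.cs.norm.mul_right)
    · exact Eventually.of_forall fun z =>
        hc.comp (by fun_prop : Continuous fun x : Euc n => (x, z))
  · have hM0 : 0 ≤ M := (abs_nonneg _).trans (hrM 0)
    have hK : IsCompact (cthickening M (tsupport w)) := hw.2.isCompact.cthickening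
    refine HasCompactSupport.intro hK fun x hx => ?_
    unfold avg
    rw [integral_eq_zero_of_ae]
    refine Eventually.of_forall fun z => ?_
    simp only [Pi.zero_apply]
    by_cases hz : z ∈ closedBall (0 : Euc n) 1
    · have : w (x + r x • z) = 0 := by
        apply image_eq_zero_of_notMem_tsupport
        intro h
        apply hx
        refine mem_cthickening_of_dist_le x _ _ _ h ?_
        rw [dist_eq_norm]
        simp only [sub_add_cancel_left, norm_neg, norm_smul, Real.norm_eq_abs]
        rw [mem_closedBall_zero_iff] at hz
        calc |r x| * ‖z‖ ≤ M * 1 := mul_le_mul (hrM x) hz (norm_nonneg _) hM0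
          _ = M := mul_one M
      rw [this, zero_mul]
    · rw [image_eq_zero_of_notMem_tsupport (f := φ) fun h => hz (hφ.supp h), mul_zero]

lemma avg_fderiv_bound {n : ℕ} {φ : Euc n → ℝ} {B : ℝ} (hφ : Moll n φ B) {r : Euc n → ℝ}
    (hr : ContDiff ℝ 1 r) (hr1 : ∀ x, ‖fderiv ℝ r x‖ ≤ 1) {w : Euc n → ℝ} (hw : CC n w)
    (x : Euc n) (hx : 0 < r x) (i : Fin n) :
    |fderiv ℝ (avg φ r w) x (bv n i)| ≤ (n + 1) * B * ((r x)⁻¹ * Dav r w x) := by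
  have hφc := hφ.cd.continuous
  have hc := avgD_continuous hφ.cd.continuous hr hw.1
  have hint : Integrable (avgD φ r w x) := by
    refine Continuous.integrable_of_hasCompactSupport
      (hc.comp (by fun_prop : Continuous fun z : Euc n => (x, z))) ?_
    unfold avgD
    exact hφ.cs.smul_right
  have hwc : ∀ j, Continuous fun z => fderiv ℝ w (x + r x • z) (bv n j) := fun j =>
    ((hw.1.continuous_fderiv (by norm_num)).comp (by fun_prop)).clm_apply continuous_const
  have hint1 : ∀ j, Integrable fun z => fderiv ℝ w (x + r x • z) (bv n j) * φ z := fun j =>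
    ((hwc j).mul hφc).integrable_of_hasCompactSupport hφ.cs.mul_left
  have hcc : ∀ j, CC n fun z : Euc n => z j * φ z := fun j =>
    ⟨(contDiff_coord j).mul hφ.cd, hφ.cs.mul_left⟩
  have hint2 : ∀ j, Integrable fun z => fderiv ℝ w (x + r x • z) (bv n j) * (z j * φ z) := fun j =>
    ((hwc j).mul (hcc j).1.continuous).integrable_of_hasCompactSupport (hcc j).2.mul_left
  have hexp : ∀ z, avgD φ r w x z (bv n i) = fderiv ℝ w (x + r x • z) (bv n i) * φ z +
      fderiv ℝ r x (bv n i) * ∑ j, fderiv ℝ w (x + r x • z) (bv n j) * (z j * φ z) := by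
    intro z
    have hz : z = ∑ j, z j • bv n j := by
      have := (EuclideanSpace.basisFun (Fin n) ℝ).sum_repr z
      simpa using this.symm
    have h2 : fderiv ℝ w (x + r x • z) z = ∑ j, z j * fderiv ℝ w (x + r x • z) (bv n j) := by
      conv_lhs => rw [hz]
      rw [map_sum]
      simp only [map_smul, smul_eq_mul]
      rw [← hz]
    simp only [avgD, ContinuousLinearMap.smul_apply, ContinuousLinearMap.comp_apply,
      ContinuousLinearMap.add_apply, ContinuousLinearMap.id_apply,
      ContinuousLinearMap.smulRight_apply, map_add, map_smul, smul_eq_mul, h2]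
    rw [mul_add, mul_comm (φ z), Finset.mul_sum, Finset.mul_sum, Finset.mul_sum]
    congr 1
    refine Finset.sum_congr rfl fun j _ => by ring
  have hformula : fderiv ℝ (avg φ r w) x (bv n i) =
      (∫ z, fderiv ℝ w (x + r x • z) (bv n i) * φ z) +
      fderiv ℝ r x (bv n i) * ∑ j, ∫ z, fderiv ℝ w (x + r x • z) (bv n j) * (z j * φ z) := by
    rw [(avg_hasFDerivAt hφ hr hr1 hw x).fderiv, ContinuousLinearMap.integral_apply hint]
    simp_rw [hexp]
    rw [integral_add (hint1 i) ((integrable_finsetSum _ fun j _ => hint2 j).const_mul _),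
      integral_const_mul, integral_finsetSum _ fun j _ => hint2 j]
  have hri : |fderiv ℝ r x (bv n i)| ≤ 1 := by
    have := (fderiv ℝ r x).le_of_opNorm_le (hr1 x) (bv n i)
    simpa using this
  have hsupp2 : ∀ j, tsupport (fun z : Euc n => z j * φ z) ⊆ closedBall 0 1 := fun j =>
    (tsupport_mul_subset_right).trans hφ.supp
  have e1 := ibp_Dav (⟨hφ.cd, hφ.cs⟩ : CC n φ) hφ.supp i (hφ.b1 i) r hw x hx
  have e2 := fun j => ibp_Dav (hcc j) (hsupp2 j) j (hφ.b2 j) r hw x hx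
  rw [hformula]
  have e3 : |fderiv ℝ r x (bv n i) *
      ∑ j, ∫ z, fderiv ℝ w (x + r x • z) (bv n j) * (z j * φ z)| ≤
      n * ((r x)⁻¹ * (B * Dav r w x)) := by
    rw [abs_mul]
    refine (mul_le_of_le_one_left (abs_nonneg _) hri).trans ?_
    refine (Finset.abs_sum_le_sum_abs _ _).trans ?_
    refine (Finset.sum_le_sum fun j _ => e2 j).trans ?_
    simp
  calc _ ≤ _ := abs_add_le _ _
    _ ≤ _ := add_le_add e1 e3
    _ = _ := by ring

/-- a regularised boundary distance -/
structure Bdy (n : ℕ) (Ω : Set (Euc n)) (ρ : Euc n → ℝ) (L c : ℝ) : Prop where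
  cd : ContDiff ℝ 2 ρ
  cs : HasCompactSupport ρ
  pos : ∀ x, x ∈ Ω ↔ 0 < ρ x
  d1 : ∀ x, ‖fderiv ℝ ρ x‖ ≤ 1 / 2
  b : ∀ x, |ρ x| ≤ 1
  d2 : ∀ i x, |fderiv ℝ (fun y => fderiv ℝ ρ y (bv n i)) x (bv n i)| ≤ L
  cpos : 0 < c
  low : ∀ x ∈ closure Ω, c ≤ ρ x + ∑ i, (fderiv ℝ ρ x (bv n i)) ^ 2

lemma cc_partial {n : ℕ} {ρ : Euc n → ℝ} (h : ContDiff ℝ 2 ρ) (hs : HasCompactSupport ρ)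
    (i : Fin n) : CC n (fun y => fderiv ℝ ρ y (bv n i)) :=
  ⟨(h.fderiv_right (m := 1) (by norm_num)).clm_apply contDiff_const, hs.fderiv_apply (𝕜 := ℝ) _⟩

lemma eq_zero_of_partials {n : ℕ} (A : Euc n →L[ℝ] ℝ) (h : ∀ i, A (bv n i) = 0) : A = 0 := by
  ext z
  have hz : z = ∑ j, z j • bv n j := by
    have := (EuclideanSpace.basisFun (Fin n) ℝ).sum_repr z
    simpa using this.symm
  rw [hz, map_sum]
  simp [h]

lemma exists_bdy (n : ℕ) (Ω : Set (Euc n)) (hΩo : IsOpen Ω)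
    (hΩb : Bornology.IsBounded Ω) (hΩs : SmoothBoundary n Ω) : ∃ ρ L c, Bdy n Ω ρ L c := by
  obtain ⟨f, hf, hfΩ, hfr⟩ := hΩs
  have hf2 : ContDiff ℝ 2 f := hf.of_le (by exact WithTop.coe_le_coe.2 (le_top : (2 : ℕ∞) ≤ ⊤))
  obtain ⟨R, hR0, hR⟩ := (hΩb.closure).subset_ball_lt 0 0
  let χ : ContDiffBump (0 : Euc n) := ⟨R, R + 1, hR0, by linarith⟩
  have hχ1 : ∀ x ∈ ball (0 : Euc n) R, χ x = 1 := fun x hx =>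
    χ.one_of_mem_closedBall (ball_subset_closedBall hx)
  have hχcd : ContDiff ℝ 2 χ := χ.contDiff
  let ρ0 : Euc n → ℝ := fun x => χ x * (- f x)
  have h0cd : ContDiff ℝ 2 ρ0 := hχcd.mul hf2.neg
  have h0cs : HasCompactSupport ρ0 := χ.hasCompactSupport.mul_right
  obtain ⟨M0, hM0⟩ := h0cs.exists_bound_of_continuous h0cd.continuous
  obtain ⟨M1, hM1⟩ := (h0cs.fderiv (𝕜 := ℝ)).exists_bound_of_continuous
    (h0cd.continuous_fderiv (by norm_num))
  have hM0p : 0 ≤ M0 := (norm_nonneg _).trans (hM0 0)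
  have hM1p : 0 ≤ M1 := (norm_nonneg _).trans (hM1 0)
  set κ : ℝ := (2 * (1 + M0 + M1))⁻¹ with hκ
  have hκp : 0 < κ := by positivity
  let ρ : Euc n → ℝ := fun x => κ * ρ0 x
  have hcd : ContDiff ℝ 2 ρ := contDiff_const.mul h0cd
  have hcs : HasCompactSupport ρ := h0cs.mul_left
  choose B hB using fun i => bounded_partial (cc_partial hcd hcs i) (bv n i)
  have hpos : ∀ x, x ∈ Ω ↔ 0 < ρ x := by
    intro x
    constructor
    · intro hx
      have h1 : f x < 0 := by rw [hfΩ] at hx; exact hx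
      have h2 := hχ1 x (hR (subset_closure hx))
      simp only [ρ, ρ0, h2, one_mul]
      exact mul_pos hκp (by linarith)
    · intro hx
      have h1 : 0 < χ x * (- f x) := (mul_pos_iff_of_pos_left hκp).1 hx
      have h2 : 0 < - f x := by
        by_contra h
        have := mul_nonpos_of_nonneg_of_nonpos (χ.nonneg (x := x)) (not_lt.1 h)
        linarith
      rw [hfΩ]; show f x < 0; linarith
  have hfd : ∀ x, fderiv ℝ ρ x = κ • fderiv ℝ ρ0 x := fun x =>
    fderiv_const_mul (h0cd.differentiable (by norm_num) x) κ
  have hlow : ∃ c, 0 < c ∧ ∀ x ∈ closure Ω, c ≤ ρ x + ∑ i, (fderiv ℝ ρ x (bv n i)) ^ 2 := by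
    have hK : IsCompact (closure Ω) := hΩb.isCompact_closure
    rcases (closure Ω).eq_empty_or_nonempty with he | hne
    · exact ⟨1, one_pos, by simp [he]⟩
    have hcont : Continuous fun x => ρ x + ∑ i, (fderiv ℝ ρ x (bv n i)) ^ 2 :=
      hcd.continuous.add (continuous_finsetSum _ fun i _ =>
        ((cc_partial hcd hcs i).1.continuous).pow 2)
    obtain ⟨x0, hx0, hmin⟩ := hK.exists_isMinOn hne hcont.continuousOn
    refine ⟨_, ?_, fun x hx => hmin hx⟩
    have hs0 : 0 ≤ ∑ i, (fderiv ℝ ρ x0 (bv n i)) ^ 2 := Finset.sum_nonneg fun _ _ => sq_nonneg _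
    by_cases hxΩ : x0 ∈ Ω
    · have := (hpos x0).1 hxΩ
      linarith
    · have hxf : x0 ∈ frontier Ω := ⟨hx0, by rwa [hΩo.interior_eq]⟩
      have hd := hfr x0 hxf
      have hρ0 : 0 ≤ ρ x0 := by
        have hcl : IsClosed {x | 0 ≤ ρ x} := isClosed_le continuous_const hcd.continuous
        exact closure_minimal (fun x hx => ((hpos x).1 hx).le) hcl hx0
      have hloc : ρ =ᶠ[𝓝 x0] fun x => (-κ) * f x := by
        filter_upwards [isOpen_ball.mem_nhds (hR hx0)] with x hx
        simp only [ρ, ρ0, hχ1 x hx]; ring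
      have hfe : fderiv ℝ ρ x0 = (-κ) • fderiv ℝ f x0 := by
        rw [hloc.fderiv_eq]
        exact fderiv_const_mul (hf2.differentiable (by norm_num) x0) _
      have hne0 : fderiv ℝ ρ x0 ≠ 0 := by
        rw [hfe]; exact smul_ne_zero (neg_ne_zero.2 hκp.ne') hd
      have : ∃ i, fderiv ℝ ρ x0 (bv n i) ≠ 0 := by
        by_contra! h
        exact hne0 (eq_zero_of_partials _ h)
      obtain ⟨i, hi⟩ := this
      have := Finset.single_le_sum (f := fun i => (fderiv ℝ ρ x0 (bv n i)) ^ 2)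
        (fun _ _ => sq_nonneg _) (Finset.mem_univ i)
      have h3 : 0 < (fderiv ℝ ρ x0 (bv n i)) ^ 2 := by positivity
      linarith
  obtain ⟨c, hc, hlow⟩ := hlow
  refine ⟨ρ, ∑ i, |B i|, c, ⟨hcd, hcs, hpos, ?_, ?_, ?_, hc, hlow⟩⟩
  · intro x
    rw [hfd, norm_smul, Real.norm_eq_abs, abs_of_pos hκp, hκ]
    rw [inv_mul_le_iff₀ (by positivity)]
    have := hM1 x
    linarith
  · intro x
    simp only [ρ]
    rw [abs_mul, abs_of_pos hκp, hκ, inv_mul_le_iff₀ (by positivity)]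
    have := hM0 x
    rw [Real.norm_eq_abs] at this
    linarith
  · intro i x
    exact (hB i x).trans ((le_abs_self _).trans
      (Finset.single_le_sum (f := fun j => |B j|) (fun _ _ => abs_nonneg _) (Finset.mem_univ i)))

lemma Bdy.lip {n : ℕ} {Ω : Set (Euc n)} {ρ : Euc n → ℝ} {L c : ℝ} (h : Bdy n Ω ρ L c)
    (x y : Euc n) : |ρ x - ρ y| ≤ 1 / 2 * ‖x - y‖ := by
  have := Convex.norm_image_sub_le_of_norm_fderiv_le (𝕜 := ℝ) (f := ρ) (s := Set.univ)
    (fun x _ => h.cd.differentiable (by norm_num) x) (fun x _ => h.d1 x) convex_univ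
    (Set.mem_univ y) (Set.mem_univ x)
  exact this

lemma cont_mul_supp {n : ℕ} {a b : Euc n → ℝ} {U : Set (Euc n)} (hU : IsOpen U)
    (ha : Continuous a) (hs : tsupport a ⊆ U) (hb : ContinuousOn b U) :
    Continuous fun x => a x * b x := by
  refine continuous_of_tsupport fun x hx => ?_
  have hx' : x ∈ tsupport a := (tsupport_mul_subset_left) hx
  exact ha.continuousAt.mul (hb.continuousAt (hU.mem_nhds (hs hx')))

lemma CC.absPow {n : ℕ} (hn : 1 ≤ n) {g : Euc n → ℝ} (hg : CC n g) :
    CC n (fun x => |g x| ^ (n + 1)) ∧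
    ∀ x v, |fderiv ℝ (fun x => |g x| ^ (n + 1)) x v| ≤ (n + 1) * |g x| ^ n * |fderiv ℝ g x v| := by
  have hp : (1 : ℝ) < (n + 1 : ℕ) := by exact_mod_cast Nat.lt_succ_of_le hn
  have he : (fun x => |g x| ^ (n + 1)) = fun x => ‖g x‖ ^ ((n + 1 : ℕ) : ℝ) := by
    funext x; rw [Real.rpow_natCast, Real.norm_eq_abs]
  refine ⟨⟨?_, ?_⟩, ?_⟩
  · rw [he]; exact hg.1.norm_rpow hp
  · exact hg.2.comp_left (g := fun t : ℝ => |t| ^ (n + 1)) (by simp)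
  · intro x v
    have h1 := (hasDerivAt_abs_rpow (g x) hp).comp_hasFDerivAt x (hg.diff x).hasFDerivAt
    have he2 : (fun x => |g x| ^ (n + 1)) = (fun t : ℝ => |t| ^ ((n + 1 : ℕ) : ℝ)) ∘ g := by
      funext x; simp only [Function.comp]; rw [Real.rpow_natCast]
    rw [he2, h1.fderiv]
    simp only [FunLike.coe_smul, Pi.smul_apply, smul_eq_mul, abs_mul]
    refine mul_le_mul_of_nonneg_right ?_ (abs_nonneg _)
    rw [mul_assoc]
    rw [abs_of_pos (by positivity : (0 : ℝ) < (n + 1 : ℕ))]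
    push_cast
    refine mul_le_mul_of_nonneg_left ?_ (by positivity)
    rw [abs_of_nonneg (Real.rpow_nonneg (abs_nonneg _) _)]
    by_cases h0 : |g x| = 0
    · rw [h0, mul_zero]; positivity
    · have hpos : 0 < |g x| := lt_of_le_of_ne (abs_nonneg _) (Ne.symm h0)
      have : |g x| ^ ((n : ℝ) + 1 - 2) * |g x| = |g x| ^ (n : ℝ) := by
        rw [← Real.rpow_add_one hpos.ne']; ring_nf
      rw [this, Real.rpow_natCast]

lemma young {n : ℕ} {a b η : ℝ} (ha : 0 ≤ a) (hb : 0 ≤ b) (hη : 0 < η) :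
    a ^ n * b ≤ η * a ^ (n + 1) + (η⁻¹) ^ n * b ^ (n + 1) := by
  rcases le_total b (η * a) with h | h
  · have : a ^ n * b ≤ a ^ n * (η * a) := mul_le_mul_of_nonneg_left h (by positivity)
    have h2 : a ^ n * (η * a) = η * a ^ (n + 1) := by ring
    have h3 : 0 ≤ (η⁻¹) ^ n * b ^ (n + 1) := by positivity
    linarith
  · have h1 : a ≤ η⁻¹ * b := by rw [← div_eq_inv_mul, le_div_iff₀ hη]; linarith
    have : a ^ n * b ≤ (η⁻¹ * b) ^ n * b :=
      mul_le_mul_of_nonneg_right (pow_le_pow_left₀ ha h1 n) hb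
    have h2 : (η⁻¹ * b) ^ n * b = (η⁻¹) ^ n * b ^ (n + 1) := by ring
    have h3 : 0 ≤ η * a ^ (n + 1) := by positivity
    linarith

/-- pointwise inequality used in the Hardy inequality -/
lemma hardy_pointwise {m : ℕ} (c K1 K2 : ℝ) (hc : 0 < c) (hK1 : 0 < K1) (hK2 : 0 < K2)
    (r a G : ℝ) (hr : 0 < r) (ha : 0 ≤ a) (hG : 0 ≤ G) :
    c * (a ^ (m + 2) * (r⁻¹) ^ (m + 1)) ≤
      4⁻¹ * c * (a ^ (m + 2) * (r⁻¹) ^ (m + 1)) + 4⁻¹ * c * (a ^ (m + 2) * (r⁻¹) ^ (m + 1))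
      + (c * (a ^ (m + 2) * (r⁻¹) ^ (m + 1)) - K1 * (a ^ (m + 2) * (r⁻¹) ^ m)
        - K2 * (a ^ (m + 1) * G * (r⁻¹) ^ m))
      + (K1 * (4 * K1 / c) ^ m * a ^ (m + 2) +
        K2 * ((c / (4 * K2))⁻¹) ^ (m + 1) * (r * G ^ (m + 2))) := by
  have h1 : K1 * (a ^ (m + 2) * (r⁻¹) ^ m) ≤ 4⁻¹ * c * (a ^ (m + 2) * (r⁻¹) ^ (m + 1)) +
      K1 * (4 * K1 / c) ^ m * a ^ (m + 2) := by
    rcases le_total (K1 * r) (4⁻¹ * c) with h | h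
    · have e : K1 * (a ^ (m + 2) * (r⁻¹) ^ m) = (K1 * r) * (a ^ (m + 2) * (r⁻¹) ^ (m + 1)) := by
        rw [pow_succ r⁻¹]; field_simp
      rw [e]
      have := mul_le_mul_of_nonneg_right h
        (by positivity : 0 ≤ a ^ (m + 2) * (r⁻¹) ^ (m + 1))
      have h3 : 0 ≤ K1 * (4 * K1 / c) ^ m * a ^ (m + 2) := by positivity
      linarith
    · have h2 : r⁻¹ ≤ 4 * K1 / c := by
        rw [inv_le_comm₀ hr (by positivity), inv_div, div_le_iff₀ (by positivity)]
        linarith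
      have h4 : K1 * (a ^ (m + 2) * (r⁻¹) ^ m) ≤ K1 * (a ^ (m + 2) * (4 * K1 / c) ^ m) := by
        gcongr
      have h5 : 0 ≤ 4⁻¹ * c * (a ^ (m + 2) * (r⁻¹) ^ (m + 1)) := by positivity
      linarith
  have h2 : K2 * (a ^ (m + 1) * G * (r⁻¹) ^ m) ≤ 4⁻¹ * c * (a ^ (m + 2) * (r⁻¹) ^ (m + 1)) +
      K2 * ((c / (4 * K2))⁻¹) ^ (m + 1) * (r * G ^ (m + 2)) := by
    have hy := young (n := m + 1) (a := a) (b := r * G) (η := c / (4 * K2)) ha (by positivity)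
      (by positivity)
    have hy2 := mul_le_mul_of_nonneg_left hy (by positivity : 0 ≤ K2 * (r⁻¹) ^ (m + 1))
    have e1 : K2 * (r⁻¹) ^ (m + 1) * (a ^ (m + 1) * (r * G)) =
        K2 * (a ^ (m + 1) * G * (r⁻¹) ^ m) := by
      rw [pow_succ r⁻¹]; field_simp
    have e2 : K2 * (r⁻¹) ^ (m + 1) * (c / (4 * K2) * a ^ (m + 1 + 1)) =
        4⁻¹ * c * (a ^ (m + 2) * (r⁻¹) ^ (m + 1)) := by field_simp
    have e3 : K2 * (r⁻¹) ^ (m + 1) * (((c / (4 * K2))⁻¹) ^ (m + 1) * (r * G) ^ (m + 1 + 1)) =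
        K2 * ((c / (4 * K2))⁻¹) ^ (m + 1) * (r * G ^ (m + 2)) := by
      have : (r⁻¹) ^ (m + 1) * (r * G) ^ (m + 1 + 1) = r * G ^ (m + 2) := by
        rw [mul_pow, inv_pow, pow_succ r (m + 1)]
        field_simp
      rw [← this]; ring
    rw [mul_add, e1, e2, e3] at hy2
    exact hy2
  linarith

lemma Bdy.isOpen {n : ℕ} {Ω : Set (Euc n)} {ρ : Euc n → ℝ} {L c : ℝ} (H : Bdy n Ω ρ L c) :
    IsOpen Ω := by
  have : Ω = ρ ⁻¹' Set.Ioi 0 := by ext x; exact H.pos x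
  rw [this]
  exact isOpen_Ioi.preimage H.cd.continuous

/-- vector field in the Hardy inequality -/
def hfield {n : ℕ} (k : ℕ) (ρ : Euc n → ℝ) (i : Fin n) (x : Euc n) : ℝ :=
  ((ρ x)⁻¹) ^ (k + 1) * fderiv ℝ ρ x (bv n i)

lemma hfield_deriv {n k : ℕ} {Ω : Set (Euc n)} {ρ : Euc n → ℝ} {L c : ℝ} (H : Bdy n Ω ρ L c)
    (i : Fin n) {x : Euc n} (hx : x ∈ Ω) :
    DifferentiableAt ℝ (hfield k ρ i) x ∧
    fderiv ℝ (hfield k ρ i) x (bv n i) =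
      ((ρ x)⁻¹) ^ (k + 1) * fderiv ℝ (fun y => fderiv ℝ ρ y (bv n i)) x (bv n i)
      - (k + 1) * ((ρ x)⁻¹) ^ (k + 2) * (fderiv ℝ ρ x (bv n i)) ^ 2 := by
  have hr : 0 < ρ x := (H.pos x).1 hx
  have h1 := ((hasDerivAt_inv hr.ne').pow (k + 1)).comp_hasFDerivAt x
    (H.cd.differentiable (by norm_num) x).hasFDerivAt
  have h2 := ((cc_partial H.cd H.cs i).diff x).hasFDerivAt
  have h3 := h1.mul h2
  have h4 : HasFDerivAt (hfield k ρ i) _ x := h3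
  refine ⟨h4.differentiableAt, ?_⟩
  rw [h4.fderiv]
  simp only [Function.comp, Pi.pow_apply, add_apply, smul_apply, smul_eq_mul]
  simp only [Nat.add_sub_cancel, Nat.cast_add, Nat.cast_one]
  rw [← inv_pow]
  ring

lemma hfield_cont {n k : ℕ} {Ω : Set (Euc n)} {ρ : Euc n → ℝ} {L c : ℝ} (H : Bdy n Ω ρ L c)
    (i : Fin n) : ContinuousOn (hfield k ρ i) Ω := fun x hx =>
  ((hfield_deriv H i hx).1.continuousAt).continuousWithinAt

lemma inv_cont {n : ℕ} {Ω : Set (Euc n)} {ρ : Euc n → ℝ} {L c : ℝ} (H : Bdy n Ω ρ L c)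
    (k : ℕ) : ContinuousOn (fun x => ((ρ x)⁻¹) ^ k) Ω :=
  (H.cd.continuous.continuousOn.inv₀ fun x hx => ((H.pos x).1 hx).ne').pow k

lemma hfield_deriv_cont {n k : ℕ} {Ω : Set (Euc n)} {ρ : Euc n → ℝ} {L c : ℝ}
    (H : Bdy n Ω ρ L c) (i : Fin n) :
    ContinuousOn (fun x => fderiv ℝ (hfield k ρ i) x (bv n i)) Ω := by
  have h1 := (cc_partial H.cd H.cs i)
  have h2 : Continuous fun x => fderiv ℝ (fun y => fderiv ℝ ρ y (bv n i)) x (bv n i) :=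
    (h1.1.continuous_fderiv (by norm_num)).clm_apply continuous_const
  refine ContinuousOn.congr (f := fun x => ((ρ x)⁻¹) ^ (k + 1) *
    fderiv ℝ (fun y => fderiv ℝ ρ y (bv n i)) x (bv n i)
      - (k + 1) * ((ρ x)⁻¹) ^ (k + 2) * (fderiv ℝ ρ x (bv n i)) ^ 2) ?_
    (fun x hx => (hfield_deriv H i hx).2)
  exact ((inv_cont H _).mul h2.continuousOn).sub
    ((continuousOn_const.mul (inv_cont H _)).mul (h1.1.continuous.continuousOn.pow 2))

lemma hardy {n : ℕ} (hn : 2 ≤ n) {Ω : Set (Euc n)} {ρ : Euc n → ℝ} {L c : ℝ}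
    (H : Bdy n Ω ρ L c) : ∃ C, 0 < C ∧ ∀ g, CC n g → tsupport g ⊆ Ω →
      ∫ x, |g x| ^ (n + 1) * ((ρ x)⁻¹) ^ n ≤
        C * ((∫ x, |g x| ^ (n + 1)) + ∫ x, ρ x * (∑ i, |fderiv ℝ g x (bv n i)|) ^ (n + 1)) := by
  obtain ⟨k, rfl⟩ : ∃ k, n = k + 2 := ⟨n - 2, by omega⟩
  have hL : 0 ≤ L := (abs_nonneg _).trans (H.d2 0 0)
  have hc := H.cpos
  set K1 : ℝ := (k + 1) + (k + 2) * L with hK1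
  set K2 : ℝ := (k + 3) with hK2
  have hK1p : 0 < K1 := by positivity
  have hK2p : 0 < K2 := by positivity
  set C2 : ℝ := K1 * (4 * K1 / c) ^ (k + 1) with hC2
  set C3 : ℝ := K2 * ((c / (4 * K2))⁻¹) ^ (k + 1 + 1) with hC3
  have hC2p : 0 < C2 := by positivity
  have hC3p : 0 < C3 := by positivity
  refine ⟨(c / 2)⁻¹ * (C2 + C3), by positivity, ?_⟩
  intro g hg hgΩ
  obtain ⟨hq, hq'⟩ := hg.absPow (by omega)
  set q : Euc (k + 2) → ℝ := fun x => |g x| ^ (k + 2 + 1) with hqd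
  have hts : tsupport q ⊆ tsupport g := by
    refine closure_mono fun x hx => ?_
    simp only [Function.mem_support, hqd] at hx ⊢
    intro h; rw [h] at hx; simp at hx
  have hqΩ := hts.trans hgΩ
  have hΩo := H.isOpen
  have hpd : ∀ i, Continuous fun x => fderiv ℝ q x (bv (k + 2) i) := fun i =>
    (hq.1.continuous_fderiv (by norm_num)).clm_apply continuous_const
  have hpds : ∀ i, HasCompactSupport fun x => fderiv ℝ q x (bv (k + 2) i) := fun i =>
    hq.2.fderiv_apply (𝕜 := ℝ) _
  have hpdt : ∀ i, tsupport (fun x => fderiv ℝ q x (bv (k + 2) i)) ⊆ Ω := fun i =>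
    (tsupport_fderiv_apply_subset (𝕜 := ℝ) _).trans hqΩ
  have i1 : ∀ i, Integrable fun x => fderiv ℝ q x (bv (k + 2) i) * hfield k ρ i x := fun i =>
    (cont_mul_supp hΩo (hpd i) (hpdt i) (hfield_cont H i)).integrable_of_hasCompactSupport
      (hpds i).mul_right
  have i2 : ∀ i, Integrable fun x => q x * fderiv ℝ (hfield k ρ i) x (bv (k + 2) i) := fun i =>
    (cont_mul_supp hΩo hq.1.continuous hqΩ
      (hfield_deriv_cont H i)).integrable_of_hasCompactSupport hq.2.mul_right
  have i3 : ∀ i, Integrable fun x => q x * hfield k ρ i x := fun i =>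
    (cont_mul_supp hΩo hq.1.continuous hqΩ
      (hfield_cont H i)).integrable_of_hasCompactSupport hq.2.mul_right
  have ibp : ∀ i, ∫ x, (q x * fderiv ℝ (hfield k ρ i) x (bv (k + 2) i) +
      fderiv ℝ q x (bv (k + 2) i) * hfield k ρ i x) = 0 := by
    intro i
    rw [integral_add (i2 i) (i1 i)]
    rw [integral_mul_fderiv_eq_neg_fderiv_mul_of_integrable (i1 i) (i2 i) (i3 i)
      (fun x _ => hq.diff x) (fun x hx => (hfield_deriv H i (hqΩ hx)).1)]
    ring
  set E : Euc (k + 2) → ℝ := fun x => ∑ i, (q x * fderiv ℝ (hfield k ρ i) x (bv (k + 2) i) +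
      fderiv ℝ q x (bv (k + 2) i) * hfield k ρ i x) with hE
  have iE : Integrable E := integrable_finsetSum _ fun i _ => (i2 i).add (i1 i)
  have hE0 : ∫ x, E x = 0 := by
    have := integral_finsetSum (μ := volume) Finset.univ
      fun i (_ : i ∈ Finset.univ) => (i2 i).add (i1 i)
    refine this.trans ?_
    exact Finset.sum_eq_zero fun i _ => ibp i
  set G : Euc (k + 2) → ℝ := fun x => ∑ i, |fderiv ℝ g x (bv (k + 2) i)| with hG
  have hGc : Continuous G := continuous_finsetSum _ fun i _ =>
    ((hg.1.continuous_fderiv (by norm_num)).clm_apply continuous_const).abs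
  have hGn : ∀ x, 0 ≤ G x := fun x => Finset.sum_nonneg fun _ _ => abs_nonneg _
  have hGz : ∀ x ∉ tsupport g, G x = 0 := by
    intro x hx
    refine Finset.sum_eq_zero fun i _ => ?_
    rw [fderiv_of_notMem_tsupport (𝕜 := ℝ) hx]; simp
  have iG : Integrable fun x => ρ x * G x ^ (k + 2 + 1) := by
    refine (H.cd.continuous.mul (hGc.pow _)).integrable_of_hasCompactSupport ?_
    refine HasCompactSupport.mul_left (HasCompactSupport.intro hg.2 fun x hx => ?_)
    rw [Pi.pow_apply, hGz x hx]; simp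
  have iq : Integrable q := hq.1.continuous.integrable_of_hasCompactSupport hq.2
  have iqr : Integrable fun x => q x * ((ρ x)⁻¹) ^ (k + 2) :=
    (cont_mul_supp hΩo hq.1.continuous hqΩ
      (inv_cont H _)).integrable_of_hasCompactSupport hq.2.mul_right
  have pw : ∀ x, c / 2 * (q x * ((ρ x)⁻¹) ^ (k + 2)) ≤
      - E x + (C2 * q x + C3 * (ρ x * G x ^ (k + 2 + 1))) := by
    intro x
    by_cases hx : x ∈ tsupport g
    · have hxΩ := hgΩ hx
      have hr : 0 < ρ x := (H.pos x).1 hxΩ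
      have hlow := H.low x (subset_closure hxΩ)
      have hP := hardy_pointwise (m := k + 1) c K1 K2 hc hK1p hK2p (ρ x) |g x| (G x) hr
        (abs_nonneg _) (hGn x)
      have hq0 : 0 ≤ q x := by positivity
      have hri : 0 < (ρ x)⁻¹ := inv_pos.2 hr
      have e1 : ∀ i, q x * fderiv ℝ (hfield k ρ i) x (bv (k + 2) i) ≤
          q x * ((ρ x)⁻¹) ^ (k + 1) * L -
          (k + 1) * (q x * ((ρ x)⁻¹) ^ (k + 2)) * (fderiv ℝ ρ x (bv (k + 2) i)) ^ 2 := by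
        intro i
        rw [(hfield_deriv H i hxΩ).2]
        have := (le_abs_self _).trans (H.d2 i x)
        have h5 := mul_le_mul_of_nonneg_left this
          (by positivity : 0 ≤ q x * ((ρ x)⁻¹) ^ (k + 1))
        linarith
      have e2 : ∀ i, fderiv ℝ q x (bv (k + 2) i) * hfield k ρ i x ≤
          (k + 3) * |g x| ^ (k + 2) * ((ρ x)⁻¹) ^ (k + 1) * |fderiv ℝ g x (bv (k + 2) i)| := by
        intro i
        have h6 : |hfield k ρ i x| ≤ ((ρ x)⁻¹) ^ (k + 1) := by
          unfold hfield
          rw [abs_mul, abs_of_nonneg (by positivity : 0 ≤ ((ρ x)⁻¹) ^ (k + 1))]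
          refine mul_le_of_le_one_right (by positivity) ?_
          have := (fderiv ℝ ρ x).le_of_opNorm_le (H.d1 x) (bv (k + 2) i)
          simp only [Real.norm_eq_abs, EuclideanSpace.norm_single, abs_one] at this
          linarith
        have h7 := hq' x (bv (k + 2) i)
        refine (le_abs_self _).trans ?_
        rw [abs_mul]
        refine (mul_le_mul h7 h6 (abs_nonneg _) (by positivity)).trans (le_of_eq ?_)
        push_cast; ring
      have e3 : E x ≤ (k + 2) * (q x * ((ρ x)⁻¹) ^ (k + 1) * L) -
          (k + 1) * (q x * ((ρ x)⁻¹) ^ (k + 2)) * (∑ i, (fderiv ℝ ρ x (bv (k + 2) i)) ^ 2) +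
          (k + 3) * |g x| ^ (k + 2) * ((ρ x)⁻¹) ^ (k + 1) * G x := by
        refine (Finset.sum_le_sum fun i _ => add_le_add (e1 i) (e2 i)).trans (le_of_eq ?_)
        rw [Finset.sum_add_distrib, Finset.sum_sub_distrib, ← Finset.mul_sum, ← Finset.mul_sum, ← Finset.mul_sum]
        simp only [Finset.sum_const, Finset.card_univ, Fintype.card_fin, nsmul_eq_mul, hG]
        push_cast; ring
      have e4 : (k + 1) * (q x * ((ρ x)⁻¹) ^ (k + 2)) * (c - ρ x) ≤
          (k + 1) * (q x * ((ρ x)⁻¹) ^ (k + 2)) * (∑ i, (fderiv ℝ ρ x (bv (k + 2) i)) ^ 2) :=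
        mul_le_mul_of_nonneg_left (by linarith) (by positivity)
      have e5 : (q x * ((ρ x)⁻¹) ^ (k + 2)) * ρ x = q x * ((ρ x)⁻¹) ^ (k + 1) := by
        rw [pow_succ _ (k + 1), mul_assoc, mul_assoc, inv_mul_cancel₀ hr.ne', mul_one]
      have e6 : c * (q x * ((ρ x)⁻¹) ^ (k + 2)) ≤ (k + 1) * (c * (q x * ((ρ x)⁻¹) ^ (k + 2))) := by
        refine le_mul_of_one_le_left (by positivity) ?_
        have : (0 : ℝ) ≤ k := by positivity
        linarith
      have e7 : q x = |g x| ^ (k + 1 + 2) := rfl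
      rw [← e7] at hP
      rw [hK1, hK2] at hP
      have e8 : (k + 1) * (q x * ((ρ x)⁻¹) ^ (k + 2)) * (c - ρ x) =
        (k + 1) * (c * (q x * ((ρ x)⁻¹) ^ (k + 2))) - (k + 1) * (q x * ((ρ x)⁻¹) ^ (k + 1)) := by
        rw [← e5]; ring
      rw [hC2, hC3, hK1, hK2]
      have e9 : (k + 1 + 1 : ℕ) = k + 2 := rfl
      have e10 : (k + 1 + 2 : ℕ) = k + 2 + 1 := rfl
      rw [e9, e10] at hP
      rw [e9]
      nlinarith [hP, e3, e4, e6, e8]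
    · have hq0 : q x = 0 := image_eq_zero_of_notMem_tsupport fun h => hx (hts h)
      have hE0 : E x = 0 := by
        refine Finset.sum_eq_zero fun i _ => ?_
        rw [hq0, fderiv_of_notMem_tsupport (𝕜 := ℝ) (fun h => hx (hts h))]; simp
      rw [hq0, hE0, hGz x hx]; simp
  have hI := integral_mono (iqr.const_mul (c / 2)) (iE.neg.add ((iq.const_mul C2).add
    (iG.const_mul C3))) pw
  have hI2 : ∫ x, (-E x + (C2 * q x + C3 * (ρ x * G x ^ (k + 2 + 1)))) =
      C2 * (∫ x, q x) + C3 * ∫ x, (ρ x * G x ^ (k + 2 + 1)) := by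
    rw [integral_add (f := fun x => - E x)
      (g := fun x => C2 * q x + C3 * (ρ x * G x ^ (k + 2 + 1))) iE.neg ((iq.const_mul C2).add (iG.const_mul C3)),
      integral_add (iq.const_mul C2) (iG.const_mul C3), integral_neg, hE0, integral_const_mul,
      integral_const_mul]
    ring
  have hI3 : c / 2 * ∫ x, q x * ((ρ x)⁻¹) ^ (k + 2) ≤
      C2 * (∫ x, q x) + C3 * ∫ x, (ρ x * G x ^ (k + 2 + 1)) := by
    rw [← hI2, ← integral_const_mul]; exact hI
  have n1 : 0 ≤ ∫ x, q x := integral_nonneg fun x => by positivity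
  have n2 : 0 ≤ ∫ x, (ρ x * G x ^ (k + 2 + 1)) := integral_nonneg fun x => by
    by_cases hx : x ∈ tsupport g
    · have := (H.pos x).1 (hgΩ hx)
      have := hGn x
      simp only [Pi.zero_apply]; positivity
    · rw [hGz x hx]; simp
  rw [mul_assoc, ← div_eq_inv_mul, le_div_iff₀ (by positivity)]
  nlinarith [mul_nonneg hC2p.le n2, mul_nonneg hC3p.le n1]

lemma Dav_continuous {n : ℕ} {r : Euc n → ℝ} (hr : Continuous r) {w : Euc n → ℝ}
    (hw : Continuous w) : Continuous (Dav r w) := by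
  refine continuous_parametric_integral_of_continuous
    (f := fun x z => |w (x + r x • z) - w x|) ?_ (isCompact_closedBall (0 : Euc n) 1)
  simp only [Function.uncurry_def]
  fun_prop

/-- total oscillation -/
def Dt {n : ℕ} (r : Euc n → ℝ) (f : Fin (n + 1) → Euc n → ℝ) (x : Euc n) : ℝ :=
  ∑ j, Dav r (f j) x

lemma Dt_nonneg {n : ℕ} (r : Euc n → ℝ) (f : Fin (n + 1) → Euc n → ℝ) (x : Euc n) :
    0 ≤ Dt r f x := Finset.sum_nonneg fun _ _ => Dav_nonneg _ _ _

lemma Dav_le_Dt {n : ℕ} (r : Euc n → ℝ) (f : Fin (n + 1) → Euc n → ℝ) (x : Euc n)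
    (j : Fin (n + 1)) : Dav r (f j) x ≤ Dt r f x :=
  Finset.single_le_sum (f := fun j => Dav r (f j) x) (fun _ _ => Dav_nonneg _ _ _)
    (Finset.mem_univ j)

/-- energy at scale `r` -/
def Fk {n : ℕ} (S : Set (Euc n)) (r : Euc n → ℝ) (f : Fin (n + 1) → Euc n → ℝ) : ENNReal :=
  ∫⁻ x in S, ENNReal.ofReal (((r x)⁻¹) ^ n * Dt r f x ^ (n + 1))

lemma Fk_meas {n : ℕ} {r : Euc n → ℝ} (hr : Continuous r) {f : Fin (n + 1) → Euc n → ℝ}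
    (hf : ∀ j, Continuous (f j)) :
    Measurable fun x => ((r x)⁻¹) ^ n * Dt r f x ^ (n + 1) := by
  have h1 : Continuous (Dt r f) := continuous_finsetSum _ fun j _ => Dav_continuous hr (hf j)
  exact (hr.measurable.inv.pow_const n).mul (h1.measurable.pow_const _)

/-- `T` functional -/
def TT {n : ℕ} (f : Fin (n + 1) → Euc n → ℝ) : ℝ :=
  ∫ x, f 0 x * (gmat n (fun j => f j.succ) x).det

lemma stepA {n : ℕ} (hn : 1 ≤ n) {φ : Euc n → ℝ} {B : ℝ} (hφ : Moll n φ B)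
    {f : Fin (n + 1) → Euc n → ℝ} (hf : ∀ j, CC n (f j)) {S : Set (Euc n)} (hS : MeasurableSet S)
    {r r' : Euc n → ℝ} (hr : ContDiff ℝ 1 r) (hr1 : ∀ x, ‖fderiv ℝ r x‖ ≤ 1)
    (hr' : ContDiff ℝ 1 r') (hr1' : ∀ x, ‖fderiv ℝ r' x‖ ≤ 1)
    (hrb : ∀ x, |r x| ≤ 1) (hrb' : ∀ x, |r' x| ≤ 1) (hpos : ∀ x ∈ S, 0 < r x)
    (hrel : ∀ x, r' x = r x / 2)
    (hs : tsupport (avg φ r (f 0)) ⊆ S) (hs' : tsupport (avg φ r' (f 0)) ⊆ S) :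
    ENNReal.ofReal |TT (fun j => avg φ r (f j)) - TT (fun j => avg φ r' (f j))| ≤
      ENNReal.ofReal ((n + 1) * n.factorial * (B * (2 * (n + 1) * B) ^ n * 2 ^ n)) *
        (Fk S r f + Fk S r' f) := by
  have hB := hφ.bpos
  have hfc : ∀ j, Continuous (f j) := fun j => (hf j).1.continuous
  have ha : ∀ j, CC n (avg φ r (f j)) := fun j => avg_CC hφ hr hr1 (hf j) hrb
  have hb : ∀ j, CC n (avg φ r' (f j)) := fun j => avg_CC hφ hr' hr1' (hf j) hrb'
  have hX : ∀ j x, |avg φ r (f j) x - avg φ r' (f j) x| ≤ B * (Dt r f x + Dt r' f x) := by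
    intro j x
    have h1 := avg_sub hφ r (hfc j) x
    have h2 := avg_sub hφ r' (hfc j) x
    have h3 := mul_le_mul_of_nonneg_left (Dav_le_Dt r f x j) hB.le
    have h4 := mul_le_mul_of_nonneg_left (Dav_le_Dt r' f x j) hB.le
    rw [abs_le] at *
    constructor <;> linarith [h1.1, h1.2, h2.1, h2.2]
  set Y : Euc n → ℝ := fun x => 2 * (n + 1) * B * ((r x)⁻¹ * (Dt r f x + Dt r' f x)) with hY
  have hYa : ∀ j i, ∀ x ∈ S, |fderiv ℝ (avg φ r (f j)) x (bv n i)| ≤ Y x := by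
    intro j i x hx
    refine (avg_fderiv_bound hφ hr hr1 (hf j) x (hpos x hx) i).trans ?_
    have h0 := inv_pos.2 (hpos x hx)
    have h1 := Dav_le_Dt r f x j
    have h2 := Dt_nonneg r' f x
    have h3 := Dt_nonneg r f x
    rw [hY]
    have h4 : (r x)⁻¹ * Dav r (f j) x ≤ (r x)⁻¹ * (Dt r f x + Dt r' f x) :=
      mul_le_mul_of_nonneg_left (by linarith) h0.le
    have h5 : 0 ≤ (r x)⁻¹ * (Dt r f x + Dt r' f x) := by positivity
    have h6 := mul_le_mul_of_nonneg_left h4 (by positivity : 0 ≤ ((n : ℝ) + 1) * B)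
    have h7 : 0 ≤ ((n : ℝ) + 1) * B * ((r x)⁻¹ * (Dt r f x + Dt r' f x)) := by positivity
    linarith
  have hYb : ∀ j i, ∀ x ∈ S, |fderiv ℝ (avg φ r' (f j)) x (bv n i)| ≤ Y x := by
    intro j i x hx
    have hp' : 0 < r' x := by rw [hrel]; exact half_pos (hpos x hx)
    refine (avg_fderiv_bound hφ hr' hr1' (hf j) x hp' i).trans ?_
    have h0 := inv_pos.2 (hpos x hx)
    have h1 := Dav_le_Dt r' f x j
    have h3 := Dt_nonneg r f x
    have e : (r' x)⁻¹ = 2 * (r x)⁻¹ := by rw [hrel, inv_div]; rfl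
    rw [e, hY]
    have h4 : (r x)⁻¹ * Dav r' (f j) x ≤ (r x)⁻¹ * (Dt r f x + Dt r' f x) :=
      mul_le_mul_of_nonneg_left (by linarith) h0.le
    have h6 := mul_le_mul_of_nonneg_left h4 (by positivity : 0 ≤ 2 * ((n : ℝ) + 1) * B)
    linarith
  have key := diff_bound hn (fun i : Fin n => ha i.succ) (fun i : Fin n => hb i.succ) (ha 0) (hb 0)
    hS hs hs' (fun x => B * (Dt r f x + Dt r' f x)) Y (fun i x _ => hX i.succ x) (fun x _ => hX 0 x)
    (fun i j => hYa i.succ j) (fun i j => hYb i.succ j) (fun j => hYb 0 j)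
  refine key.trans ?_
  have hm := Fk_meas hr.continuous hfc
  rw [Fk, Fk, ← lintegral_add_left hm.ennreal_ofReal, ← lintegral_const_mul' _ _ ENNReal.ofReal_ne_top]
  refine setLIntegral_mono_ae' hS (Eventually.of_forall fun x hx => ?_)
  have hp := hpos x hx
  have hp' : 0 < r' x := by rw [hrel]; exact half_pos hp
  have h2 := Dt_nonneg r' f x
  have h3 := Dt_nonneg r f x
  rw [← ENNReal.ofReal_add (by positivity) (by positivity), ← ENNReal.ofReal_mul (by positivity)]
  refine ENNReal.ofReal_le_ofReal ?_
  rw [mul_assoc _ (B * _ * _) (_ + _)]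
  refine mul_le_mul_of_nonneg_left ?_ (by positivity)
  have e1 : B * (Dt r f x + Dt r' f x) * Y x ^ n =
      B * (2 * (n + 1) * B) ^ n * (((r x)⁻¹) ^ n * (Dt r f x + Dt r' f x) ^ (n + 1)) := by
    have : ∀ a b d e : ℝ, b * d * (a * (e * d)) ^ n = b * a ^ n * (e ^ n * d ^ (n + 1)) := by
      intro a b d e; rw [mul_pow, mul_pow]; ring
    exact this _ _ _ _
  rw [e1, mul_assoc (B * _) (2 ^ n)]
  refine mul_le_mul_of_nonneg_left ?_ (by positivity)
  have h4 := add_pow_le h3 h2 (n + 1)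
  rw [Nat.add_sub_cancel] at h4
  have h5 : ((r x)⁻¹) ^ n ≤ ((r' x)⁻¹) ^ n := by
    refine pow_le_pow_left₀ (by positivity) ?_ n
    refine inv_anti₀ hp' ?_
    rw [hrel]; linarith
  have h6 : ((r x)⁻¹) ^ n * Dt r' f x ^ (n + 1) ≤ ((r' x)⁻¹) ^ n * Dt r' f x ^ (n + 1) :=
    mul_le_mul_of_nonneg_right h5 (by positivity)
  calc _ ≤ ((r x)⁻¹) ^ n * (2 ^ n * (Dt r f x ^ (n + 1) + Dt r' f x ^ (n + 1))) :=
        mul_le_mul_of_nonneg_left h4 (by positivity)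
    _ = 2 ^ n * (((r x)⁻¹) ^ n * Dt r f x ^ (n + 1) + ((r x)⁻¹) ^ n * Dt r' f x ^ (n + 1)) := by ring
    _ ≤ _ := by gcongr

lemma gmat_zero_det_int {n : ℕ} (g : Fin n → Euc n → ℝ) :
    ∫ x, (fun _ => (0 : ℝ)) x * (gmat n g x).det = 0 := by simp

lemma CC.zero (n : ℕ) : CC n (fun _ => (0 : ℝ)) :=
  ⟨contDiff_const, HasCompactSupport.zero⟩

lemma ofReal_integral_le_lintegral {n : ℕ} {S : Set (Euc n)} (hS : MeasurableSet S)
    {g : Euc n → ℝ} (hg : Integrable g) (h0 : ∀ x, 0 ≤ g x) (hz : ∀ x ∉ S, g x = 0) :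
    ENNReal.ofReal (∫ x, g x) = ∫⁻ x in S, ENNReal.ofReal (g x) := by
  rw [← setIntegral_eq_integral_of_forall_compl_eq_zero hz]
  exact ofReal_integral_eq_lintegral_ofReal hg.integrableOn (Eventually.of_forall h0)

lemma stepB {n : ℕ} (hn : 2 ≤ n) {Ω : Set (Euc n)} {ρ : Euc n → ℝ} {L c : ℝ}
    (H : Bdy n Ω ρ L c) {φ : Euc n → ℝ} {B : ℝ} (hφ : Moll n φ B) :
    ∃ C : ℝ, 0 < C ∧ ∀ (f : Fin (n + 1) → Euc n → ℝ) (S : Set (Euc n)), (∀ j, CC n (f j)) →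
      MeasurableSet S → S ⊆ Ω → tsupport (avg φ ρ (f 0)) ⊆ S →
      ENNReal.ofReal |TT (fun j => avg φ ρ (f j))| ≤ ENNReal.ofReal C *
        ((∫⁻ x in S, ENNReal.ofReal (|f 0 x| ^ (n + 1))) + Fk S ρ f) := by
  obtain ⟨CH, hCH, hardy⟩ := hardy hn H
  have hB := hφ.bpos
  have hρ1 : ContDiff ℝ 1 ρ := H.cd.of_le (by norm_num)
  have hρd : ∀ x, ‖fderiv ℝ ρ x‖ ≤ 1 := fun x => (H.d1 x).trans (by norm_num)
  set A : ℝ := (n + 1) * n.factorial * ((n + 1) * B) ^ n with hA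
  set C1 : ℝ := 2 ^ n * (1 + B ^ (n + 1)) with hC1
  set C2 : ℝ := (n * ((n + 1) * B)) ^ (n + 1) with hC2
  have hAp : 0 < A := by positivity
  have hC1p : 0 < C1 := by positivity
  have hC2p : 0 ≤ C2 := by positivity
  refine ⟨A * (1 + CH * (C1 + C1 + C2)), by positivity, ?_⟩
  intro f S hf hS hSΩ hs
  have hfc : ∀ j, Continuous (f j) := fun j => (hf j).1.continuous
  have ha : ∀ j, CC n (avg φ ρ (f j)) := fun j => avg_CC hφ hρ1 hρd (hf j) H.b
  set Ψ := avg φ ρ (f 0) with hΨ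
  have hpos : ∀ x ∈ S, 0 < ρ x := fun x hx => (H.pos x).1 (hSΩ hx)
  set Y : Euc n → ℝ := fun x => (n + 1) * B * ((ρ x)⁻¹ * Dt ρ f x) with hY
  have hYa : ∀ j i, ∀ x ∈ S, |fderiv ℝ (avg φ ρ (f j)) x (bv n i)| ≤ Y x := by
    intro j i x hx
    refine (avg_fderiv_bound hφ hρ1 hρd (hf j) x (hpos x hx) i).trans ?_
    have h0 := inv_pos.2 (hpos x hx)
    have h1 := Dav_le_Dt ρ f x j
    rw [hY]
    exact mul_le_mul_of_nonneg_left (mul_le_mul_of_nonneg_left h1 h0.le) (by positivity)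
  have hYn : ∀ x ∈ S, 0 ≤ Y x := fun x hx => by
    have h0 := inv_pos.2 (hpos x hx)
    have h1 := Dt_nonneg ρ f x
    positivity
  have key := diff_bound (by omega) (fun i : Fin n => ha i.succ) (fun i : Fin n => ha i.succ) (ha 0)
    (CC.zero n) hS hs (by simp [tsupport]) (fun x => |Ψ x|) Y
    (fun i x _ => by simp) (fun x _ => by simp [hΨ]) (fun i j => hYa i.succ j)
    (fun i j => hYa i.succ j) (fun j x hx => by simpa using hYn x hx)
  rw [gmat_zero_det_int, sub_zero] at key
  refine key.trans ?_
  -- Hardy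
  have hq := (ha 0).absPow (by omega)
  have hΨz : ∀ x ∉ S, Ψ x = 0 := fun x hx => image_eq_zero_of_notMem_tsupport fun h => hx (hs h)
  have hGz : ∀ x ∉ S, ∀ i, fderiv ℝ Ψ x (bv n i) = 0 := fun x hx i => by
    rw [fderiv_of_notMem_tsupport (𝕜 := ℝ) fun h => hx (hs h)]; rfl
  have hH := hardy Ψ (ha 0) (hs.trans hSΩ)
  have hqc : HasCompactSupport fun x => |Ψ x| ^ (n + 1) := hq.1.2
  have hts : tsupport (fun x => |Ψ x| ^ (n + 1)) ⊆ Ω := by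
    refine Set.Subset.trans (closure_mono fun x hx => ?_) (hs.trans hSΩ)
    simp only [Function.mem_support] at hx ⊢
    intro h; rw [h] at hx; simp at hx
  have i1 : Integrable fun x => |Ψ x| ^ (n + 1) * ((ρ x)⁻¹) ^ n :=
    (cont_mul_supp H.isOpen hq.1.1.continuous hts (inv_cont H n)).integrable_of_hasCompactSupport
      hqc.mul_right
  have i2 : Integrable fun x => |Ψ x| ^ (n + 1) :=
    hq.1.1.continuous.integrable_of_hasCompactSupport hqc
  have hGc : Continuous fun x => ∑ i, |fderiv ℝ Ψ x (bv n i)| := continuous_finsetSum _ fun i _ =>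
    (((ha 0).1.continuous_fderiv (by norm_num)).clm_apply continuous_const).abs
  have i3 : Integrable fun x => ρ x * (∑ i, |fderiv ℝ Ψ x (bv n i)|) ^ (n + 1) := by
    refine (hρ1.continuous.mul (hGc.pow _)).integrable_of_hasCompactSupport ?_
    refine HasCompactSupport.mul_left (HasCompactSupport.intro (ha 0).2 fun x hx => ?_)
    rw [Pi.pow_apply]
    rw [Finset.sum_eq_zero]
    · simp
    · intro i _
      rw [fderiv_of_notMem_tsupport (𝕜 := ℝ) hx]; simp
  have n1 : ∀ x, 0 ≤ |Ψ x| ^ (n + 1) * ((ρ x)⁻¹) ^ n := fun x => by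
    by_cases hx : x ∈ S
    · have := inv_pos.2 (hpos x hx); positivity
    · simp [hΨz x hx]
  have n2 : ∀ x, 0 ≤ |Ψ x| ^ (n + 1) := fun x => by positivity
  have n3 : ∀ x, 0 ≤ ρ x * (∑ i, |fderiv ℝ Ψ x (bv n i)|) ^ (n + 1) := fun x => by
    by_cases hx : x ∈ S
    · have := (hpos x hx)
      have : 0 ≤ ∑ i, |fderiv ℝ Ψ x (bv n i)| := Finset.sum_nonneg fun _ _ => abs_nonneg _
      positivity
    · simp [hGz x hx]
  have hH2 := ENNReal.ofReal_le_ofReal hH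
  rw [ENNReal.ofReal_mul hCH.le, ENNReal.ofReal_add (integral_nonneg n2) (integral_nonneg n3),
    ofReal_integral_le_lintegral hS i1 n1 (fun x hx => by simp [hΨz x hx]),
    ofReal_integral_le_lintegral hS i2 n2 (fun x hx => by simp [hΨz x hx]),
    ofReal_integral_le_lintegral hS i3 n3 (fun x hx => by simp [hGz x hx])] at hH2
  have hm := Fk_meas hρ1.continuous hfc
  have hm0 : Measurable fun x => |f 0 x| ^ (n + 1) :=
    ((hfc 0).abs.pow _).measurable
  set P := ∫⁻ x in S, ENNReal.ofReal (|f 0 x| ^ (n + 1)) with hP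
  set F := Fk S ρ f with hF
  have b2 : ∫⁻ x in S, ENNReal.ofReal (|Ψ x| ^ (n + 1)) ≤ ENNReal.ofReal C1 * (P + F) := by
    rw [hP, hF, Fk, ← lintegral_add_left hm0.ennreal_ofReal,
      ← lintegral_const_mul' _ _ ENNReal.ofReal_ne_top]
    refine setLIntegral_mono_ae' hS (Eventually.of_forall fun x hx => ?_)
    have hp := hpos x hx
    have hD := Dt_nonneg ρ f x
    rw [← ENNReal.ofReal_add (by positivity) (by positivity), ← ENNReal.ofReal_mul (by positivity)]
    refine ENNReal.ofReal_le_ofReal ?_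
    have h1 := avg_sub hφ ρ (hfc 0) x
    have h2 := mul_le_mul_of_nonneg_left (Dav_le_Dt ρ f x 0) hB.le
    have h3 : |Ψ x| ≤ |f 0 x| + B * Dt ρ f x := by
      have : |Ψ x| ≤ |Ψ x - f 0 x| + |f 0 x| := by
        have := abs_add_le (Ψ x - f 0 x) (f 0 x); rwa [sub_add_cancel] at this
      rw [← hΨ] at h1
      linarith
    have h4 : |Ψ x| ^ (n + 1) ≤ 2 ^ n * (|f 0 x| ^ (n + 1) + (B * Dt ρ f x) ^ (n + 1)) :=
      (pow_le_pow_left₀ (abs_nonneg _) h3 _).trans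
        (by simpa using add_pow_le (abs_nonneg (f 0 x)) (by positivity : 0 ≤ B * Dt ρ f x) (n + 1))
    have h5 : Dt ρ f x ^ (n + 1) ≤ ((ρ x)⁻¹) ^ n * Dt ρ f x ^ (n + 1) := by
      refine le_mul_of_one_le_left (by positivity) (one_le_pow₀ ?_)
      exact (one_le_inv₀ hp).2 ((le_abs_self _).trans (H.b x))
    rw [mul_pow] at h4
    rw [hC1]
    have hB' : 0 ≤ B ^ (n + 1) := by positivity
    have q1 : 0 ≤ B ^ (n + 1) * |f 0 x| ^ (n + 1) := by positivity
    have q2 := mul_le_mul_of_nonneg_left h5 hB'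
    have q3 : 0 ≤ Dt ρ f x ^ (n + 1) := by positivity
    calc _ ≤ _ := h4
      _ ≤ 2 ^ n * ((1 + B ^ (n + 1)) * (|f 0 x| ^ (n + 1) + ((ρ x)⁻¹) ^ n * Dt ρ f x ^ (n + 1))) := by
        refine mul_le_mul_of_nonneg_left ?_ (by positivity)
        linarith
      _ = _ := by ring
  have b3 : ∫⁻ x in S, ENNReal.ofReal (ρ x * (∑ i, |fderiv ℝ Ψ x (bv n i)|) ^ (n + 1)) ≤
      ENNReal.ofReal C2 * F := by
    rw [hF, Fk, ← lintegral_const_mul' _ _ ENNReal.ofReal_ne_top]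
    refine setLIntegral_mono_ae' hS (Eventually.of_forall fun x hx => ?_)
    have hp := hpos x hx
    have hD := Dt_nonneg ρ f x
    rw [← ENNReal.ofReal_mul (by positivity)]
    refine ENNReal.ofReal_le_ofReal ?_
    have h1 : ∑ i, |fderiv ℝ Ψ x (bv n i)| ≤ n * Y x := by
      refine (Finset.sum_le_sum fun i _ => hYa 0 i x hx).trans ?_
      simp
    have h2 := pow_le_pow_left₀ (Finset.sum_nonneg fun _ _ => abs_nonneg _) h1 (n + 1)
    refine (mul_le_mul_of_nonneg_left h2 hp.le).trans (le_of_eq ?_)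
    have : ∀ a b d e : ℝ, e ≠ 0 → e * (a * (b * (e⁻¹ * d))) ^ (n + 1) =
        (a * b) ^ (n + 1) * ((e⁻¹) ^ n * d ^ (n + 1)) := by
      intro a b d e he
      simp only [mul_pow, pow_succ]
      field_simp
    exact this _ _ _ _ hp.ne'
  have b1 : ∫⁻ x in S, ENNReal.ofReal ((n + 1) * n.factorial * (|Ψ x| * Y x ^ n)) ≤
      ENNReal.ofReal A * ((∫⁻ x in S, ENNReal.ofReal (|Ψ x| ^ (n + 1) * ((ρ x)⁻¹) ^ n)) + F) := by
    rw [hF, Fk, ← lintegral_add_right _ hm.ennreal_ofReal,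
      ← lintegral_const_mul' _ _ ENNReal.ofReal_ne_top]
    refine setLIntegral_mono_ae' hS (Eventually.of_forall fun x hx => ?_)
    have hp := hpos x hx
    have hD := Dt_nonneg ρ f x
    rw [← ENNReal.ofReal_add (by positivity) (by positivity), ← ENNReal.ofReal_mul (by positivity)]
    refine ENNReal.ofReal_le_ofReal ?_
    have hy := young (n := n) hD (abs_nonneg (Ψ x)) one_pos
    simp only [one_mul, inv_one, one_pow] at hy
    have hy2 := mul_le_mul_of_nonneg_left hy (by positivity : 0 ≤ A * ((ρ x)⁻¹) ^ n)
    have e1 : (n + 1) * n.factorial * (|Ψ x| * Y x ^ n) =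
        A * ((ρ x)⁻¹) ^ n * (Dt ρ f x ^ n * |Ψ x|) := by
      rw [hA, hY]; simp only [mul_pow]; ring
    rw [e1]
    refine hy2.trans (le_of_eq ?_)
    ring
  refine b1.trans ?_
  rw [ENNReal.ofReal_mul hAp.le, mul_assoc]
  refine mul_le_mul_right ?_ _
  rw [ENNReal.ofReal_add zero_le_one (by positivity), ENNReal.ofReal_mul hCH.le,
    ENNReal.ofReal_add (by positivity) hC2p, ENNReal.ofReal_add (by positivity) hC1p.le]
  rw [ENNReal.ofReal_one]
  calc _ ≤ ENNReal.ofReal CH * (ENNReal.ofReal C1 * (P + F) + ENNReal.ofReal C2 * F) + F := by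
        gcongr
        refine hH2.trans ?_
        gcongr
    _ ≤ ENNReal.ofReal CH * ((ENNReal.ofReal C1 + ENNReal.ofReal C1) * (P + F) +
        ENNReal.ofReal C2 * (P + F)) + (P + F) := by
        gcongr
        · exact le_self_add
        · exact le_add_self
        · exact le_add_self
    _ = _ := by ring

lemma CC.lip {n : ℕ} {g : Euc n → ℝ} (hg : CC n g) :
    ∃ M, 0 ≤ M ∧ (∀ x, ‖fderiv ℝ g x‖ ≤ M) ∧ ∀ x y, |g x - g y| ≤ M * ‖x - y‖ := by
  obtain ⟨M, hM⟩ := (hg.2.fderiv (𝕜 := ℝ)).exists_bound_of_continuous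
    (hg.1.continuous_fderiv (by norm_num))
  refine ⟨M, (norm_nonneg _).trans (hM 0), hM, fun x y => ?_⟩
  exact Convex.norm_image_sub_le_of_norm_fderiv_le (𝕜 := ℝ) (f := g) (s := Set.univ)
    (fun x _ => hg.diff x) (fun x _ => hM x) convex_univ (Set.mem_univ y) (Set.mem_univ x)

/-- volume of unit ball -/
def uV (n : ℕ) : ℝ := volume.real (closedBall (0 : Euc n) 1)

lemma uV_pos (n : ℕ) : 0 < uV n := by
  refine ENNReal.toReal_pos ?_ (isCompact_closedBall (0 : Euc n) 1).measure_lt_top.ne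
  exact (measure_closedBall_pos volume _ one_pos).ne'

lemma Dav_lip {n : ℕ} {g : Euc n → ℝ} (hg : Continuous g) {M : ℝ} (hM0 : 0 ≤ M)
    (hM : ∀ x y, |g x - g y| ≤ M * ‖x - y‖) (r : Euc n → ℝ) (x : Euc n) :
    Dav r g x ≤ M * |r x| * uV n := by
  unfold Dav
  have : ∫ z in closedBall (0 : Euc n) 1, (M * |r x|) = M * |r x| * uV n := by
    rw [setIntegral_const, smul_eq_mul, mul_comm]; rfl
  rw [← this]
  refine setIntegral_mono_on (osc_integrable r hg x) ?_ measurableSet_closedBall ?_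
  · exact integrableOn_const (isCompact_closedBall (0 : Euc n) 1).measure_lt_top.ne
  · intro z hz
    rw [mem_closedBall_zero_iff] at hz
    refine (hM _ _).trans ?_
    rw [add_sub_cancel_left, norm_smul, Real.norm_eq_abs]
    have : |r x| * ‖z‖ ≤ |r x| := mul_le_of_le_one_right (abs_nonneg _) hz
    exact mul_le_mul_of_nonneg_left this hM0

/-- dyadic scales -/
def rk {n : ℕ} (ρ : Euc n → ℝ) (k : ℕ) (x : Euc n) : ℝ := (1 / 2) ^ k * ρ x

lemma rk_props {n : ℕ} {Ω : Set (Euc n)} {ρ : Euc n → ℝ} {L c : ℝ} (H : Bdy n Ω ρ L c) (k : ℕ) :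
    ContDiff ℝ 1 (rk ρ k) ∧ (∀ x, ‖fderiv ℝ (rk ρ k) x‖ ≤ 1) ∧ (∀ x, |rk ρ k x| ≤ (1 / 2) ^ k) ∧
    (∀ x, |rk ρ k x| ≤ 1) ∧ (∀ x, |rk ρ k x| ≤ |ρ x|) ∧ (∀ x ∈ Ω, 0 < rk ρ k x) := by
  have h1 : ((1 : ℝ) / 2) ^ k ≤ 1 := pow_le_one₀ (by norm_num) (by norm_num)
  have h0 : (0 : ℝ) < (1 / 2) ^ k := by positivity
  have hle : ∀ x, |rk ρ k x| = (1 / 2) ^ k * |ρ x| := fun x => by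
    rw [rk, abs_mul, abs_of_pos h0]
  refine ⟨contDiff_const.mul (H.cd.of_le (by norm_num)), ?_, ?_, ?_, ?_, ?_⟩
  · intro x
    have : fderiv ℝ (rk ρ k) x = ((1 / 2 : ℝ) ^ k) • fderiv ℝ ρ x :=
      fderiv_const_mul (H.cd.differentiable (by norm_num) x) _
    rw [this, norm_smul, Real.norm_eq_abs, abs_of_pos h0]
    have := H.d1 x
    nlinarith [norm_nonneg (fderiv ℝ ρ x)]
  · intro x; rw [hle]; exact mul_le_of_le_one_right h0.le (H.b x)
  · intro x; rw [hle]; exact mul_le_one₀ h1 (abs_nonneg _) (H.b x)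
  · intro x; rw [hle]; exact mul_le_of_le_one_left (abs_nonneg _) h1
  · intro x hx; exact mul_pos h0 ((H.pos x).1 hx)

lemma stepC {n : ℕ} (hn : 2 ≤ n) {Ω : Set (Euc n)} {ρ : Euc n → ℝ} {L c : ℝ}
    (H : Bdy n Ω ρ L c) {φ : Euc n → ℝ} {B : ℝ} (hφ : Moll n φ B)
    (f : Fin (n + 1) → Euc n → ℝ) (S : Set (Euc n)) (hf : ∀ j, CC n (f j))
    (hS : MeasurableSet S) (hSΩ : S ⊆ Ω) (hSv : volume S ≠ ⊤)
    (hs : ∀ k, tsupport (avg φ (rk ρ k) (f 0)) ⊆ S) (hs0 : tsupport (f 0) ⊆ S) :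
    ∃ K : ℝ, 0 ≤ K ∧ ∀ N, ENNReal.ofReal |TT (fun j => avg φ (rk ρ N) (f j)) - TT f| ≤
      ENNReal.ofReal (K * (1 / 2) ^ N) := by
  have hB := hφ.bpos
  have hfc : ∀ j, Continuous (f j) := fun j => (hf j).1.continuous
  choose M hM0 hM1 hM2 using fun j => (hf j).lip
  set Ms := ∑ j, M j with hMs
  have hMs0 : 0 ≤ Ms := Finset.sum_nonneg fun j _ => hM0 j
  have hMle : ∀ j, M j ≤ Ms := fun j =>
    Finset.single_le_sum (f := M) (fun j _ => hM0 j) (Finset.mem_univ j)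
  have hV := uV_pos n
  set Y : ℝ := Ms + (n + 1) * B * (Ms * uV n) with hY
  have hY0 : 0 ≤ Y := by positivity
  set X0 : ℝ := B * (Ms * uV n) with hX0
  have hX00 : 0 ≤ X0 := by positivity
  refine ⟨(volume S).toReal * ((n + 1) * n.factorial * (X0 * Y ^ n)), by positivity, ?_⟩
  intro N
  obtain ⟨p1, p2, p3, p4, -, p5⟩ := rk_props H N
  have ha : ∀ j, CC n (avg φ (rk ρ N) (f j)) := fun j => avg_CC hφ p1 p2 (hf j) p4
  have hD : ∀ j x, Dav (rk ρ N) (f j) x ≤ Ms * uV n * |rk ρ N x| := by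
    intro j x
    have := Dav_lip (hfc j) (hM0 j) (hM2 j) (rk ρ N) x
    have h2 := mul_le_mul_of_nonneg_right (hMle j) (by positivity : 0 ≤ |rk ρ N x| * uV n)
    linarith
  have hX : ∀ j x, |avg φ (rk ρ N) (f j) x - f j x| ≤ X0 * (1 / 2) ^ N := by
    intro j x
    have h1 := avg_sub hφ (rk ρ N) (hfc j) x
    have h2 := mul_le_mul_of_nonneg_left (hD j x) hB.le
    have h3 := mul_le_mul_of_nonneg_left (p3 x) (by positivity : 0 ≤ B * (Ms * uV n))
    rw [hX0]; linarith
  have hYa : ∀ j i, ∀ x ∈ S, |fderiv ℝ (avg φ (rk ρ N) (f j)) x (bv n i)| ≤ Y := by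
    intro j i x hx
    have hp := p5 x (hSΩ hx)
    refine (avg_fderiv_bound hφ p1 p2 (hf j) x hp i).trans ?_
    have h1 := hD j x
    rw [abs_of_pos hp] at h1
    have h2 : (rk ρ N x)⁻¹ * Dav (rk ρ N) (f j) x ≤ Ms * uV n := by
      rw [inv_mul_le_iff₀ hp]; linarith
    have h3 := mul_le_mul_of_nonneg_left h2 (by positivity : 0 ≤ ((n : ℝ) + 1) * B)
    rw [hY]; linarith
  have hYb : ∀ j i, ∀ x ∈ S, |fderiv ℝ (f j) x (bv n i)| ≤ Y := by
    intro j i x _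
    have h1 := (fderiv ℝ (f j) x).le_of_opNorm_le (hM1 j x) (bv n i)
    simp only [Real.norm_eq_abs, EuclideanSpace.norm_single, abs_one, mul_one] at h1
    have h2 := hMle j
    have h3 : 0 ≤ (n + 1) * B * (Ms * uV n) := by positivity
    rw [hY]; linarith
  have key := diff_bound (by omega) (fun i : Fin n => ha i.succ) (fun i : Fin n => hf i.succ) (ha 0)
    (hf 0) hS (hs N) hs0 (fun _ => X0 * (1 / 2) ^ N) (fun _ => Y)
    (fun i x _ => hX i.succ x) (fun x _ => hX 0 x) (fun i j => hYa i.succ j)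
    (fun i j => hYb i.succ j) (fun j => hYb 0 j)
  refine key.trans (le_of_eq ?_)
  rw [setLIntegral_const]
  rw [← ENNReal.ofReal_toReal hSv, ← ENNReal.ofReal_mul (by positivity), ENNReal.ofReal_toReal hSv]
  congr 1; ring

lemma geom_trunc (b : ℕ → ℝ) (hb0 : ∀ k, 0 ≤ b k) (hb : ∀ k, 2 * b k ≤ b (k + 1)) (M : ℝ)
    (hM : 0 ≤ M) (N : ℕ) :
    ∑ k ∈ Finset.range N, (if b k ≤ M then b k else 0) ≤ 2 * M := by
  have h1 : ∀ N, ∑ k ∈ Finset.range N, b k ≤ b N := by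
    intro N
    induction N with
    | zero => simpa using hb0 0
    | succ N ih => rw [Finset.sum_range_succ]; linarith [hb N]
  induction N with
  | zero => simpa using hM
  | succ N ih =>
    rw [Finset.sum_range_succ]
    split_ifs with h
    · have : ∑ k ∈ Finset.range N, (if b k ≤ M then b k else 0) ≤ ∑ k ∈ Finset.range N, b k :=
        Finset.sum_le_sum fun k _ => by split_ifs; exacts [le_rfl, hb0 k]
      linarith [h1 N]
    · linarith

lemma jensen_ball {n : ℕ} {g : Euc n → ℝ} (hg : Continuous g) (h0 : ∀ z, 0 ≤ g z) (m : ℕ) :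
    (∫ z in closedBall (0 : Euc n) 1, g z) ^ (m + 1) ≤
      uV n ^ m * ∫ z in closedBall (0 : Euc n) 1, g z ^ (m + 1) := by
  have hK := isCompact_closedBall (0 : Euc n) 1
  have hV := uV_pos n
  have : IsFiniteMeasure (volume.restrict (closedBall (0 : Euc n) 1)) :=
    ⟨by simpa using hK.measure_lt_top⟩
  have : NeZero (volume.restrict (closedBall (0 : Euc n) 1)) := ⟨by
    intro h
    have h2 := congrArg (fun μ => μ Set.univ) h
    simp only [Measure.restrict_apply_univ] at h2
    exact (measure_closedBall_pos volume (0 : Euc n) one_pos).ne' (by simpa using h2)⟩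
  have h := (convexOn_pow (m + 1)).map_average_le (μ := volume.restrict (closedBall (0 : Euc n) 1))
    (f := g) (continuous_pow (m + 1)).continuousOn isClosed_Ici (Eventually.of_forall h0)
    (hg.continuousOn.integrableOn_compact hK)
    ((hg.pow (m + 1)).continuousOn.integrableOn_compact hK)
  rw [average_eq, average_eq] at h
  have e : (volume.restrict (closedBall (0 : Euc n) 1)).real Set.univ = uV n := by
    simp [uV, Measure.real]
  rw [e, smul_eq_mul, smul_eq_mul, mul_pow] at h
  have h2 := mul_le_mul_of_nonneg_left h (by positivity : 0 ≤ uV n ^ (m + 1))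
  have e1 : ∀ a b : ℝ, uV n ^ (m + 1) * ((uV n)⁻¹ ^ (m + 1) * a) = a := by
    intro a b; rw [← mul_assoc, ← mul_pow, mul_inv_cancel₀ hV.ne']; simp
  have e2 : ∀ a : ℝ, uV n ^ (m + 1) * ((uV n)⁻¹ * a) = uV n ^ m * a := by
    intro a; rw [pow_succ]; field_simp
  rw [e1 _ 0, e2] at h2
  exact h2

lemma ball_change {n : ℕ} (g : Euc n → ℝ) (x : Euc n) {r : ℝ} (hr : 0 < r) :
    ∫ z in closedBall (0 : Euc n) 1, g (x + r • z) = (r⁻¹) ^ n * ∫ y in closedBall x r, g y := by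
  rw [← integral_indicator measurableSet_closedBall, ← integral_indicator measurableSet_closedBall]
  have h1 : (fun z => (closedBall (0 : Euc n) 1).indicator (fun z => g (x + r • z)) z) =
      fun z => (fun y => (closedBall x r).indicator g (x + y)) (r • z) := by
    funext z
    simp only [Set.indicator, mem_closedBall, dist_self_add_left, dist_zero_right, norm_smul,
      Real.norm_eq_abs, abs_of_pos hr]
    have : ‖z‖ ≤ 1 ↔ r * ‖z‖ ≤ r := by
      rw [mul_le_iff_le_one_right hr]
    simp only [this]
  rw [h1, Measure.integral_comp_smul volume (fun y => (closedBall x r).indicator g (x + y)) r,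
    integral_add_left_eq_self (fun y => (closedBall x r).indicator g y)]
  rw [finrank_euclideanSpace, Fintype.card_fin, smul_eq_mul, abs_of_pos (by positivity), inv_pow]

lemma sum_lintegral_le {α : Type*} [MeasurableSpace α] (μ : Measure α) (f : ℕ → α → ENNReal)
    (N : ℕ) : ∑ k ∈ Finset.range N, ∫⁻ x, f k x ∂μ ≤ ∫⁻ x, ∑ k ∈ Finset.range N, f k x ∂μ := by
  induction N with
  | zero => simp
  | succ N ih =>
    rw [Finset.sum_range_succ]
    simp_rw [Finset.sum_range_succ]
    exact (add_le_add ih le_rfl).trans (le_lintegral_add _ _)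

/-- sum of `|f_j x - f_j y|^{n+1}` -/
def osc {n : ℕ} (f : Fin (n + 1) → Euc n → ℝ) (x y : Euc n) : ℝ :=
  ∑ j, |f j y - f j x| ^ (n + 1)

lemma osc_nonneg {n : ℕ} (f : Fin (n + 1) → Euc n → ℝ) (x y : Euc n) : 0 ≤ osc f x y :=
  Finset.sum_nonneg fun _ _ => by positivity

lemma Dt_pow_le {n : ℕ} {f : Fin (n + 1) → Euc n → ℝ} (hf : ∀ j, Continuous (f j))
    (r : Euc n → ℝ) (x : Euc n) (hr : 0 < r x) :
    ENNReal.ofReal (((r x)⁻¹) ^ n * Dt r f x ^ (n + 1)) ≤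
      ENNReal.ofReal ((n + 1) ^ n * uV n ^ n) *
        ∫⁻ y in closedBall x (r x), ENNReal.ofReal (((r x)⁻¹) ^ (2 * n) * osc f x y) := by
  have hV := uV_pos n
  have hoc : Continuous fun y => osc f x y := by
    unfold osc
    have := hf
    fun_prop
  have h1 : Dt r f x ^ (n + 1) ≤ (n + 1) ^ n * ∑ j, Dav r (f j) x ^ (n + 1) := by
    have := pow_sum_div_card_le_sum_pow (s := Finset.univ) (f := fun j => Dav r (f j) x)
      (fun j _ => Dav_nonneg _ _ _) n
    rw [div_le_iff₀ (by simp; positivity)] at this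
    simp only [Finset.card_univ, Fintype.card_fin] at this
    push_cast at this
    rw [mul_comm] at this
    exact this
  have h2 : ∀ j, Dav r (f j) x ^ (n + 1) ≤ uV n ^ n *
      (((r x)⁻¹) ^ n * ∫ y in closedBall x (r x), |f j y - f j x| ^ (n + 1)) := by
    intro j
    have := hf j
    rw [← ball_change (fun y => |f j y - f j x| ^ (n + 1)) x hr]
    exact jensen_ball (g := fun z => |f j (x + r x • z) - f j x|) (by fun_prop)
      (fun z => abs_nonneg _) n
  have hK := isCompact_closedBall x (r x)
  have h3 : ∑ j, ∫ y in closedBall x (r x), |f j y - f j x| ^ (n + 1) =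
      ∫ y in closedBall x (r x), osc f x y := by
    unfold osc
    rw [integral_finsetSum]
    intro j _
    have := hf j
    exact (by fun_prop : Continuous fun y => |f j y - f j x| ^ (n + 1)).continuousOn.integrableOn_compact hK
  have h4 : ((r x)⁻¹) ^ n * Dt r f x ^ (n + 1) ≤ ((n + 1) ^ n * uV n ^ n) *
      ∫ y in closedBall x (r x), ((r x)⁻¹) ^ (2 * n) * osc f x y := by
    rw [integral_const_mul, ← h3]
    calc _ ≤ ((r x)⁻¹) ^ n * ((n + 1) ^ n * ∑ j, uV n ^ n *
      (((r x)⁻¹) ^ n * ∫ y in closedBall x (r x), |f j y - f j x| ^ (n + 1))) := by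
          refine mul_le_mul_of_nonneg_left (h1.trans ?_) (by positivity)
          exact mul_le_mul_of_nonneg_left (Finset.sum_le_sum fun j _ => h2 j) (by positivity)
      _ = _ := by rw [← Finset.mul_sum, ← Finset.mul_sum]; ring
  refine (ENNReal.ofReal_le_ofReal h4).trans ?_
  rw [ENNReal.ofReal_mul (by positivity)]
  refine mul_le_mul_right (le_of_eq ?_) _
  refine ofReal_integral_eq_lintegral_ofReal
    ((continuous_const.mul hoc).continuousOn.integrableOn_compact hK) ?_
  refine Eventually.of_forall fun y => ?_
  have := osc_nonneg f x y
  simp only [Pi.zero_apply]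
  positivity

/-- local energy -/
def En {n : ℕ} (S : Set (Euc n)) (ρ : Euc n → ℝ) (f : Fin (n + 1) → Euc n → ℝ) : ENNReal :=
  ∫⁻ x in S, ∫⁻ y in closedBall x (ρ x),
    ENNReal.ofReal (((dist x y)⁻¹) ^ (2 * n) * osc f x y)

lemma stepD {n : ℕ} (hn : 1 ≤ n) {Ω : Set (Euc n)} {ρ : Euc n → ℝ} {L c : ℝ} (H : Bdy n Ω ρ L c)
    {f : Fin (n + 1) → Euc n → ℝ} (hf : ∀ j, Continuous (f j)) {S : Set (Euc n)}
    (hS : MeasurableSet S) (hSΩ : S ⊆ Ω) (N : ℕ) :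
    ∑ k ∈ Finset.range N, Fk S (rk ρ k) f ≤
      ENNReal.ofReal ((n + 1) ^ n * uV n ^ n * 2) * En S ρ f := by
  have hV := uV_pos n
  refine (sum_lintegral_le (volume.restrict S) _ N).trans ?_
  rw [En, ← lintegral_const_mul' _ _ ENNReal.ofReal_ne_top]
  refine setLIntegral_mono_ae' hS (Eventually.of_forall fun x hx => ?_)
  have hp : ∀ k, 0 < rk ρ k x := fun k => (rk_props H k).2.2.2.2.2 x (hSΩ hx)
  have hρ : 0 < ρ x := (H.pos x).1 (hSΩ hx)
  set b : ℕ → ℝ := fun k => ((rk ρ k x)⁻¹) ^ (2 * n) with hb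
  have hb0 : ∀ k, 0 ≤ b k := fun k => by have := hp k; positivity
  have hbs : ∀ k, 2 * b k ≤ b (k + 1) := by
    intro k
    have e : (rk ρ (k + 1) x)⁻¹ = 2 * (rk ρ k x)⁻¹ := by
      simp only [rk, pow_succ, mul_inv]; ring
    simp only [hb]
    rw [e, mul_pow]
    refine mul_le_mul_of_nonneg_right ?_ (hb0 k)
    calc (2 : ℝ) = 2 ^ 1 := by norm_num
      _ ≤ 2 ^ (2 * n) := pow_le_pow_right₀ (by norm_num) (by omega)
  calc _ ≤ ∑ k ∈ Finset.range N, ENNReal.ofReal ((n + 1) ^ n * uV n ^ n) *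
        ∫⁻ y in closedBall x (ρ x), ENNReal.ofReal
          ((if b k ≤ ((dist x y)⁻¹) ^ (2 * n) then b k else 0) * osc f x y) := by
        refine Finset.sum_le_sum fun k _ => ?_
        refine (Dt_pow_le hf (rk ρ k) x (hp k)).trans ?_
        refine mul_le_mul_right ?_ _
        have hsub : closedBall x (rk ρ k x) ⊆ closedBall x (ρ x) := by
          refine closedBall_subset_closedBall ?_
          have := (rk_props H k).2.2.2.2.1 x
          rwa [abs_of_pos (hp k), abs_of_pos hρ] at this
        refine le_trans ?_ (lintegral_mono_set hsub)
        refine setLIntegral_mono_ae' measurableSet_closedBall (Eventually.of_forall fun y hy => ?_)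
        refine ENNReal.ofReal_le_ofReal ?_
        by_cases hxy : y = x
        · have : osc f x y = 0 := by
            subst hxy; simp [osc]
          rw [this]; simp
        · have hd : 0 < dist x y := dist_pos.2 (Ne.symm hxy)
          rw [mem_closedBall, dist_comm] at hy
          have : b k ≤ ((dist x y)⁻¹) ^ (2 * n) :=
            pow_le_pow_left₀ (inv_nonneg.2 (hp k).le) (inv_anti₀ hd hy) _
          rw [if_pos this]
    _ = ENNReal.ofReal ((n + 1) ^ n * uV n ^ n) * ∑ k ∈ Finset.range N,
        ∫⁻ y in closedBall x (ρ x), ENNReal.ofReal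
          ((if b k ≤ ((dist x y)⁻¹) ^ (2 * n) then b k else 0) * osc f x y) := by
        rw [Finset.mul_sum]
    _ ≤ ENNReal.ofReal ((n + 1) ^ n * uV n ^ n) * ∫⁻ y in closedBall x (ρ x),
        ENNReal.ofReal 2 * ENNReal.ofReal (((dist x y)⁻¹) ^ (2 * n) * osc f x y) := by
        refine mul_le_mul_right ?_ _
        refine (sum_lintegral_le _ _ N).trans ?_
        refine lintegral_mono fun y => ?_
        have ho := osc_nonneg f x y
        rw [← ENNReal.ofReal_sum_of_nonneg, ← Finset.sum_mul, ← ENNReal.ofReal_mul (by norm_num)]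
        · refine ENNReal.ofReal_le_ofReal ?_
          rw [← mul_assoc]
          refine mul_le_mul_of_nonneg_right ?_ ho
          exact geom_trunc b hb0 hbs _ (by positivity) N
        · intro k _
          refine mul_nonneg ?_ ho
          split_ifs; exacts [hb0 k, le_rfl]
    _ = _ := by
        rw [lintegral_const_mul' _ _ ENNReal.ofReal_ne_top, ← mul_assoc,
          ← ENNReal.ofReal_mul (by positivity)]

lemma avg_supp {n : ℕ} {Ω : Set (Euc n)} {ρ : Euc n → ℝ} {L c : ℝ} (H : Bdy n Ω ρ L c)
    {φ : Euc n → ℝ} {B : ℝ} (hφ : Moll n φ B) {ψ : Euc n → ℝ} {δ : ℝ} (hδ : 0 < δ)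
    (hψ : ∀ x, ψ x ≠ 0 → 2 * δ ≤ ρ x) (k : ℕ) :
    tsupport (avg φ (rk ρ k) ψ) ⊆ {x | δ ≤ ρ x} := by
  refine closure_minimal ?_ (isClosed_le continuous_const H.cd.continuous)
  intro x hx
  by_contra hlt
  simp only [Set.mem_ofPred_eq, not_le] at hlt
  apply hx
  unfold avg
  rw [integral_eq_zero_of_ae]
  refine Eventually.of_forall fun z => ?_
  simp only [Pi.zero_apply]
  by_cases hz : z ∈ closedBall (0 : Euc n) 1
  · have : ψ (x + rk ρ k x • z) = 0 := by
      by_contra hne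
      have h1 := hψ _ hne
      have h2 := H.lip (x + rk ρ k x • z) x
      rw [mem_closedBall_zero_iff] at hz
      rw [add_sub_cancel_left, norm_smul, Real.norm_eq_abs] at h2
      have h3 := (rk_props H k).2.2.2.2.1 x
      have h4 : |rk ρ k x| * ‖z‖ ≤ |ρ x| := by
        calc _ ≤ |ρ x| * 1 := mul_le_mul h3 hz (norm_nonneg _) (abs_nonneg _)
          _ = _ := mul_one _
      have h5 := (abs_le.1 h2).2
      rcases le_total 0 (ρ x) with h | h
      · rw [abs_of_nonneg h] at h4; linarith
      · rw [abs_of_nonpos h] at h4; linarith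
    rw [this, zero_mul]
  · rw [image_eq_zero_of_notMem_tsupport (f := φ) fun h => hz (hφ.supp h), mul_zero]

theorem core0 {n : ℕ} (hn : 2 ≤ n) {Ω : Set (Euc n)} {ρ : Euc n → ℝ} {L c : ℝ}
    (H : Bdy n Ω ρ L c) : ∃ C : ℝ, 0 < C ∧ ∀ (f : Fin (n + 1) → Euc n → ℝ) (δ : ℝ),
      (∀ j, CC n (f j)) → 0 < δ → (∀ x, f 0 x ≠ 0 → 2 * δ ≤ ρ x) →
      ENNReal.ofReal |TT f| ≤ ENNReal.ofReal C *
        ((∫⁻ x in {x | δ ≤ ρ x}, ENNReal.ofReal (|f 0 x| ^ (n + 1))) + En {x | δ ≤ ρ x} ρ f) := by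
  obtain ⟨φ, B, hφ⟩ := exists_moll n
  obtain ⟨CB, hCB, hstepB⟩ := stepB hn H hφ
  have hB := hφ.bpos
  have hV := uV_pos n
  set CA : ℝ := (n + 1) * n.factorial * (B * (2 * (n + 1) * B) ^ n * 2 ^ n) with hCA
  have hCAp : 0 < CA := by positivity
  set CD : ℝ := (n + 1) ^ n * uV n ^ n * 2 with hCD
  have hCDp : 0 < CD := by positivity
  refine ⟨CB + (CB + CA + CA) * CD, by positivity, ?_⟩
  intro f δ hf hδ hsup
  set S : Set (Euc n) := {x | δ ≤ ρ x} with hSd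
  have hSc : IsClosed S := isClosed_le continuous_const H.cd.continuous
  have hS : MeasurableSet S := hSc.measurableSet
  have hSΩ : S ⊆ Ω := fun x hx => (H.pos x).2 (lt_of_lt_of_le hδ hx)
  have hSv : volume S ≠ ⊤ := by
    refine (lt_of_le_of_lt (measure_mono ?_) H.cs.isCompact.measure_lt_top).ne
    intro x hx
    refine subset_tsupport _ ?_
    exact (lt_of_lt_of_le hδ hx).ne'
  have hfc : ∀ j, Continuous (f j) := fun j => (hf j).1.continuous
  have hs : ∀ k, tsupport (avg φ (rk ρ k) (f 0)) ⊆ S := fun k => avg_supp H hφ hδ hsup k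
  have hs0 : tsupport (f 0) ⊆ S := closure_minimal (fun x hx => by
    have := hsup x hx
    show δ ≤ ρ x
    linarith) hSc
  obtain ⟨K, hK0, hC⟩ := stepC hn H hφ f S hf hS hSΩ hSv hs hs0
  set P := ∫⁻ x in S, ENNReal.ofReal (|f 0 x| ^ (n + 1)) with hP
  set E := En S ρ f with hE
  have hD := fun N => stepD (by omega) H hfc hS hSΩ N
  set T : ℕ → ℝ := fun k => TT (fun j => avg φ (rk ρ k) (f j)) with hT
  have hA : ∀ k, ENNReal.ofReal |T k - T (k + 1)| ≤ ENNReal.ofReal CA *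
      (Fk S (rk ρ k) f + Fk S (rk ρ (k + 1)) f) := by
    intro k
    obtain ⟨p1, p2, p3, p4, -, p5⟩ := rk_props H k
    obtain ⟨q1, q2, q3, q4, -, q5⟩ := rk_props H (k + 1)
    exact stepA (by omega) hφ hf hS p1 p2 q1 q2 p4 q4 (fun x hx => p5 x (hSΩ hx))
      (fun x => by simp only [rk, pow_succ]; ring) (hs k) (hs (k + 1))
  have hρ0 : rk ρ 0 = ρ := by funext x; simp [rk]
  have hB0 : ENNReal.ofReal |T 0| ≤ ENNReal.ofReal CB * (P + Fk S (rk ρ 0) f) := by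
    have h := hs 0
    simp only [hT]
    rw [hρ0] at h ⊢
    exact hstepB f S hf hS hSΩ h
  have htri : ∀ a b : ℝ, ENNReal.ofReal |a| ≤ ENNReal.ofReal |b| + ENNReal.ofReal |b - a| := by
    intro a b
    rw [← ENNReal.ofReal_add (abs_nonneg _) (abs_nonneg _)]
    refine ENNReal.ofReal_le_ofReal ?_
    have := abs_sub_abs_le_abs_sub a b
    rw [abs_sub_comm b a]; linarith
  have hTN : ∀ N, ENNReal.ofReal |T N| ≤ ENNReal.ofReal CB * P +
      (ENNReal.ofReal CB * Fk S (rk ρ 0) f + ∑ k ∈ Finset.range N, ENNReal.ofReal CA *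
      (Fk S (rk ρ k) f + Fk S (rk ρ (k + 1)) f)) := by
    intro N
    induction N with
    | zero =>
      refine hB0.trans (le_of_eq ?_)
      rw [Finset.sum_range_zero, add_zero, mul_add]
    | succ N ih =>
      refine (htri _ (T N)).trans ((add_le_add ih (hA N)).trans (le_of_eq ?_))
      rw [Finset.sum_range_succ]; ring
  have hTN2 : ∀ N, ENNReal.ofReal |T N| ≤
      ENNReal.ofReal (CB + (CB + CA + CA) * CD) * (P + E) := by
    intro N
    refine (hTN N).trans ?_
    have f1 : Fk S (rk ρ 0) f ≤ ENNReal.ofReal CD * E := by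
      have := hD 1
      rwa [Finset.sum_range_one] at this
    have f2 : ∑ k ∈ Finset.range N, Fk S (rk ρ k) f ≤ ENNReal.ofReal CD * E := hD N
    have f3 : ∑ k ∈ Finset.range N, Fk S (rk ρ (k + 1)) f ≤ ENNReal.ofReal CD * E := by
      refine le_trans ?_ (hD (N + 1))
      rw [Finset.sum_range_succ']
      exact le_self_add
    rw [← Finset.mul_sum, Finset.sum_add_distrib]
    have hco : ENNReal.ofReal (CB + (CB + CA + CA) * CD) = ENNReal.ofReal CB +
        (ENNReal.ofReal CB + ENNReal.ofReal CA + ENNReal.ofReal CA) * ENNReal.ofReal CD := by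
      rw [ENNReal.ofReal_add hCB.le (by positivity),
        ENNReal.ofReal_mul (p := CB + CA + CA) (q := CD) (by positivity),
        ENNReal.ofReal_add (p := CB + CA) (q := CA) (by positivity) hCAp.le,
        ENNReal.ofReal_add hCB.le hCAp.le]
    rw [hco]
    calc _ ≤ ENNReal.ofReal CB * P + (ENNReal.ofReal CB * (ENNReal.ofReal CD * E) +
          ENNReal.ofReal CA * (ENNReal.ofReal CD * E + ENNReal.ofReal CD * E)) := by gcongr
      _ ≤ ENNReal.ofReal CB * (P + E) + (ENNReal.ofReal CB * (ENNReal.ofReal CD * (P + E)) +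
          ENNReal.ofReal CA * (ENNReal.ofReal CD * (P + E) + ENNReal.ofReal CD * (P + E))) := by
          gcongr
          · exact le_self_add
          · exact le_add_self
          · exact le_add_self
          · exact le_add_self
      _ = _ := by ring
  have hfin : ∀ N, ENNReal.ofReal |TT f| ≤
      ENNReal.ofReal (CB + (CB + CA + CA) * CD) * (P + E) + ENNReal.ofReal (K * (1 / 2) ^ N) :=
    fun N => (htri _ (T N)).trans (add_le_add (hTN2 N) (hC N))
  have hlim : Tendsto (fun N : ℕ => ENNReal.ofReal (CB + (CB + CA + CA) * CD) * (P + E) +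
      ENNReal.ofReal (K * (1 / 2) ^ N)) atTop
      (𝓝 (ENNReal.ofReal (CB + (CB + CA + CA) * CD) * (P + E) + 0)) := by
    refine tendsto_const_nhds.add ?_
    have : Tendsto (fun N : ℕ => K * (1 / 2 : ℝ) ^ N) atTop (𝓝 (K * 0)) :=
      (tendsto_pow_atTop_nhds_zero_of_lt_one (by norm_num) (by norm_num)).const_mul K
    have h2 := ENNReal.tendsto_ofReal this
    simpa using h2
  rw [add_zero] at hlim
  exact ge_of_tendsto' hlim hfin

/-- full energy on `Ω × Ω` -/
def EO {n : ℕ} (Ω : Set (Euc n)) (f : Fin (n + 1) → Euc n → ℝ) : ENNReal :=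
  ∫⁻ x in Ω, ∫⁻ y in Ω, ENNReal.ofReal (((dist x y)⁻¹) ^ (2 * n) * osc f x y)

theorem core1 {n : ℕ} (hn : 2 ≤ n) {Ω : Set (Euc n)} {ρ : Euc n → ℝ} {L c : ℝ}
    (H : Bdy n Ω ρ L c) : ∃ C : ℝ, 0 < C ∧ ∀ (ψ : Euc n → ℝ) (w : Fin n → Euc n → ℝ),
      Cc1 n Ω ψ → (∀ j, ContDiffOn ℝ 1 (w j) Ω) →
      ENNReal.ofReal |∫ x, ψ x * (gmat n w x).det| ≤ ENNReal.ofReal C *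
        ((∫⁻ x in Ω, ENNReal.ofReal (|ψ x| ^ (n + 1))) + EO Ω (Fin.cons ψ w)) := by
  obtain ⟨C, hC, h0⟩ := core0 hn H
  refine ⟨C, hC, ?_⟩
  intro ψ w hψ hw
  have hΩ : IsOpen Ω := H.isOpen
  have hρc : Continuous ρ := H.cd.continuous
  obtain ⟨δ, hδ, hδ2⟩ : ∃ δ : ℝ, 0 < δ ∧ ∀ x ∈ tsupport ψ, 2 * δ ≤ ρ x := by
    rcases (tsupport ψ).eq_empty_or_nonempty with h | h
    · exact ⟨1, one_pos, by simp [h]⟩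
    · obtain ⟨x0, hx0, hmin⟩ := hψ.2.1.isCompact.exists_isMinOn h hρc.continuousOn
      have := (H.pos x0).1 (hψ.2.2 hx0)
      exact ⟨ρ x0 / 2, by linarith, fun x hx => by have := hmin hx; simp at this; linarith⟩
  set χ : Euc n → ℝ := fun x => Real.smoothTransition (4 / δ * ρ x - 1) with hχ
  have hχc : ContDiff ℝ 1 χ := by
    have h1 : ContDiff ℝ 1 (fun x => 4 / δ * ρ x - 1) :=
      (contDiff_const.mul (H.cd.of_le (by norm_num))).sub contDiff_const
    exact Real.smoothTransition.contDiff.comp h1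
  have hχ1 : ∀ x, δ / 2 ≤ ρ x → χ x = 1 := by
    intro x hx
    refine Real.smoothTransition.one_of_one_le ?_
    have : 4 / δ * (δ / 2) ≤ 4 / δ * ρ x := by gcongr
    have h2 : 4 / δ * (δ / 2) = 2 := by field_simp; norm_num
    linarith
  have hχ0 : ∀ x, ρ x ≤ δ / 4 → χ x = 0 := by
    intro x hx
    refine Real.smoothTransition.zero_of_nonpos ?_
    have : 4 / δ * ρ x ≤ 4 / δ * (δ / 4) := by gcongr
    have h2 : 4 / δ * (δ / 4) = 1 := by field_simp
    linarith
  set f : Fin (n + 1) → Euc n → ℝ := Fin.cons ψ (fun j x => χ x * w j x) with hf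
  have hf0 : f 0 = ψ := rfl
  have hfs : ∀ j : Fin n, f j.succ = fun x => χ x * w j x := fun j => rfl
  have hCC : ∀ j, CC n (f j) := by
    intro j
    refine Fin.cases ⟨hψ.1, hψ.2.1⟩ (fun j => ?_) j
    rw [hfs]
    constructor
    · rw [contDiff_iff_contDiffAt]
      intro x
      by_cases hx : x ∈ Ω
      · exact hχc.contDiffAt.mul ((hw j).contDiffAt (hΩ.mem_nhds hx))
      · have hlt : ρ x < δ / 4 := by
          have := mt (H.pos x).2 hx
          linarith
        have : (fun x => χ x * w j x) =ᶠ[𝓝 x] fun _ => 0 := by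
          filter_upwards [hρc.continuousAt.eventually_lt_const hlt] with y hy
          rw [hχ0 y hy.le, zero_mul]
        exact (contDiffAt_const (c := (0 : ℝ))).congr_of_eventuallyEq this
    · refine HasCompactSupport.of_support_subset_isCompact H.cs.isCompact ?_
      intro x hx
      refine subset_tsupport _ ?_
      intro h
      apply hx
      show χ x * w j x = 0
      rw [hχ0 x (by rw [h]; linarith), zero_mul]
  have hsup : ∀ x, f 0 x ≠ 0 → 2 * δ ≤ ρ x := fun x hx => hδ2 x (subset_tsupport _ hx)
  have hT : TT f = ∫ x, ψ x * (gmat n w x).det := by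
    unfold TT
    congr 1
    funext x
    rw [hf0]
    by_cases hx : ψ x = 0
    · rw [hx, zero_mul, zero_mul]
    · have h2 : 2 * δ ≤ ρ x := hsup x hx
      have hev : ∀ᶠ y in 𝓝 x, χ y = 1 := by
        filter_upwards [hρc.continuousAt.eventually_const_lt (show δ / 2 < ρ x by linarith)]
          with y hy using hχ1 y hy.le
      congr 2
      ext i j
      have : f i.succ =ᶠ[𝓝 x] w i := by
        rw [hfs]
        filter_upwards [hev] with y hy
        rw [hy, one_mul]
      simp only [gmat, Matrix.of_apply, this.fderiv_eq]
  have h1 := h0 f δ hCC hδ hsup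
  rw [hT] at h1
  refine h1.trans ?_
  have hSΩ : {x | δ ≤ ρ x} ⊆ Ω := fun x hx => (H.pos x).2 (lt_of_lt_of_le hδ hx)
  have hS : MeasurableSet {x | δ ≤ ρ x} := (isClosed_le continuous_const hρc).measurableSet
  refine mul_le_mul_right (add_le_add ?_ ?_) _
  · exact lintegral_mono_set hSΩ
  · unfold En EO
    refine le_trans ?_ (lintegral_mono_set hSΩ)
    refine setLIntegral_mono_ae' hS (Eventually.of_forall fun x hx => ?_)
    have hx' : δ ≤ ρ x := hx
    have hy : ∀ y ∈ closedBall x (ρ x), δ / 2 ≤ ρ y := by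
      intro y hy
      have h2 := H.lip x y
      rw [mem_closedBall', dist_eq_norm] at hy
      have := (abs_le.1 h2).2
      linarith
    refine le_trans (le_of_eq ?_) (lintegral_mono_set (s := closedBall x (ρ x)) fun y hyb =>
      (H.pos y).2 (by linarith [hy y hyb]))
    refine setLIntegral_congr_fun measurableSet_closedBall fun y hyb => ?_
    show ENNReal.ofReal _ = ENNReal.ofReal _
    congr 2
    unfold osc
    refine Finset.sum_congr rfl fun j _ => ?_
    refine Fin.cases rfl (fun j => ?_) j
    simp only [hfs, Fin.cons_succ]
    rw [hχ1 x (by linarith), hχ1 y (hy y hyb), one_mul, one_mul]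

/-- the `(n+1)`-th power of the Sobolev norm, as an extended nonnegative real -/
def NN {n : ℕ} {F : Type*} [NormedAddCommGroup F] (Ω : Set (Euc n)) (g : Euc n → F) : ENNReal :=
  (∫⁻ x in Ω, ENNReal.ofReal (‖g x‖ ^ (n + 1))) +
    ∫⁻ x in Ω, ∫⁻ y in Ω, ENNReal.ofReal (((dist x y)⁻¹) ^ (2 * n) * ‖g x - g y‖ ^ (n + 1))

lemma NN_smul {n : ℕ} (Ω : Set (Euc n)) (g : Euc n → ℝ) {l : ℝ} (hl : 0 < l) :
    NN Ω (fun x => l * g x) = ENNReal.ofReal (l ^ (n + 1)) * NN Ω g := by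
  unfold NN
  have hp : 0 ≤ l ^ (n + 1) := by positivity
  rw [mul_add, ← lintegral_const_mul' _ _ ENNReal.ofReal_ne_top,
    ← lintegral_const_mul' _ _ ENNReal.ofReal_ne_top]
  congr 1
  · refine lintegral_congr fun x => ?_
    rw [← ENNReal.ofReal_mul hp, norm_mul, mul_pow, Real.norm_of_nonneg hl.le]
  · refine lintegral_congr fun x => ?_
    rw [← lintegral_const_mul' _ _ ENNReal.ofReal_ne_top]
    refine lintegral_congr fun y => ?_
    rw [← ENNReal.ofReal_mul hp, ← mul_sub, norm_mul, mul_pow, Real.norm_of_nonneg hl.le]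
    congr 1
    ring

lemma meas_dbl {n : ℕ} {F : Type*} [NormedAddCommGroup F] {Ω : Set (Euc n)} (hΩ : IsOpen Ω)
    {g : Euc n → F} (hg : ContinuousOn g Ω) :
    AEMeasurable (fun q : Euc n × Euc n => ((dist q.1 q.2)⁻¹) ^ (2 * n) * ‖g q.1 - g q.2‖ ^ (n + 1))
      ((volume.restrict Ω).prod (volume.restrict Ω)) := by
  refine AEMeasurable.mul ?_ ?_
  · exact ((continuous_dist.measurable.inv).pow_const _).aemeasurable
  · refine AEMeasurable.pow_const ?_ _
    have h : ContinuousOn (fun q : Euc n × Euc n => ‖g q.1 - g q.2‖) (Ω ×ˢ Ω) :=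
      ((hg.comp continuous_fst.continuousOn fun q hq => hq.1).sub
        (hg.comp continuous_snd.continuousOn fun q hq => hq.2)).norm
    rw [Measure.prod_restrict]
    exact h.aemeasurable (hΩ.measurableSet.prod hΩ.measurableSet)

lemma meas_row {n : ℕ} {F : Type*} [NormedAddCommGroup F] {Ω : Set (Euc n)} (hΩ : IsOpen Ω)
    {g : Euc n → F} (hg : ContinuousOn g Ω) (x : Euc n) :
    AEMeasurable (fun y : Euc n => ((dist x y)⁻¹) ^ (2 * n) * ‖g x - g y‖ ^ (n + 1))
      (volume.restrict Ω) := by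
  refine AEMeasurable.mul ?_ ?_
  · have : Measurable fun y : Euc n => dist x y := (continuous_const.dist continuous_id).measurable
    exact ((this.inv).pow_const _).aemeasurable
  · refine AEMeasurable.pow_const ?_ _
    exact ((continuousOn_const.sub hg).norm).aemeasurable hΩ.measurableSet

lemma EO_le {n : ℕ} {Ω : Set (Euc n)} (hΩ : IsOpen Ω) {f : Fin (n + 1) → Euc n → ℝ}
    (hf : ∀ j, ContinuousOn (f j) Ω) :
    (∫⁻ x in Ω, ENNReal.ofReal (|f 0 x| ^ (n + 1))) + EO Ω f ≤ 2 * ∑ j, NN Ω (f j) := by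
  have h1 : (∫⁻ x in Ω, ENNReal.ofReal (|f 0 x| ^ (n + 1))) ≤ ∑ j, NN Ω (f j) := by
    refine le_trans ?_ (Finset.single_le_sum (f := fun j => NN Ω (f j)) (fun _ _ => zero_le)
      (Finset.mem_univ 0))
    exact le_self_add
  have h2 : EO Ω f ≤ ∑ j, NN Ω (f j) := by
    have : EO Ω f = ∑ j, ∫⁻ x in Ω, ∫⁻ y in Ω,
        ENNReal.ofReal (((dist x y)⁻¹) ^ (2 * n) * ‖f j x - f j y‖ ^ (n + 1)) := by
      rw [← lintegral_finsetSum' _ fun j _ =>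
        ((meas_dbl hΩ (hf j)).ennreal_ofReal).lintegral_prod_right']
      refine lintegral_congr fun x => ?_
      rw [← lintegral_finsetSum' _ fun j _ => (meas_row hΩ (hf j) x).ennreal_ofReal]
      refine lintegral_congr fun y => ?_
      rw [← ENNReal.ofReal_sum_of_nonneg fun j _ => by positivity]
      unfold osc
      rw [Finset.mul_sum]
      congr 1
      refine Finset.sum_congr rfl fun j _ => ?_
      rw [Real.norm_eq_abs, abs_sub_comm]
    rw [this]
    exact Finset.sum_le_sum fun j _ => le_add_self
  rw [two_mul]
  exact add_le_add h1 h2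

lemma gmat_scale {n : ℕ} (w : Fin n → Euc n → ℝ) (l : Fin n → ℝ) (x : Euc n) :
    (gmat n (fun j x => l j * w j x) x).det = (∏ j, l j) * (gmat n w x).det := by
  have : gmat n (fun j x => l j * w j x) x = Matrix.of fun i j => l i * gmat n w x i j := by
    ext i j
    simp only [gmat, Matrix.of_apply]
    have := congrFun (fderiv_const_smul_field (𝕜 := ℝ) (f := w i) (l i)) x
    have h2 : (fun x => l i * w i x) = l i • w i := rfl
    rw [h2, this]
    simp
  rw [this, Matrix.det_mul_column]

theorem core2 {n : ℕ} (hn : 2 ≤ n) {Ω : Set (Euc n)} {ρ : Euc n → ℝ} {L c : ℝ}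
    (H : Bdy n Ω ρ L c) : ∃ C : ℝ, 0 < C ∧ ∀ (ψ : Euc n → ℝ) (w : Fin n → Euc n → ℝ)
      (t0 : ℝ) (t : Fin n → ℝ),
      Cc1 n Ω ψ → (∀ j, ContDiffOn ℝ 1 (w j) Ω) → 0 < t0 → (∀ j, 0 < t j) →
      NN Ω ψ ≤ ENNReal.ofReal (t0 ^ (n + 1)) →
      (∀ j, NN Ω (w j) ≤ ENNReal.ofReal (t j ^ (n + 1))) →
      |∫ x, ψ x * (gmat n w x).det| ≤ C * (t0 * ∏ j, t j) := by
  obtain ⟨C, hC, h1⟩ := core1 hn H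
  refine ⟨C * (2 * (n + 1)), by positivity, ?_⟩
  intro ψ w t0 t hψ hw ht0 ht hN0 hN
  have hsc : ∀ (g : Euc n → ℝ) (t : ℝ), 0 < t → NN Ω g ≤ ENNReal.ofReal (t ^ (n + 1)) →
      NN Ω (fun x => t⁻¹ * g x) ≤ 1 := by
    intro g t ht h
    rw [NN_smul Ω g (inv_pos.2 ht)]
    refine (mul_le_mul_right h _).trans (le_of_eq ?_)
    rw [← ENNReal.ofReal_mul (by positivity), ← mul_pow, inv_mul_cancel₀ ht.ne', one_pow,
      ENNReal.ofReal_one]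
  set ψ' : Euc n → ℝ := fun x => t0⁻¹ * ψ x with hψ'
  set w' : Fin n → Euc n → ℝ := fun j x => (t j)⁻¹ * w j x with hw'
  have c1 : Cc1 n Ω ψ' := by
    have hts : tsupport ψ' ⊆ tsupport ψ := closure_mono fun x hx h => hx (by
      show t0⁻¹ * ψ x = 0
      rw [h, mul_zero])
    exact ⟨contDiff_const.mul hψ.1, hψ.2.1.mul_left, hts.trans hψ.2.2⟩
  have c2 : ∀ j, ContDiffOn ℝ 1 (w' j) Ω := fun j => contDiffOn_const.mul (hw j)
  have hf : ∀ j, ContinuousOn ((Fin.cons ψ' w' : Fin (n + 1) → Euc n → ℝ) j) Ω := by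
    intro j
    refine Fin.cases ?_ (fun j => ?_) j
    · exact c1.1.continuous.continuousOn
    · exact (c2 j).continuousOn
  have hN1 : ∀ j, NN Ω ((Fin.cons ψ' w' : Fin (n + 1) → Euc n → ℝ) j) ≤ 1 := by
    intro j
    refine Fin.cases ?_ (fun j => ?_) j
    · exact hsc _ _ ht0 hN0
    · exact hsc _ _ (ht j) (hN j)
  have h2 := (h1 ψ' w' c1 c2).trans (mul_le_mul_right (EO_le H.isOpen hf) _)
  have h3 : (2 : ENNReal) * ∑ j, NN Ω ((Fin.cons ψ' w' : Fin (n + 1) → Euc n → ℝ) j) ≤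
      ENNReal.ofReal (2 * (n + 1)) := by
    have : ∑ j, NN Ω ((Fin.cons ψ' w' : Fin (n + 1) → Euc n → ℝ) j) ≤ ((n + 1 : ℕ) : ENNReal) := by
      refine (Finset.sum_le_sum fun j _ => hN1 j).trans (le_of_eq ?_)
      simp
    refine (mul_le_mul_right this _).trans (le_of_eq ?_)
    rw [ENNReal.ofReal_mul (by norm_num)]
    have : (n : ℝ) + 1 = ((n + 1 : ℕ) : ℝ) := by push_cast; ring
    rw [this, ENNReal.ofReal_natCast]
    simp
  have h4 := h2.trans (mul_le_mul_right h3 _)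
  rw [← ENNReal.ofReal_mul hC.le, ENNReal.ofReal_le_ofReal_iff (by positivity)] at h4
  have h5 : ∫ x, ψ' x * (gmat n w' x).det =
      (t0⁻¹ * ∏ j, (t j)⁻¹) * ∫ x, ψ x * (gmat n w x).det := by
    rw [← integral_const_mul]
    congr 1
    funext x
    rw [hw', gmat_scale]
    simp only [hψ']
    ring
  have hP : 0 < ∏ j, t j := Finset.prod_pos fun j _ => ht j
  rw [h5, abs_mul, Finset.prod_inv_distrib, abs_of_pos (by positivity), ← mul_inv,
    inv_mul_le_iff₀ (by positivity)] at h4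
  linarith

theorem core3 {n : ℕ} (hn : 2 ≤ n) {Ω : Set (Euc n)} {ρ : Euc n → ℝ} {L c : ℝ}
    (H : Bdy n Ω ρ L c) : ∃ C : ℝ, 0 < C ∧ ∀ (ψ : Euc n → ℝ) (w : Fin n → Euc n → ℝ)
      (t0 : ℝ) (t : Fin n → ℝ),
      Cc1 n Ω ψ → (∀ j, ContDiffOn ℝ 1 (w j) Ω) → 0 ≤ t0 → (∀ j, 0 ≤ t j) →
      NN Ω ψ ≤ ENNReal.ofReal (t0 ^ (n + 1)) →
      (∀ j, NN Ω (w j) ≤ ENNReal.ofReal (t j ^ (n + 1))) →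
      |∫ x, ψ x * (gmat n w x).det| ≤ C * (t0 * ∏ j, t j) := by
  obtain ⟨C, hC, h1⟩ := core2 hn H
  refine ⟨C, hC, ?_⟩
  intro ψ w t0 t hψ hw ht0 ht hN0 hN
  have hc : Tendsto (fun e : ℝ => C * ((t0 + e) * ∏ j, (t j + e))) (𝓝[>] 0)
      (𝓝 (C * ((t0 + 0) * ∏ j, (t j + 0)))) := by
    have : Continuous fun e : ℝ => C * ((t0 + e) * ∏ j, (t j + e)) := by fun_prop
    exact (this.tendsto 0).mono_left nhdsWithin_le_nhds
  simp only [add_zero] at hc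
  refine ge_of_tendsto hc ?_
  filter_upwards [self_mem_nhdsWithin] with e he
  have he : 0 < e := he
  refine h1 ψ w _ _ hψ hw (by positivity) (fun j => by have := ht j; positivity)
    (hN0.trans (ENNReal.ofReal_le_ofReal ?_)) (fun j => (hN j).trans (ENNReal.ofReal_le_ofReal ?_))
  · gcongr; linarith
  · have := ht j
    gcongr; linarith

lemma kernel_fin {n : ℕ} (hn : 2 ≤ n) (R : ℝ) :
    ∫⁻ z in ball (0 : Euc n) R, ENNReal.ofReal ((‖z‖⁻¹) ^ (n - 1)) < ⊤ := by
  have : Nontrivial (Euc n) := by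
    have : Nonempty (Fin n) := ⟨⟨0, by omega⟩⟩
    infer_instance
  have h := (integrableOn_fun_norm_addHaar (E := Euc n) (volume : Measure (Euc n))
    (f := fun t : ℝ => (t⁻¹) ^ (n - 1)) (r := R)).2 (by
      have hd : Module.finrank ℝ (Euc n) = n := by simp
      rw [hd]
      have : Set.EqOn (fun _ : ℝ => (1 : ℝ)) (fun y : ℝ => y ^ (n - 1) • (y⁻¹) ^ (n - 1))
          (Set.Ioo 0 R) := by
        intro y hy
        have : y ≠ 0 := hy.1.ne'
        simp only [smul_eq_mul]
        rw [← mul_pow, mul_inv_cancel₀ this, one_pow]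
      refine IntegrableOn.congr_fun ?_ this measurableSet_Ioo
      exact integrableOn_const (by simp))
  exact h.lintegral_lt_top

lemma kernel_bound {n : ℕ} (hn : 2 ≤ n) {Ω : Set (Euc n)} (hΩb : Bornology.IsBounded Ω) :
    ∃ M : ENNReal, M < ⊤ ∧ ∀ x ∈ Ω, ∫⁻ y in Ω, ENNReal.ofReal (((dist x y)⁻¹) ^ (n - 1)) ≤ M := by
  obtain ⟨R, hR⟩ := hΩb.subset_ball (0 : Euc n)
  refine ⟨_, kernel_fin hn (2 * R), fun x hx => ?_⟩
  have hsub : Ω ⊆ ball x (2 * R) := by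
    intro y hy
    have h1 := hR hx
    have h2 := hR hy
    rw [mem_ball] at *
    calc dist y x ≤ dist y 0 + dist 0 x := dist_triangle _ _ _
      _ < 2 * R := by rw [dist_comm 0 x]; linarith
  refine (lintegral_mono_set hsub).trans (le_of_eq ?_)
  rw [← lintegral_indicator measurableSet_ball, ← lintegral_indicator measurableSet_ball,
    ← lintegral_sub_left_eq_self ((ball (0 : Euc n) (2 * R)).indicator _) x]
  refine lintegral_congr fun y => ?_
  by_cases hy : y ∈ ball x (2 * R)
  · have hy2 : x - y ∈ ball (0 : Euc n) (2 * R) := by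
      rw [mem_ball_zero_iff, ← dist_eq_norm, dist_comm]; exact hy
    rw [Set.indicator_of_mem hy, Set.indicator_of_mem hy2, dist_eq_norm]
  · have hy2 : x - y ∉ ball (0 : Euc n) (2 * R) := by
      rw [mem_ball_zero_iff, ← dist_eq_norm, dist_comm]; exact hy
    rw [Set.indicator_of_notMem hy, Set.indicator_of_notMem hy2]

/-- Lipschitz on a set, elementary form -/
def LipO {n : ℕ} {F : Type*} [NormedAddCommGroup F] (Ω : Set (Euc n)) (g : Euc n → F) : Prop :=
  ∃ K : ℝ, 0 ≤ K ∧ ∀ x ∈ Ω, ∀ y ∈ Ω, ‖g x - g y‖ ≤ K * dist x y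

lemma LipO.cont {n : ℕ} {F : Type*} [NormedAddCommGroup F] {Ω : Set (Euc n)} {g : Euc n → F}
    (h : LipO Ω g) : ContinuousOn g Ω := by
  obtain ⟨K, hK, h⟩ := h
  have : LipschitzOnWith ⟨K, hK⟩ g Ω := by
    refine LipschitzOnWith.of_dist_le_mul fun x hx y hy => ?_
    rw [dist_eq_norm]
    exact h x hx y hy
  exact this.continuousOn

lemma NN_row_bound {n : ℕ} (hn : 2 ≤ n) {F : Type*} [NormedAddCommGroup F] {Ω : Set (Euc n)}
    (hΩ : IsOpen Ω) (hΩb : Bornology.IsBounded Ω) {g : Euc n → F} (h : LipO Ω g) :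
    ∃ M : ENNReal, M < ⊤ ∧ ∀ x ∈ Ω, ∫⁻ y in Ω,
      ENNReal.ofReal (((dist x y)⁻¹) ^ (2 * n) * ‖g x - g y‖ ^ (n + 1)) ≤ M := by
  obtain ⟨K, hK, h⟩ := h
  obtain ⟨M, hM, hk⟩ := kernel_bound hn hΩb
  refine ⟨ENNReal.ofReal (K ^ (n + 1)) * M, ENNReal.mul_lt_top ENNReal.ofReal_lt_top hM,
    fun x hx => ?_⟩
  refine le_trans ?_ (mul_le_mul_right (hk x hx) _)
  rw [← lintegral_const_mul' _ _ ENNReal.ofReal_ne_top]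
  refine setLIntegral_mono_ae' hΩ.measurableSet (Eventually.of_forall fun y hy => ?_)
  rw [← ENNReal.ofReal_mul (by positivity)]
  refine ENNReal.ofReal_le_ofReal ?_
  calc ((dist x y)⁻¹) ^ (2 * n) * ‖g x - g y‖ ^ (n + 1)
      ≤ ((dist x y)⁻¹) ^ (2 * n) * (K * dist x y) ^ (n + 1) := by
        gcongr; exact h x hx y hy
    _ = K ^ (n + 1) * (((dist x y)⁻¹) ^ (n - 1) * ((dist x y)⁻¹ * dist x y) ^ (n + 1)) := by
        have : 2 * n = (n - 1) + (n + 1) := by omega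
        rw [this, pow_add]; ring
    _ ≤ _ := by
        gcongr
        refine mul_le_of_le_one_right (by positivity) (pow_le_one₀ (by positivity) ?_)
        exact inv_mul_le_one

lemma NN_le {n : ℕ} (hn : 2 ≤ n) {F : Type*} [NormedAddCommGroup F] {Ω : Set (Euc n)}
    (hΩ : IsOpen Ω) (hΩb : Bornology.IsBounded Ω) {g : Euc n → F} (h : LipO Ω g) :
    0 ≤ sobNorm n ((n : ℝ) / ((n : ℝ) + 1)) ((n : ℝ) + 1) Ω g ∧
    NN Ω g ≤ ENNReal.ofReal
      (sobNorm n ((n : ℝ) / ((n : ℝ) + 1)) ((n : ℝ) + 1) Ω g ^ (n + 1)) := by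
  have hcont := h.cont
  have hΩm := hΩ.measurableSet
  have hvol : volume Ω ≠ ⊤ := hΩb.measure_lt_top.ne
  have hp : (n : ℝ) + 1 = ((n + 1 : ℕ) : ℝ) := by push_cast; ring
  have e1 : ∀ x, ‖g x‖ ^ ((n : ℝ) + 1) = ‖g x‖ ^ (n + 1) := fun x => by
    rw [hp, Real.rpow_natCast]
  have e2 : ∀ x y, ‖g x - g y‖ ^ ((n : ℝ) + 1) /
      dist x y ^ ((n : ℝ) + (n : ℝ) / ((n : ℝ) + 1) * ((n : ℝ) + 1)) =
      ((dist x y)⁻¹) ^ (2 * n) * ‖g x - g y‖ ^ (n + 1) := fun x y => by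
    have : (n : ℝ) + (n : ℝ) / ((n : ℝ) + 1) * ((n : ℝ) + 1) = ((2 * n : ℕ) : ℝ) := by
      have : (n : ℝ) + 1 ≠ 0 := by positivity
      push_cast
      field_simp
      ring
    rw [this, hp, Real.rpow_natCast, Real.rpow_natCast, inv_pow, div_eq_inv_mul]
  unfold sobNorm sobSemi
  simp only [e1, e2]
  set A : ℝ := ∫ x in Ω, ‖g x‖ ^ (n + 1) with hA
  set D : ℝ := ∫ x in Ω, ∫ y in Ω, ((dist x y)⁻¹) ^ (2 * n) * ‖g x - g y‖ ^ (n + 1) with hD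
  have hA0 : 0 ≤ A := integral_nonneg fun x => by positivity
  have hD0 : 0 ≤ D := integral_nonneg fun x => integral_nonneg fun y => by positivity
  refine ⟨by positivity, ?_⟩
  -- `L^p` part
  obtain ⟨B, hB⟩ : ∃ B : ℝ, ∀ x ∈ Ω, ‖g x‖ ≤ B := by
    obtain ⟨K, hK, hl⟩ := h
    rcases Ω.eq_empty_or_nonempty with he | ⟨x0, hx0⟩
    · exact ⟨0, by simp [he]⟩
    · obtain ⟨R, hR⟩ := hΩb.subset_ball x0
      refine ⟨‖g x0‖ + K * R, fun x hx => ?_⟩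
      have h1 := hl x hx x0 hx0
      have h2 := hR hx
      rw [mem_ball] at h2
      have h3 : K * dist x x0 ≤ K * R := by gcongr
      have h4 := norm_le_insert' (g x) (g x0)
      linarith
  have hAi : IntegrableOn (fun x => ‖g x‖ ^ (n + 1)) Ω := by
    refine IntegrableOn.of_bound hvol.lt_top ?_ (B ^ (n + 1)) ?_
    · exact (hcont.norm.pow _).aestronglyMeasurable hΩm
    · refine (ae_restrict_iff' hΩm).2 (Eventually.of_forall fun x hx => ?_)
      rw [Real.norm_of_nonneg (by positivity)]
      have := hB x hx
      gcongr
  have hA1 : ∫⁻ x in Ω, ENNReal.ofReal (‖g x‖ ^ (n + 1)) = ENNReal.ofReal A :=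
    (ofReal_integral_eq_lintegral_ofReal hAi (Eventually.of_forall fun x => by positivity)).symm
  -- double part
  obtain ⟨M, hM, hrow⟩ := NN_row_bound hn hΩ hΩb h
  have hri : ∀ x ∈ Ω, IntegrableOn
      (fun y => ((dist x y)⁻¹) ^ (2 * n) * ‖g x - g y‖ ^ (n + 1)) Ω := by
    intro x hx
    refine ⟨(meas_row hΩ hcont x).aestronglyMeasurable, ?_⟩
    rw [hasFiniteIntegral_iff_ofReal (Eventually.of_forall fun y => by positivity)]
    exact (hrow x hx).trans_lt hM
  have hr2 : ∀ x ∈ Ω, ∫⁻ y in Ω,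
      ENNReal.ofReal (((dist x y)⁻¹) ^ (2 * n) * ‖g x - g y‖ ^ (n + 1)) =
      ENNReal.ofReal (∫ y in Ω, ((dist x y)⁻¹) ^ (2 * n) * ‖g x - g y‖ ^ (n + 1)) := fun x hx =>
    (ofReal_integral_eq_lintegral_ofReal (hri x hx)
      (Eventually.of_forall fun x => by positivity)).symm
  have hDi : IntegrableOn
      (fun x => ∫ y in Ω, ((dist x y)⁻¹) ^ (2 * n) * ‖g x - g y‖ ^ (n + 1)) Ω := by
    refine ⟨(meas_dbl hΩ hcont).aestronglyMeasurable.integral_prod_right', ?_⟩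
    rw [hasFiniteIntegral_iff_ofReal (Eventually.of_forall fun x =>
      integral_nonneg fun y => by positivity)]
    rw [← setLIntegral_congr_fun hΩm hr2]
    calc _ ≤ ∫⁻ x in Ω, M := setLIntegral_mono_ae' hΩm (Eventually.of_forall hrow)
      _ = M * volume Ω := setLIntegral_const _ _
      _ < ⊤ := ENNReal.mul_lt_top hM hvol.lt_top
  have hD1 : ∫⁻ x in Ω, ∫⁻ y in Ω,
      ENNReal.ofReal (((dist x y)⁻¹) ^ (2 * n) * ‖g x - g y‖ ^ (n + 1)) = ENNReal.ofReal D := by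
    rw [setLIntegral_congr_fun hΩm hr2]
    exact (ofReal_integral_eq_lintegral_ofReal hDi
      (Eventually.of_forall fun x => integral_nonneg fun y => by positivity)).symm
  unfold NN
  rw [hA1, hD1, ← ENNReal.ofReal_add hA0 hD0]
  refine ENNReal.ofReal_le_ofReal ?_
  have hroot : ∀ a : ℝ, 0 ≤ a → (a ^ (1 / ((n : ℝ) + 1))) ^ (n + 1) = a := by
    intro a ha
    rw [hp, one_div, Real.rpow_inv_natCast_pow ha (by omega)]
  calc A + D = (A ^ (1 / ((n : ℝ) + 1))) ^ (n + 1) + (D ^ (1 / ((n : ℝ) + 1))) ^ (n + 1) := by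
        rw [hroot A hA0, hroot D hD0]
    _ ≤ _ := pow_add_pow_le (by positivity) (by positivity) (by omega)

lemma NN_mono {n : ℕ} {F G : Type*} [NormedAddCommGroup F] [NormedAddCommGroup G]
    (Ω : Set (Euc n)) {g : Euc n → F} {k : Euc n → G} (h1 : ∀ x, ‖g x‖ ≤ ‖k x‖)
    (h2 : ∀ x y, ‖g x - g y‖ ≤ ‖k x - k y‖) : NN Ω g ≤ NN Ω k := by
  unfold NN
  refine add_le_add (lintegral_mono fun x => ?_)
    (lintegral_mono fun x => lintegral_mono fun y => ?_)
  · have := h1 x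
    exact ENNReal.ofReal_le_ofReal (by gcongr)
  · have := h2 x y
    exact ENNReal.ofReal_le_ofReal (by gcongr)

lemma path_exists {n : ℕ} {Ω : Set (Euc n)} {ρ : Euc n → ℝ} {L c : ℝ} (H : Bdy n Ω ρ L c)
    (x0 : Euc n) (hx0 : x0 ∈ closure Ω) :
    ∃ N : ℝ, 0 ≤ N ∧ ∀ r1 > 0, ∃ r > 0, ∀ x ∈ Ω ∩ ball x0 r, ∀ y ∈ Ω ∩ ball x0 r, ∃ z,
      dist x z ≤ N * dist x y ∧ dist y z ≤ N * dist x y ∧ segment ℝ x z ⊆ Ω ∩ ball x0 r1 ∧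
      segment ℝ y z ⊆ Ω ∩ ball x0 r1 := by
  by_cases hx : x0 ∈ Ω
  · refine ⟨1, zero_le_one, fun r1 hr1 => ?_⟩
    obtain ⟨e, he, hb⟩ := Metric.isOpen_iff.1 H.isOpen x0 hx
    refine ⟨min e r1, lt_min he hr1, fun x hx y hy => ⟨y, by simp, by simp, ?_, ?_⟩⟩
    · refine ((convex_ball x0 (min e r1)).segment_subset hx.2 hy.2).trans ?_
      exact Set.subset_inter ((ball_subset_ball (min_le_left _ _)).trans hb)
        (ball_subset_ball (min_le_right _ _))
    · refine ((convex_ball x0 (min e r1)).segment_subset hy.2 hy.2).trans ?_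
      exact Set.subset_inter ((ball_subset_ball (min_le_left _ _)).trans hb)
        (ball_subset_ball (min_le_right _ _))
  · have hρ0 : ρ x0 ≤ 0 := not_lt.1 (mt (H.pos x0).2 hx)
    have hne : fderiv ℝ ρ x0 ≠ 0 := by
      intro h0
      have := H.low x0 hx0
      simp [h0] at this
      have := H.cpos
      linarith
    obtain ⟨ν0, hν0⟩ : ∃ ν, fderiv ℝ ρ x0 ν ≠ 0 := by
      by_contra! h
      exact hne (ContinuousLinearMap.ext h)
    obtain ⟨ν, hν⟩ : ∃ ν, fderiv ℝ ρ x0 ν = 1 :=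
      ⟨(fderiv ℝ ρ x0 ν0)⁻¹ • ν0, by rw [map_smul, smul_eq_mul, inv_mul_cancel₀ hν0]⟩
    have hcf : Continuous fun p => fderiv ℝ ρ p ν :=
      (H.cd.continuous_fderiv (by norm_num)).clm_apply continuous_const
    obtain ⟨r2, hr2, hb2⟩ : ∃ r2 > 0, ∀ p ∈ ball x0 r2, 1 / 2 < fderiv ℝ ρ p ν := by
      have := hcf.continuousAt.eventually_const_lt (show 1 / 2 < fderiv ℝ ρ x0 ν by
        rw [hν]; norm_num)
      obtain ⟨r2, hr2, h⟩ := Metric.eventually_nhds_iff_ball.1 this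
      exact ⟨r2, hr2, h⟩
    refine ⟨1 / 2 + ‖ν‖, by positivity, fun r1 hr1 => ?_⟩
    set R := min r1 r2 with hR
    have hRp : 0 < R := lt_min hr1 hr2
    refine ⟨R / (2 + 2 * ‖ν‖), by positivity, ?_⟩
    set r := R / (2 + 2 * ‖ν‖) with hr
    have hrp : 0 < r := by positivity
    have hrR : r * (2 + 2 * ‖ν‖) = R := by
      rw [hr]; field_simp
    -- the one-sided statement
    have key : ∀ x ∈ Ω ∩ ball x0 r, ∀ y ∈ Ω ∩ ball x0 r, ∀ z,
        z = (1 / 2 : ℝ) • (x + y) + dist x y • ν →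
        dist x z ≤ (1 / 2 + ‖ν‖) * dist x y ∧ segment ℝ x z ⊆ Ω ∩ ball x0 r1 := by
      intro x hx y hy z hz
      have hd : dist x y < 2 * r := by
        have h1 := mem_ball.1 hx.2
        have h2 := mem_ball.1 hy.2
        have := dist_triangle_right x y x0
        linarith
      have hzx : z - x = (1 / 2 : ℝ) • (y - x) + dist x y • ν := by
        rw [hz]; module
      have hn1 : dist x z ≤ (1 / 2 + ‖ν‖) * dist x y := by
        rw [dist_comm x z, dist_eq_norm, hzx]
        refine (norm_add_le _ _).trans (le_of_eq ?_)
        rw [norm_smul, norm_smul, ← dist_eq_norm, dist_comm y x, Real.norm_of_nonneg dist_nonneg]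
        norm_num
        ring
      have hN : 0 ≤ ‖ν‖ := norm_nonneg ν
      have hxR : x ∈ ball x0 R := by
        refine ball_subset_ball ?_ hx.2
        nlinarith
      have hzR : z ∈ ball x0 R := by
        rw [mem_ball]
        have h1 := mem_ball.1 hx.2
        have h2 := dist_triangle_left z x0 x
        have h3 : (1 / 2 + ‖ν‖) * dist x y ≤ (1 / 2 + ‖ν‖) * (2 * r) := by gcongr
        nlinarith
      have hsegR : segment ℝ x z ⊆ ball x0 R := (convex_ball x0 R).segment_subset hxR hzR
      refine ⟨hn1, fun q hq => ⟨?_, ball_subset_ball (min_le_left _ _) (hsegR hq)⟩⟩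
      obtain ⟨p, hp, hpe⟩ := domain_mvt (f := ρ) (s := Set.univ) (x := x) (y := q)
        (f' := fun p => fderiv ℝ ρ p)
        (fun p _ => ((H.cd.differentiable (by norm_num)) p).hasFDerivAt.hasFDerivWithinAt)
        convex_univ (Set.mem_univ _) (Set.mem_univ _)
      have hpR : p ∈ ball x0 R :=
        (convex_ball x0 R).segment_subset hxR (hsegR hq) hp
      have hp2 := hb2 p (ball_subset_ball (min_le_right _ _) hpR)
      have hge : 0 ≤ fderiv ℝ ρ p (q - x) := by
        rw [segment_eq_image'] at hq
        obtain ⟨s, hs, rfl⟩ := hq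
        have : x + s • (z - x) - x = s • (z - x) := by module
        simp only [this]
        rw [map_smul, smul_eq_mul]
        refine mul_nonneg hs.1 ?_
        rw [hzx, map_add, map_smul, map_smul, smul_eq_mul, smul_eq_mul]
        have h5 : |fderiv ℝ ρ p (y - x)| ≤ 1 / 2 * dist x y := by
          have h6 := (fderiv ℝ ρ p).le_opNorm (y - x)
          rw [Real.norm_eq_abs, ← dist_eq_norm, dist_comm y x] at h6
          exact h6.trans (mul_le_mul_of_nonneg_right (H.d1 p) dist_nonneg)
        have h7 := (abs_le.1 h5).1
        have h8 : dist x y * (1 / 2) ≤ dist x y * fderiv ℝ ρ p ν := by gcongr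
        have h9 : 0 ≤ dist x y := dist_nonneg
        linarith
      have h0 := (H.pos x).1 hx.1
      exact (H.pos q).2 (by rw [hpe.symm] at hge; linarith)
    intro x hx y hy
    refine ⟨(1 / 2 : ℝ) • (x + y) + dist x y • ν, ?_⟩
    have k1 := key x hx y hy _ rfl
    have k2 := key y hy x hx ((1 / 2 : ℝ) • (x + y) + dist x y • ν) (by
      rw [add_comm x y, dist_comm x y])
    rw [dist_comm y x] at k2
    exact ⟨k1.1, k2.1, k1.2, k2.2⟩

lemma lip_local {n : ℕ} {F : Type*} [NormedAddCommGroup F] [NormedSpace ℝ F]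
    {Ω : Set (Euc n)} {ρ : Euc n → ℝ} {L c : ℝ}
    (H : Bdy n Ω ρ L c) {u : Euc n → F} (hu : ContDiffOn ℝ 1 u (closure Ω))
    (x0 : Euc n) (hx0 : x0 ∈ closure Ω) :
    ∃ K : ℝ, 0 ≤ K ∧ ∃ r > 0, ∀ x ∈ Ω ∩ ball x0 r, ∀ y ∈ Ω ∩ ball x0 r,
      ‖u x - u y‖ ≤ K * dist x y := by
  have h1 : ContDiffWithinAt ℝ (0 + 1) u (closure Ω) x0 := by
    rw [zero_add]; exact hu x0 hx0
  obtain ⟨W, hW, -, -, f', hf', hc⟩ :=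
    (contDiffWithinAt_succ_iff_hasFDerivWithinAt' (by simp)).1 h1
  rw [Set.insert_eq_of_mem hx0] at hW
  have hc' : ContinuousWithinAt f' (closure Ω) x0 := hc.continuousWithinAt
  have hb : ∀ᶠ x in 𝓝[closure Ω] x0, ‖f' x‖ < ‖f' x0‖ + 1 :=
    hc'.norm.eventually (gt_mem_nhds (by linarith))
  obtain ⟨r1, hr1, hr1b⟩ := Metric.mem_nhdsWithin_iff.1 (inter_mem hW hb)
  obtain ⟨N, hN, hpath⟩ := path_exists H x0 hx0
  obtain ⟨r, hr, hz⟩ := hpath r1 hr1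
  set K := ‖f' x0‖ + 1 with hK
  have hKp : 0 ≤ K := by positivity
  refine ⟨2 * (K * N), by positivity, r, hr, fun x hx y hy => ?_⟩
  obtain ⟨z, hxz, hyz, s1, s2⟩ := hz x hx y hy
  have seg : ∀ a, segment ℝ a z ⊆ Ω ∩ ball x0 r1 → dist a z ≤ N * dist x y →
      ‖u z - u a‖ ≤ K * (N * dist x y) := by
    intro a hs ha
    have hin : ∀ p ∈ segment ℝ a z, p ∈ W ∧ ‖f' p‖ < K := fun p hp =>
      hr1b ⟨(hs hp).2, subset_closure (hs hp).1⟩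
    have := (convex_segment a z).norm_image_sub_le_of_norm_hasFDerivWithin_le (f := u) (f' := f')
      (C := K) (𝕜 := ℝ)
      (fun p hp => (hf' p (hin p hp).1).mono fun q hq => subset_closure (hs hq).1)
      (fun p hp => (hin p hp).2.le) (left_mem_segment ℝ a z) (right_mem_segment ℝ a z)
    refine this.trans ?_
    rw [← dist_eq_norm, dist_comm z a]
    gcongr
  have e1 := seg x s1 hxz
  have e2 := seg y s2 hyz
  have : u x - u y = (u z - u y) - (u z - u x) := by abel
  rw [this]
  refine (norm_sub_le _ _).trans ?_
  linarith

lemma lip_global {n : ℕ} {F : Type*} [NormedAddCommGroup F] [NormedSpace ℝ F]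
    {Ω : Set (Euc n)} {ρ : Euc n → ℝ} {L c : ℝ} (hΩb : Bornology.IsBounded Ω)
    (H : Bdy n Ω ρ L c) {u : Euc n → F} (hu : ContDiffOn ℝ 1 u (closure Ω)) : LipO Ω u := by
  have hcomp : IsCompact (closure Ω) := hΩb.isCompact_closure
  have hP : ∃ K : ℝ, 0 ≤ K ∧ ∃ δ > 0, ∀ x ∈ Ω ∩ closure Ω, ∀ y ∈ Ω, dist x y < δ →
      ‖u x - u y‖ ≤ K * dist x y := by
    refine hcomp.induction_on (p := fun s => ∃ K : ℝ, 0 ≤ K ∧ ∃ δ > 0, ∀ x ∈ Ω ∩ s, ∀ y ∈ Ω,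
      dist x y < δ → ‖u x - u y‖ ≤ K * dist x y) ?_ ?_ ?_ ?_
    · exact ⟨0, le_rfl, 1, one_pos, fun x hx => absurd hx.2 (Set.notMem_empty _)⟩
    · rintro s t hst ⟨K, hK, δ, hδ, h⟩
      exact ⟨K, hK, δ, hδ, fun x hx => h x ⟨hx.1, hst hx.2⟩⟩
    · rintro s t ⟨K, hK, δ, hδ, h⟩ ⟨K', hK', δ', hδ', h'⟩
      refine ⟨max K K', le_max_of_le_left hK, min δ δ', lt_min hδ hδ', ?_⟩
      rintro x ⟨hx, hs | ht⟩ y hy hd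
      · refine (h x ⟨hx, hs⟩ y hy (hd.trans_le (min_le_left _ _))).trans ?_
        gcongr
        exact le_max_left _ _
      · refine (h' x ⟨hx, ht⟩ y hy (hd.trans_le (min_le_right _ _))).trans ?_
        gcongr
        exact le_max_right _ _
    · intro x0 hx0
      obtain ⟨K, hK, r, hr, h⟩ := lip_local H hu x0 hx0
      refine ⟨ball x0 (r / 2), mem_nhdsWithin_of_mem_nhds (ball_mem_nhds _ (by positivity)), K, hK,
        r / 2, by positivity, ?_⟩
      rintro x ⟨hx, hxb⟩ y hy hd
      rw [mem_ball] at hxb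
      refine h x ⟨hx, ?_⟩ y ⟨hy, ?_⟩
      · rw [mem_ball]; linarith
      · rw [mem_ball]
        have := dist_triangle_left y x0 x
        linarith
  obtain ⟨K, hK, δ, hδ, h⟩ := hP
  obtain ⟨B, hB⟩ := hcomp.exists_bound_of_continuousOn hu.continuousOn
  refine ⟨K + 2 * |B| / δ, by positivity, fun x hx y hy => ?_⟩
  have hd0 : 0 ≤ dist x y := dist_nonneg
  rcases lt_or_ge (dist x y) δ with hd | hd
  · refine (h x ⟨hx, subset_closure hx⟩ y hy hd).trans ?_
    gcongr
    have : 0 ≤ 2 * |B| / δ := by positivity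
    linarith
  · have h1 := (hB x (subset_closure hx)).trans (le_abs_self B)
    have h2 := (hB y (subset_closure hy)).trans (le_abs_self B)
    have h3 : 2 * |B| / δ * δ ≤ 2 * |B| / δ * dist x y := by gcongr
    rw [div_mul_cancel₀ _ hδ.ne'] at h3
    have h4 : 0 ≤ K * dist x y := by positivity
    have := norm_sub_le (u x) (u y)
    nlinarith

lemma integrable_pairing {n : ℕ} {Ω : Set (Euc n)} (hΩ : IsOpen Ω) {ψ : Euc n → ℝ}
    (hψ : Cc1 n Ω ψ) {w : Fin n → Euc n → ℝ} (hw : ∀ j, ContDiffOn ℝ 1 (w j) Ω) :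
    Integrable fun x => ψ x * (gmat n w x).det := by
  have hc : ContinuousOn (fun x => (gmat n w x).det) Ω := by
    simp only [Matrix.det_apply]
    refine continuousOn_finsetSum _ fun σ _ => ContinuousOn.const_smul ?_ _
    refine continuousOn_finsetProd _ fun i _ => ?_
    simp only [gmat, Matrix.of_apply]
    exact ((hw _).continuousOn_fderiv_of_isOpen hΩ le_rfl).clm_apply continuousOn_const
  have hcc : Continuous fun x => ψ x * (gmat n w x).det := by
    rw [continuous_iff_continuousAt]
    intro x
    by_cases hx : x ∈ tsupport ψ
    · exact hψ.1.continuous.continuousAt.mul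
        (hc.continuousAt (hΩ.mem_nhds (hψ.2.2 hx)))
    · have : (fun x => ψ x * (gmat n w x).det) =ᶠ[𝓝 x] fun _ => 0 := by
        filter_upwards [(isClosed_tsupport ψ).isOpen_compl.mem_nhds hx] with y hy
        rw [image_eq_zero_of_notMem_tsupport hy, zero_mul]
      exact continuousAt_const.congr this.symm
  exact hcc.integrable_of_hasCompactSupport hψ.2.1.mul_right

lemma jac_eq {n : ℕ} {u : Euc n → Euc n} {x : Euc n} (hu : DifferentiableAt ℝ u x) :
    jacMat n u x = gmat n (fun j x => u x j) x := by
  ext i j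
  simp only [jacMat, gmat, Matrix.of_apply]
  have h := ((EuclideanSpace.proj i : Euc n →L[ℝ] ℝ).hasFDerivAt.comp x
    hu.hasFDerivAt).fderiv
  have h2 : ((EuclideanSpace.proj i : Euc n →L[ℝ] ℝ) ∘ u) =
    fun x => u x i := rfl
  rw [h2] at h
  rw [h]
  rfl

lemma set_pairing {n : ℕ} {Ω : Set (Euc n)} (hΩ : IsOpen Ω) {ψ : Euc n → ℝ}
    (hψ : Cc1 n Ω ψ) {u : Euc n → Euc n} (hu : ContDiffOn ℝ 1 u Ω) :
    ∫ x in Ω, (jacMat n u x).det * ψ x = ∫ x, ψ x * (gmat n (fun j x => u x j) x).det := by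
  rw [setIntegral_congr_fun (g := fun x => ψ x * (gmat n (fun j x => u x j) x).det)
    hΩ.measurableSet]
  · refine setIntegral_eq_integral_of_forall_compl_eq_zero fun x hx => ?_
    rw [image_eq_zero_of_notMem_tsupport fun h => hx (hψ.2.2 h), zero_mul]
  · intro x hx
    show (jacMat n u x).det * ψ x = _
    rw [jac_eq ((hu.contDiffAt (hΩ.mem_nhds hx)).differentiableAt (by norm_num)), mul_comm]

lemma coord_norm_le {n : ℕ} (a : Euc n) (j : Fin n) : ‖a j‖ ≤ ‖a‖ := PiLp.norm_apply_le a j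

theorem main_est
    (n : ℕ) (hn : 2 ≤ n) (Ω : Set (Euc n)) (hΩo : IsOpen Ω)
    (hΩb : Bornology.IsBounded Ω) (hΩs : SmoothBoundary n Ω) :
    ∃ C : ℝ, 0 < C ∧ ∀ (u v : Euc n → Euc n) (ψ : Euc n → ℝ),
      ContDiffOn ℝ 1 u (closure Ω) → ContDiffOn ℝ 1 v (closure Ω) → Cc1 n Ω ψ →
      |(∫ x in Ω, (jacMat n u x).det * ψ x) - ∫ x in Ω, (jacMat n v x).det * ψ x| ≤
        C * sobNorm n ((n : ℝ) / ((n : ℝ) + 1)) ((n : ℝ) + 1) Ω (u - v) *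
          (sobNorm n ((n : ℝ) / ((n : ℝ) + 1)) ((n : ℝ) + 1) Ω u +
            sobNorm n ((n : ℝ) / ((n : ℝ) + 1)) ((n : ℝ) + 1) Ω v) ^ (n - 1) *
          sobNorm n ((n : ℝ) / ((n : ℝ) + 1)) ((n : ℝ) + 1) Ω ψ := by
  obtain ⟨ρ, L, c, H⟩ := exists_bdy n Ω hΩo hΩb hΩs
  obtain ⟨C, hC, hcore⟩ := core3 hn H
  refine ⟨n * C, by have : 0 < n := by omega
                    positivity, ?_⟩
  intro u v ψ hu hv hψ
  obtain ⟨u0, uN⟩ := NN_le hn hΩo hΩb (lip_global hΩb H hu)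
  obtain ⟨v0, vN⟩ := NN_le hn hΩo hΩb (lip_global hΩb H hv)
  obtain ⟨d0, dN⟩ := NN_le hn hΩo hΩb (lip_global hΩb H (hu.sub hv))
  obtain ⟨p0, pN⟩ := NN_le hn hΩo hΩb (lip_global hΩb H hψ.1.contDiffOn)
  change 0 ≤ sobNorm n _ _ Ω (u - v) at d0
  change NN Ω (u - v) ≤ ENNReal.ofReal (sobNorm n _ _ Ω (u - v) ^ (n + 1)) at dN
  set U := sobNorm n ((n : ℝ) / ((n : ℝ) + 1)) ((n : ℝ) + 1) Ω u
  set V := sobNorm n ((n : ℝ) / ((n : ℝ) + 1)) ((n : ℝ) + 1) Ω v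
  set D := sobNorm n ((n : ℝ) / ((n : ℝ) + 1)) ((n : ℝ) + 1) Ω (u - v)
  set P := sobNorm n ((n : ℝ) / ((n : ℝ) + 1)) ((n : ℝ) + 1) Ω ψ
  have huΩ : ContDiffOn ℝ 1 u Ω := hu.mono subset_closure
  have hvΩ : ContDiffOn ℝ 1 v Ω := hv.mono subset_closure
  rw [set_pairing hΩo hψ huΩ, set_pairing hΩo hψ hvΩ]
  set a : Fin n → Euc n → ℝ := fun j x => u x j with ha
  set b : Fin n → Euc n → ℝ := fun j x => v x j with hb
  have hac : ∀ j, ContDiffOn ℝ 1 (a j) Ω := fun j =>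
    (EuclideanSpace.proj j : Euc n →L[ℝ] ℝ).contDiff.comp_contDiffOn huΩ
  have hbc : ∀ j, ContDiffOn ℝ 1 (b j) Ω := fun j =>
    (EuclideanSpace.proj j : Euc n →L[ℝ] ℝ).contDiff.comp_contDiffOn hvΩ
  have htc : ∀ i j, ContDiffOn ℝ 1 (tele a b i j) Ω := by
    intro i j
    unfold tele
    split_ifs
    · exact hac j
    · exact (hac j).sub (hbc j)
    · exact hbc j
  have hgt : ∀ i, ∀ x ∈ Ω, gmat n (tele a b i) x =
      Matrix.of (tele (fun k => gmat n a x k) (fun k => gmat n b x k) i) := by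
    intro i x hx
    have dA : ∀ k, DifferentiableAt ℝ (a k) x := fun k =>
      ((hac k).contDiffAt (hΩo.mem_nhds hx)).differentiableAt (by norm_num)
    have dB : ∀ k, DifferentiableAt ℝ (b k) x := fun k =>
      ((hbc k).contDiffAt (hΩo.mem_nhds hx)).differentiableAt (by norm_num)
    ext k j
    simp only [gmat, tele, Matrix.of_apply]
    split_ifs with h1 h2
    · rfl
    · rw [fderiv_sub (dA k) (dB k)]; rfl
    · rfl
  have hsum : (∫ x, ψ x * (gmat n a x).det) - ∫ x, ψ x * (gmat n b x).det =
      ∑ i, ∫ x, ψ x * (gmat n (tele a b i) x).det := by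
    rw [← integral_sub (integrable_pairing hΩo hψ hac) (integrable_pairing hΩo hψ hbc),
      ← integral_finsetSum _ fun i _ => integrable_pairing hΩo hψ (htc i)]
    congr 1
    funext x
    by_cases hx : x ∈ Ω
    · rw [← mul_sub, det_sub_det, Finset.mul_sum]
      refine Finset.sum_congr rfl fun i _ => ?_
      rw [hgt i x hx]
    · rw [image_eq_zero_of_notMem_tsupport fun h => hx (hψ.2.2 h)]
      simp
  have hterm : ∀ i, |∫ x, ψ x * (gmat n (tele a b i) x).det| ≤ C * (P * (D * (U + V) ^ (n - 1))) := by
    intro i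
    have h := hcore ψ (tele a b i) P (fun j => if j = i then D else U + V) hψ (htc i) p0
      (fun j => by
        show 0 ≤ (if j = i then D else U + V)
        split_ifs
        · exact d0
        · positivity) pN (fun j => by
        show _ ≤ ENNReal.ofReal ((if j = i then D else U + V) ^ (n + 1))
        by_cases hji : j = i
        · have e : tele a b i j = fun x => (u - v) x j := by
            subst hji
            simp only [tele, lt_irrefl, if_true, if_false]
            rfl
          rw [if_pos hji, e]
          exact (NN_mono Ω (fun x => coord_norm_le _ j) fun x y =>
            coord_norm_le ((u - v) x - (u - v) y) j).trans dN
        · rw [if_neg hji]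
          by_cases hlt : j < i
          · have e : tele a b i j = fun x => u x j := by
              simp only [tele, hlt, if_true]; rfl
            rw [e]
            refine (NN_mono Ω (fun x => coord_norm_le _ j) fun x y =>
              coord_norm_le (u x - u y) j).trans (uN.trans (ENNReal.ofReal_le_ofReal ?_))
            gcongr
            linarith
          · have e : tele a b i j = fun x => v x j := by
              simp only [tele, hlt, hji, if_false]; rfl
            rw [e]
            refine (NN_mono Ω (fun x => coord_norm_le _ j) fun x y =>
              coord_norm_le (v x - v y) j).trans (vN.trans (ENNReal.ofReal_le_ofReal ?_))
            gcongr
            linarith)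
    have hprod : ∏ j, (if j = i then D else U + V) = D * (U + V) ^ (n - 1) := by
      rw [← Finset.mul_prod_erase Finset.univ _ (Finset.mem_univ i), if_pos rfl]
      congr 1
      rw [Finset.prod_congr rfl (g := fun _ => U + V) fun j hj => if_neg (Finset.ne_of_mem_erase hj),
        Finset.prod_const, Finset.card_erase_of_mem (Finset.mem_univ i), Finset.card_univ,
        Fintype.card_fin]
    rwa [hprod] at h
  rw [hsum]
  calc |∑ i, ∫ x, ψ x * (gmat n (tele a b i) x).det|
      ≤ ∑ i, |∫ x, ψ x * (gmat n (tele a b i) x).det| := Finset.abs_sum_le_sum_abs _ _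
    _ ≤ ∑ _i : Fin n, C * (P * (D * (U + V) ^ (n - 1))) := Finset.sum_le_sum fun i _ => hterm i
    _ = _ := by
      rw [Finset.sum_const, Finset.card_univ, Fintype.card_fin, nsmul_eq_mul]
      ring

/-- The `W^{n/(n+1),n+1}` estimate for distributional Jacobians. -/
theorem jacobian_estimate_W_n_over_n_plus_one
    (n : ℕ) (hn : 2 ≤ n) (Ω : Set (Euc n)) (hΩo : IsOpen Ω)
    (hΩb : Bornology.IsBounded Ω) (hΩs : SmoothBoundary n Ω) :
    ∃ C : ℝ, 0 < C ∧ ∀ (u v : Euc n → Euc n) (ψ : Euc n → ℝ),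
      ContDiffOn ℝ 1 u (closure Ω) → ContDiffOn ℝ 1 v (closure Ω) → Cc1 n Ω ψ →
      |(∫ x in Ω, (jacMat n u x).det * ψ x) - ∫ x in Ω, (jacMat n v x).det * ψ x| ≤
        C * sobNorm n ((n : ℝ) / ((n : ℝ) + 1)) ((n : ℝ) + 1) Ω (u - v) *
          (sobNorm n ((n : ℝ) / ((n : ℝ) + 1)) ((n : ℝ) + 1) Ω u +
            sobNorm n ((n : ℝ) / ((n : ℝ) + 1)) ((n : ℝ) + 1) Ω v) ^ (n - 1) *
          sobNorm n ((n : ℝ) / ((n : ℝ) + 1)) ((n : ℝ) + 1) Ω ψ :=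
  main_est n hn Ω hΩo hΩb hΩs

end
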